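/- arXiv:2309.06872 — 12 statements merged into one kernel-verified Lean document; each statement's English description precedes it below -/
import Mathlib

section
/- Let P(x) ∈ F_{q^2}[x] be an irreducible polynomial of degree m. Then P satisfies Condition (1) if and only if G_P has no zeroes in Z, i.e., there is no pair (z,w) ∈ F_{q^2} × F_{q^2} with z^{q+1} = w^{q+1} = 1, z ≠ w and G_P(z,w) = 0. -/
noncomputable section

open Polynomial

/-- A polynomial `P` over `F = 𝔽_{q²}`, of degree `m`, satisfies Condition (1):
for all nonzero `x, y`, if `x^m P(x^{q-1}) / (y^m P(y^{q-1})) ∈ 𝔽_q`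
(expressed by cross-multiplying with the `q`-th power) then `x/y ∈ 𝔽_q`. -/
def Condition1 {F : Type*} [Field F] (q m : ℕ) (P : Polynomial F) : Prop :=
  ∀ x y : F, x ≠ 0 → y ≠ 0 →
    (x ^ m * P.eval (x ^ (q - 1))) * (y ^ m * P.eval (y ^ (q - 1))) ^ q =
      (x ^ m * P.eval (x ^ (q - 1))) ^ q * (y ^ m * P.eval (y ^ (q - 1))) →
    x * y ^ q = x ^ q * y

/-- For `P(x) = ∑_{i=0}^m a_i x^i` of degree `m`, `P̃(x) = ∑_{i=0}^m a_{m-i}^q x^i`. -/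
def Ptilde {F : Type*} [Field F] (q : ℕ) (P : Polynomial F) : Polynomial F :=
  ∑ i ∈ Finset.range (P.natDegree + 1), C ((P.coeff (P.natDegree - i)) ^ q) * X ^ i

/-- For `z` with `z ^ (q + 1) = 1`, the reciprocal-conjugate polynomial evaluates to
`z ^ deg P * P(z) ^ q`. -/
theorem Ptilde_eval_of_pow_succ_eq_one {F : Type*} [Field F] (p n : ℕ) [Fact p.Prime] [CharP F p]
    (P : Polynomial F) {z : F} (hz : z ^ (p ^ n + 1) = 1) :
    (Ptilde (p ^ n) P).eval z = z ^ P.natDegree * (P.eval z) ^ (p ^ n) := by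
  rw [eval_eq_sum_range (p := P), sum_pow_char_pow, Ptilde, eval_finsetSum, Finset.mul_sum,
    ← Finset.sum_range_reflect]
  refine Finset.sum_congr rfl fun i hi => ?_
  have hi : i ≤ P.natDegree := Nat.lt_succ_iff.mp (Finset.mem_range.mp hi)
  obtain ⟨k, hk⟩ := Nat.exists_eq_add_of_le hi
  rw [show P.natDegree + 1 - 1 - i = k by omega, show P.natDegree - k = i by omega, hk]
  simp only [eval_mul, eval_C, eval_pow, eval_X]
  calc P.coeff i ^ p ^ n * z ^ k = P.coeff i ^ p ^ n * z ^ k * (z ^ (p ^ n + 1)) ^ i := by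
        rw [hz, one_pow, mul_one]
    _ = z ^ (i + k) * (P.coeff i * z ^ i) ^ p ^ n := by ring

/-- In a field with `q ^ 2` elements every `z` with `z ^ (q + 1) = 1` is a `(q - 1)`-st power. -/
theorem exists_pow_sub_one_eq {F : Type*} [Field F] [Fintype F] {q : ℕ}
    (hF : Fintype.card F = q ^ 2) {z : F} (hz : z ^ (q + 1) = 1) :
    ∃ x : F, x ≠ 0 ∧ x ^ (q - 1) = z := by
  have hz0 : z ≠ 0 := by
    rintro rfl
    simp at hz
  obtain ⟨g, hg⟩ := IsCyclic.exists_generator (α := Fˣ)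
  obtain ⟨k, hk⟩ := (mem_powers_iff_mem_zpowers (y := Units.mk0 z hz0)).mpr (hg _)
  replace hk : g ^ k = Units.mk0 z hz0 := hk
  have h1 : g ^ (k * (q + 1)) = 1 := by
    rw [pow_mul, hk]
    ext
    simpa using hz
  have hcard : orderOf g = (q - 1) * (q + 1) := by
    rw [orderOf_eq_card_of_forall_mem_zpowers hg, Nat.card_units, Nat.card_eq_fintype_card, hF,
      mul_comm, ← Nat.sq_sub_sq, one_pow]
  obtain ⟨j, rfl⟩ : q - 1 ∣ k := by
    have h := orderOf_dvd_of_pow_eq_one h1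
    rw [hcard] at h
    exact Nat.dvd_of_mul_dvd_mul_right q.succ_pos h
  refine ⟨(g ^ j : Fˣ), Units.ne_zero _, ?_⟩
  have := congrArg Units.val hk
  rw [← Units.val_pow_eq_pow_val, ← pow_mul, mul_comm j]
  exact this

/-- Lemma: an irreducible polynomial `P ∈ 𝔽_{q²}[x]` of degree `m` satisfies Condition (1)
if and only if `G_P(z,w) = P(z)P̃(w) − P̃(z)P(w)` has no zero `(z,w)` with
`z^{q+1} = w^{q+1} = 1` and `z ≠ w`. -/
theorem statement0 (p n q m : ℕ) (hp : p.Prime) (hp3 : 3 < p) (hn : n ≠ 0) (hq : q = p ^ n)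
    (F : Type*) [Field F] [Fintype F] (hF : Fintype.card F = q ^ 2)
    (P : Polynomial F) (hPirr : Irreducible P) (hPdeg : P.natDegree = m) :
    Condition1 q m P ↔
      ¬ ∃ z w : F, z ^ (q + 1) = 1 ∧ w ^ (q + 1) = 1 ∧ z ≠ w ∧
        P.eval z * (Ptilde q P).eval w - (Ptilde q P).eval z * P.eval w = 0 := by
  have : Fact p.Prime := ⟨hp⟩
  obtain ⟨r, hr⟩ := CharP.exists F
  obtain ⟨k, hrp, hrk⟩ := FiniteField.card F r
  have hpr : p = r := by
    have h : p ∣ r ^ (k : ℕ) := by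
      rw [← hrk, hF, hq, ← pow_mul]
      exact dvd_pow_self p (by simpa using hn)
    exact (Nat.prime_dvd_prime_iff_eq hp hrp).mp (hp.dvd_of_dvd_pow h)
  subst hpr
  have hq0 : 0 < q := hq ▸ pow_pos hp.pos n
  have hmu : ∀ x : F, x ≠ 0 → (x ^ (q - 1)) ^ (q + 1) = 1 := fun x hx => by
    rw [← pow_mul, mul_comm, ← Nat.sq_sub_sq, one_pow, ← hF]
    exact FiniteField.pow_card_sub_one_eq_one x hx
  have hxq : ∀ x : F, x ^ q = x * x ^ (q - 1) := fun x => by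
    rw [← pow_succ', Nat.sub_add_cancel hq0]
  have hconj : ∀ x : F, x ≠ 0 → (x ^ m * P.eval (x ^ (q - 1))) ^ q =
      x ^ m * (Ptilde q P).eval (x ^ (q - 1)) := fun x hx => by
    have h := hmu x hx
    have hP : (Ptilde q P).eval (x ^ (q - 1)) =
        (x ^ (q - 1)) ^ m * P.eval (x ^ (q - 1)) ^ q := by
      subst hq hPdeg
      exact Ptilde_eval_of_pow_succ_eq_one p n P h
    rw [hP, mul_pow, ← pow_mul, mul_comm m q, pow_mul, hxq x, mul_pow, mul_assoc]
  have hcond : ∀ x y : F, x ≠ 0 → y ≠ 0 →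
      ((x ^ m * P.eval (x ^ (q - 1))) * (y ^ m * P.eval (y ^ (q - 1))) ^ q =
        (x ^ m * P.eval (x ^ (q - 1))) ^ q * (y ^ m * P.eval (y ^ (q - 1))) ↔
      P.eval (x ^ (q - 1)) * (Ptilde q P).eval (y ^ (q - 1)) -
        (Ptilde q P).eval (x ^ (q - 1)) * P.eval (y ^ (q - 1)) = 0) := fun x y hx hy => by
    rw [hconj x hx, hconj y hy, mul_mul_mul_comm,
      mul_mul_mul_comm _ ((Ptilde q P).eval (x ^ (q - 1))), sub_eq_zero]
    exact mul_right_inj' (mul_ne_zero (pow_ne_zero m hx) (pow_ne_zero m hy))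
  have hratio : ∀ x y : F, x ≠ 0 → y ≠ 0 →
      (x * y ^ q = x ^ q * y ↔ x ^ (q - 1) = y ^ (q - 1)) := fun x y hx hy => by
    rw [hxq x, hxq y, mul_right_comm x, ← mul_assoc, mul_right_inj' (mul_ne_zero hx hy), eq_comm]
  constructor
  · rintro h ⟨z, w, hz, hw, hzw, hG⟩
    obtain ⟨x, hx, rfl⟩ := exists_pow_sub_one_eq hF hz
    obtain ⟨y, hy, rfl⟩ := exists_pow_sub_one_eq hF hw
    exact hzw ((hratio x y hx hy).mp (h x y hx hy ((hcond x y hx hy).mpr hG)))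
  · intro h x y hx hy hxy
    by_contra hne
    exact h ⟨_, _, hmu x hx, hmu y hy, fun heq => hne ((hratio x y hx hy).mpr heq),
      (hcond x y hx hy).mp hxy⟩
end
end

section
/- Let a, b ∈ F_{q^2} with b ≠ 0, and let f_{a,b}(X) = X(1 + aX^{q(q−1)} + bX^{2(q−1)}) ∈ F_{q^2}[X]. Then the map x ↦ f_{a,b}(x) is a bijection of F_{q^2} (i.e., f_{a,b} is a permutation polynomial of F_{q^2}) if and only if the cubic P(x) = x^3 + b^{−1}x + ab^{−1} satisfies Condition (1) with m = 3. -/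
noncomputable section

open Polynomial

/-- In a field with `q²` elements, two nonzero elements satisfy `x * y ^ q = x ^ q * y` only if
their ratio is fixed by the `q`-power map. -/
lemma exists_pow_eq_self_mul {F : Type*} [Field F] {q : ℕ} {x y : F} (hx : x ≠ 0) (hy : y ≠ 0)
    (h : x * y ^ q = x ^ q * y) : ∃ c : F, c ≠ 0 ∧ c ^ q = c ∧ x = c * y :=
  ⟨x / y, div_ne_zero hx hy, by rw [div_pow]; field_simp; linear_combination -h,
    (div_mul_cancel₀ x hy).symm⟩

lemma pow_sub_one_eq_one_of_pow_eq_self {F : Type*} [Field F] {q : ℕ} (hq : 1 < q) {c : F}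
    (hc : c ≠ 0) (h : c ^ q = c) : c ^ (q - 1) = 1 := by
  apply mul_right_cancel₀ hc
  rw [← pow_succ, Nat.sub_add_cancel hq.le, h, one_mul]

/-- A field with `q²` elements has an element not fixed by the `q`-power map. -/
lemma exists_pow_ne_self {F : Type*} [Field F] [Fintype F] {q : ℕ} (hq : 1 < q)
    (hF : Fintype.card F = q ^ 2) : ∃ z : F, z ≠ 0 ∧ z ^ q ≠ z := by
  by_contra! h
  have hall : ∀ z : Fˣ, z ^ (q - 1) = 1 := fun z => Units.ext <| by
    simpa using pow_sub_one_eq_one_of_pow_eq_self hq z.ne_zero (h z z.ne_zero)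
  have hdvd := (FiniteField.forall_pow_eq_one_iff F (q - 1)).1 hall
  rw [hF] at hdvd
  have hle := Nat.le_of_dvd (by omega) hdvd
  have : q < q ^ 2 := by nlinarith
  omega

/-- Scaling by an element fixed by the `q`-power map commutes with
`x ↦ x * (1 + a * x ^ (q * (q - 1)) + b * x ^ (2 * (q - 1)))`. -/
lemma trinomial_mul_of_pow_eq_self {F : Type*} [Field F] {q : ℕ} (hq : 1 < q) (a b : F) {c : F}
    (hc : c ≠ 0) (h : c ^ q = c) (y : F) :
    c * y * (1 + a * (c * y) ^ (q * (q - 1)) + b * (c * y) ^ (2 * (q - 1))) =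
      c * (y * (1 + a * y ^ (q * (q - 1)) + b * y ^ (2 * (q - 1)))) := by
  have h1 := pow_sub_one_eq_one_of_pow_eq_self hq hc h
  rw [mul_pow, mul_pow, mul_comm q, pow_mul c, mul_comm 2, pow_mul c, h1]
  ring

lemma pow_mul_eval_cubic {F : Type*} [Field F] [Fintype F] {q : ℕ} (hq : 1 < q)
    (hF : Fintype.card F = q ^ 2) (a : F) {b x : F} (hb : b ≠ 0) (hx : x ≠ 0) :
    x ^ 3 * (X ^ 3 + C b⁻¹ * X + C (a * b⁻¹) : F[X]).eval (x ^ (q - 1)) =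
      b⁻¹ * x ^ (q + 1) *
        (x * (1 + a * x ^ (q * (q - 1)) + b * x ^ (2 * (q - 1)))) := by
  obtain ⟨k, rfl⟩ : ∃ k, q = k + 1 := ⟨q - 1, by omega⟩
  have hu : (x ^ k) ^ (k + 1) * x ^ k = 1 := by
    rw [← FiniteField.pow_card_sub_one_eq_one x hx, hF, ← pow_mul, ← pow_add]
    congr 1
    rw [show (k + 1) ^ 2 = k * (k + 1) + k + 1 by ring, Nat.add_sub_cancel]
  simp only [Nat.add_sub_cancel, eval_add, eval_pow, eval_X, eval_mul, eval_C]
  rw [mul_comm (k + 1), pow_mul x k, mul_comm 2, pow_mul x k 2,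
    show x ^ (k + 1 + 1) = x ^ 2 * x ^ k by ring]
  generalize (x ^ k) ^ (k + 1) = v at hu ⊢
  field_simp
  linear_combination (-a) * hu

/-- For a cubic and a trinomial as in `pow_mul_eval_cubic`, the ratio of two values lies in the
subfield with `q` elements for one exactly when it does for the other. -/
lemma pow_mul_eval_cubic_ratio_iff {F : Type*} [Field F] [Fintype F] {q : ℕ}
    (hF : Fintype.card F = q ^ 2) {b x y : F} (hb : b ≠ 0) (hx : x ≠ 0) (hy : y ≠ 0) (s t : F) :
    b⁻¹ * x ^ (q + 1) * s * (b⁻¹ * y ^ (q + 1) * t) ^ q =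
        (b⁻¹ * x ^ (q + 1) * s) ^ q * (b⁻¹ * y ^ (q + 1) * t) ↔
      s * t ^ q = s ^ q * t := by
  have norm_pow (z : F) : (z ^ (q + 1)) ^ q = z ^ (q + 1) := by
    rw [← pow_mul, add_mul, one_mul, ← sq, ← hF, pow_add, FiniteField.pow_card, pow_succ']
  have hk : b⁻¹ * (b⁻¹) ^ q * x ^ (q + 1) * y ^ (q + 1) ≠ 0 :=
    mul_ne_zero (mul_ne_zero (mul_ne_zero (inv_ne_zero hb) (pow_ne_zero _ (inv_ne_zero hb)))
      (pow_ne_zero _ hx)) (pow_ne_zero _ hy)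
  rw [← mul_right_inj' hk (b := s * t ^ q)]
  simp only [mul_pow _ _ q, norm_pow]
  refine Eq.congr ?_ ?_ <;> ring

/-- `f_{a,b}(X) = X(1 + aX^{q(q−1)} + bX^{2(q−1)})` is a permutation polynomial of `𝔽_{q²}`
if and only if `P(x) = x³ + b⁻¹x + ab⁻¹` satisfies Condition (1) with `m = 3`. -/
theorem statement1 (p n q : ℕ) (hp : p.Prime) (hp3 : 3 < p) (hn : n ≠ 0) (hq : q = p ^ n)
    (F : Type*) [Field F] [Fintype F] (hF : Fintype.card F = q ^ 2)
    (a b : F) (hb : b ≠ 0) :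
    Function.Bijective (fun x : F => x * (1 + a * x ^ (q * (q - 1)) + b * x ^ (2 * (q - 1)))) ↔
      Condition1 q 3 (X ^ 3 + C b⁻¹ * X + C (a * b⁻¹)) := by
  have hq1 : 1 < q := hq ▸ Nat.one_lt_pow hn hp.one_lt
  set f : F → F := fun x => x * (1 + a * x ^ (q * (q - 1)) + b * x ^ (2 * (q - 1))) with hf
  have hf0 : f 0 = 0 := zero_mul _
  have hsmul {c : F} (hc : c ≠ 0) (h : c ^ q = c) (y : F) : f (c * y) = c * f y :=
    trinomial_mul_of_pow_eq_self hq1 a b hc h y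
  have hcond : Condition1 q 3 (X ^ 3 + C b⁻¹ * X + C (a * b⁻¹)) ↔
      ∀ x y : F, x ≠ 0 → y ≠ 0 → f x * f y ^ q = f x ^ q * f y → x * y ^ q = x ^ q * y := by
    refine forall₄_congr fun x y hx hy => ?_
    rw [pow_mul_eval_cubic hq1 hF a hb hx, pow_mul_eval_cubic hq1 hF a hb hy,
      pow_mul_eval_cubic_ratio_iff hF hb hx hy]
  rw [hcond]
  constructor
  · intro hbij x y hx hy h
    have hne {z : F} (hz : z ≠ 0) : f z ≠ 0 := fun h0 => hz (hbij.1 (h0.trans hf0.symm))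
    obtain ⟨c, hc, hcq, hxy⟩ := exists_pow_eq_self_mul (hne hx) (hne hy) h
    obtain rfl : x = c * y := hbij.1 (hxy.trans (hsmul hc hcq y).symm)
    rw [mul_pow, hcq]
    ring
  · intro h
    have hne {x : F} (h0 : f x = 0) : x = 0 := by
      by_contra hx
      obtain ⟨z, hz, hzq⟩ := exists_pow_ne_self hq1 hF
      have hxz := h x (x * z) hx (mul_ne_zero hx hz) (by simp [h0, show q ≠ 0 by omega])
      have hk : x * x ^ q ≠ 0 := mul_ne_zero hx (pow_ne_zero q hx)
      exact hzq (mul_left_cancel₀ hk (by rw [mul_pow] at hxz; linear_combination hxz))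
    refine Finite.injective_iff_bijective.1 fun x y hxy => ?_
    rcases eq_or_ne x 0 with rfl | hx
    · exact (hne (hxy.symm.trans hf0)).symm
    rcases eq_or_ne y 0 with rfl | hy
    · exact hne (hxy.trans hf0)
    obtain ⟨c, hc, hcq, rfl⟩ := exists_pow_eq_self_mul hx hy (h x y hx hy (by rw [hxy, mul_comm]))
    rw [hsmul hc hcq] at hxy
    rw [(mul_eq_right₀ (fun h0 => hy (hne h0))).1 hxy, one_mul]
end
end

section
/- Let P(x) ∈ F_{q^2}[x] be irreducible of degree m ≥ 2. Then both P(x) and P̃(x) divide each of the univariate polynomials G_P(x^{q^2}, x) and H_P(x^{q^2}, x) in F_{q^2}[x]. -/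
noncomputable section

open Polynomial

/-- `G_P(z,w) = P(z)P̃(w) − P̃(z)P(w)` as a bivariate polynomial, with `z = X 0`, `w = X 1`. -/
def Gpol {F : Type*} [Field F] (q : ℕ) (P : Polynomial F) : MvPolynomial (Fin 2) F :=
  Polynomial.eval₂ MvPolynomial.C (MvPolynomial.X 0) P *
      Polynomial.eval₂ MvPolynomial.C (MvPolynomial.X 1) (Ptilde q P) -
    Polynomial.eval₂ MvPolynomial.C (MvPolynomial.X 0) (Ptilde q P) *
      Polynomial.eval₂ MvPolynomial.C (MvPolynomial.X 1) P

/-- The substitution `z ↦ x^{q²}`, `w ↦ x`, turning a bivariate polynomial into a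
univariate one. -/
def substFrob {F : Type*} [Field F] (q : ℕ) : MvPolynomial (Fin 2) F →ₐ[F] Polynomial F :=
  MvPolynomial.aeval ![(X : Polynomial F) ^ q ^ 2, (X : Polynomial F)]

/-- A polynomial over a finite field without roots there is coprime to `X ^ #F - X`. -/
theorem isCoprime_X_pow_card_sub_X_of_no_root {F : Type*} [Field F] [Fintype F]
    {D : Polynomial F} (hD : ∀ a, D.eval a ≠ 0) :
    IsCoprime D (X ^ Fintype.card F - X) := by
  have hroots := FiniteField.roots_X_pow_card_sub_X F
  have hprod : ∏ a : F, (X - C a) = X ^ Fintype.card F - X := by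
    have hmonic : (X ^ Fintype.card F - X : F[X]).Monic :=
      monic_X_pow_sub (by rw [degree_X]; exact_mod_cast Fintype.one_lt_card)
    have h := prod_multiset_X_sub_C_of_monic_of_roots_card_eq hmonic (by
      rw [hroots, FiniteField.X_pow_card_sub_X_natDegree_eq F Fintype.one_lt_card]; rfl)
    rwa [hroots] at h
  rw [← hprod]
  refine IsCoprime.prod_right fun a _ => ?_
  refine (((irreducible_X_sub_C a).coprime_iff_not_dvd).2 ?_).symm
  rw [dvd_iff_isRoot]
  exact hD a

/-- If `P ≠ 0` has no roots in the field with `q ^ 2` elements, then neither has `P̃`. -/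
theorem eval_Ptilde_ne_zero {F : Type*} [Field F] [Fintype F] {p n q : ℕ} [CharP F p]
    (hp : p.Prime) (hq : q = p ^ n) (hF : Fintype.card F = q ^ 2)
    {P : Polynomial F} (hP0 : P ≠ 0) (hP : ∀ a, P.eval a ≠ 0) (a : F) :
    (Ptilde q P).eval a ≠ 0 := by
  have hq0 : q ≠ 0 := by rw [hq]; exact pow_ne_zero _ hp.ne_zero
  have heval : (Ptilde q P).eval a =
      ∑ i ∈ Finset.range (P.natDegree + 1), P.coeff (P.natDegree - i) ^ q * a ^ i := by
    simp [Ptilde, eval_finsetSum]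
  rw [heval]
  rcases eq_or_ne a 0 with rfl | ha
  · rw [Finset.sum_range_succ']
    simpa [hq0] using hP0
  · have := Fact.mk hp
    set c : F := a⁻¹ ^ q with hc
    have hcq : c ^ q = a⁻¹ := by
      rw [hc, ← pow_mul, ← sq, ← hF, FiniteField.pow_card]
    have key : ∑ i ∈ Finset.range (P.natDegree + 1), P.coeff (P.natDegree - i) ^ q * a ^ i =
        a ^ P.natDegree * P.eval c ^ q := by
      rw [eval_eq_sum_range, hq, sum_pow_char_pow p, ← hq, Finset.mul_sum,
        ← Finset.sum_range_reflect]
      refine Finset.sum_congr rfl fun i hi => ?_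
      have hi' : i ≤ P.natDegree := Nat.lt_succ_iff.1 (Finset.mem_range.1 hi)
      have h1 : P.natDegree + 1 - 1 - i = P.natDegree - i := by omega
      rw [h1, Nat.sub_sub_self hi', mul_pow, ← pow_mul, mul_comm i q, pow_mul, hcq, inv_pow,
        pow_sub₀ a ha hi']
      ring
    rw [key]
    exact mul_ne_zero (pow_ne_zero _ ha) (pow_ne_zero _ (hP c))

/-- `G_P(x^{q²}, x) = P^{q²} P̃ − P̃^{q²} P` over the field with `q ^ 2` elements. -/
theorem substFrob_Gpol {F : Type*} [Field F] [Fintype F] {q : ℕ}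
    (hF : Fintype.card F = q ^ 2) (P : Polynomial F) :
    substFrob q (Gpol q P) = P ^ q ^ 2 * Ptilde q P - Ptilde q P ^ q ^ 2 * P := by
  have h (i : Fin 2) (A : Polynomial F) :
      substFrob q (eval₂ MvPolynomial.C (MvPolynomial.X i) A) =
        A.comp (![(X : Polynomial F) ^ q ^ 2, X] i) := by
    rw [← MvPolynomial.algebraMap_eq, ← aeval_def, ← aeval_algHom_apply, substFrob,
      MvPolynomial.aeval_X, comp_eq_aeval]
  have hexp (A : Polynomial F) : A.comp (X ^ q ^ 2) = A ^ q ^ 2 := by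
    rw [← expand_eq_comp_X_pow, ← hF, FiniteField.expand_card]
  simp only [Gpol, map_sub, map_mul, h]
  simp [hexp]

/-- Lemma: for irreducible `P` of degree `m ≥ 2`, both `P` and `P̃` divide both
`G_P(x^{q²}, x)` and `H_P(x^{q²}, x)`, where `H_P = G_P / (z - w)`. -/
theorem statement2 (p n q : ℕ) (hp : p.Prime) (hp3 : 3 < p) (hn : n ≠ 0) (hq : q = p ^ n)
    (F : Type*) [Field F] [Fintype F] (hF : Fintype.card F = q ^ 2)
    (P : Polynomial F) (hPirr : Irreducible P) (hPdeg : 2 ≤ P.natDegree)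
    (H : MvPolynomial (Fin 2) F)
    (hH : (MvPolynomial.X 0 - MvPolynomial.X 1) * H = Gpol q P) :
    (P ∣ substFrob q (Gpol q P) ∧ Ptilde q P ∣ substFrob q (Gpol q P)) ∧
      (P ∣ substFrob q H ∧ Ptilde q P ∣ substFrob q H) := by
  have hq0 : q ≠ 0 := by rw [hq]; exact pow_ne_zero _ hp.ne_zero
  have := Fact.mk hp
  have : CharP F p := charP_of_card_eq_prime_pow (f := n * 2) (by rw [hF, hq, pow_mul])
  have hroot (a : F) : P.eval a ≠ 0 := fun h => by
    have : P.natDegree = 1 := natDegree_eq_of_degree_eq_some (degree_eq_one_of_irreducible_of_root hPirr h)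
    omega
  have hG := substFrob_Gpol hF P
  have hdvd : P ∣ substFrob q (Gpol q P) ∧ Ptilde q P ∣ substFrob q (Gpol q P) := by
    have hq2 : q ^ 2 ≠ 0 := pow_ne_zero _ hq0
    rw [hG]
    exact ⟨dvd_sub ((dvd_pow_self _ hq2).mul_right _) (dvd_mul_left _ _),
      dvd_sub (dvd_mul_left _ _) ((dvd_pow_self _ hq2).mul_right _)⟩
  have hfactor : substFrob q (Gpol q P) = (X ^ Fintype.card F - X) * substFrob q H := by
    rw [← hH, map_mul, hF]
    simp [substFrob]
  refine ⟨hdvd, ?_⟩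
  rw [hfactor] at hdvd
  exact ⟨(isCoprime_X_pow_card_sub_X_of_no_root hroot).dvd_of_dvd_mul_left hdvd.1,
    (isCoprime_X_pow_card_sub_X_of_no_root
      (eval_Ptilde_ne_zero hp hq hF hPirr.ne_zero hroot)).dvd_of_dvd_mul_left hdvd.2⟩
end
end

section
/- Let P(x) = x^3 − δx^2 − γx − θ ∈ F_{q^2}[x]. If H_P(z,w) is absolutely irreducible, i.e., irreducible as a bivariate polynomial over the algebraic closure of F_q, then P does not satisfy Condition (1) with m = 3. -/
noncomputable section

open Polynomial

theorem eq_C_of_derivative_eq_zero_of_natDegree_lt {F : Type*} [Field F] {p : ℕ} [CharP F p]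
    {f : F[X]} (hf : derivative f = 0) (hd : f.natDegree < p) : f = C (f.coeff 0) := by
  ext i
  rcases i with _ | i
  · simp
  · rw [coeff_C_of_ne_zero (Nat.succ_ne_zero i)]
    by_contra hne
    have hle := le_natDegree_of_ne_zero hne
    have h := coeff_derivative f i
    rw [hf, coeff_zero, eq_comm, mul_eq_zero] at h
    have h' : ((i + 1 : ℕ) : F) = 0 := by
      push_cast
      exact h.resolve_left hne
    have := Nat.le_of_dvd (Nat.succ_pos i) ((CharP.cast_eq_zero_iff F p _).1 h')
    omega

theorem eq_C_mul_of_wronskian_eq_zero {F : Type*} [Field F] {p : ℕ} [CharP F p] {f g : F[X]}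
    (hg : g ≠ 0) (hfd : f.natDegree < p) (hgd : g.natDegree < p)
    (hw : wronskian f g = 0) : ∃ c, f = C c * g := by
  by_cases hf : f = 0
  · exact ⟨0, by simp [hf]⟩
  classical
  obtain ⟨f', g', hf', hg', hu⟩ := extract_gcd f g
  set d := gcd f g
  have hd : d ≠ 0 := by
    rintro h0
    rw [h0, zero_mul] at hf'
    exact hf hf'
  have hf0 : f' ≠ 0 := by rintro rfl; simp at hf'; exact hf hf'
  have hg0 : g' ≠ 0 := by rintro rfl; simp at hg'; exact hg hg'
  have hcop : IsCoprime f' g' := (gcd_isUnit_iff f' g').1 hu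
  have hw' : wronskian f' g' = 0 := by
    have : d ^ 2 * wronskian f' g' = 0 := by
      rw [← hw]
      conv_rhs => rw [hf', hg']
      simp only [wronskian, derivative_mul]
      ring
    exact (mul_eq_zero.1 this).resolve_left (pow_ne_zero 2 hd)
  obtain ⟨h1, h2⟩ := hcop.wronskian_eq_zero_iff.1 hw'
  have e1 : f'.natDegree < p := by
    rw [hf', natDegree_mul hd hf0] at hfd; omega
  have e2 : g'.natDegree < p := by
    rw [hg', natDegree_mul hd hg0] at hgd; omega
  have k1 := eq_C_of_derivative_eq_zero_of_natDegree_lt h1 e1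
  have k2 := eq_C_of_derivative_eq_zero_of_natDegree_lt h2 e2
  have hc : g'.coeff 0 ≠ 0 := by
    intro h; rw [h, C_0] at k2; exact hg0 k2
  refine ⟨f'.coeff 0 / g'.coeff 0, ?_⟩
  have : C (f'.coeff 0 / g'.coeff 0) * C (g'.coeff 0) = C (f'.coeff 0) := by
    rw [← C_mul, div_mul_cancel₀ _ hc]
  rw [hg', hf', k1, k2]
  simp only [coeff_C_zero]
  rw [← this]; ring

theorem quartic_eq_C_mul_sq_of_dvd {F : Type*} [Field F] {p q m : ℕ} [CharP F p] (hp : 4 < p)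
    (hm : q = 2 * m + 1) (hm0 : 2 ≤ m) (hq0 : (q : F) = 0) {f : F[X]} {c₀ c₁ c₂ c₃ c₄ : F}
    (hf : f = C c₀ + C c₁ * X + C c₂ * X ^ 2 + C c₃ * X ^ 3 + C c₄ * X ^ 4)
    (h13 : c₃ = 0 → c₁ = 0) (h31 : c₁ = 0 → c₃ = 0)
    (hdvd : (X ^ (q + 1) - 1 : F[X]) ∣ X ^ 2 * f ^ m - 1) : ∃ c s, f = C c * s ^ 2 := by
  obtain ⟨A, hA⟩ := hdvd
  by_cases hf0 : f = 0
  · exact ⟨0, 0, by simp [hf0]⟩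
  have hcast : ∀ k : ℕ, 0 < k → k < p → (k : F) ≠ 0 := fun k hk hkp h =>
    absurd (Nat.le_of_dvd hk ((CharP.cast_eq_zero_iff F p k).1 h)) (by omega)
  have hfd : f.natDegree ≤ 4 := by rw [hf]; compute_degree
  have hf' : derivative f = C c₁ + 2 * C c₂ * X + 3 * C c₃ * X ^ 2 + 4 * C c₄ * X ^ 3 := by
    rw [hf]
    simp only [derivative_add, derivative_mul, derivative_C, derivative_X_pow, derivative_X, map_natCast]
    push_cast
    ring
  set N : F[X] := X ^ (q + 1) - 1 with hN
  have hNmonic : N.Monic := monic_X_pow_sub_C 1 (Nat.succ_ne_zero q)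
  have hNd : N.natDegree = q + 1 := natDegree_X_pow_sub_C
  have hN' : X * derivative N = N + 1 := by
    rw [hN]; simp [hq0]; ring
  -- the logarithmic derivative of `f ^ m`
  have hpow : 2 * f * derivative (f ^ m) = - derivative f * f ^ m := by
    obtain ⟨k, rfl⟩ : ∃ k, m = k + 1 := ⟨m - 1, by omega⟩
    have h2m : (2 * (C ((k + 1 : ℕ) : F)) : F[X]) = -1 := by
      have : (2 * ((k + 1 : ℕ) : F)) = -1 := by
        have := hq0
        rw [hm] at this
        push_cast at this ⊢
        linear_combination this
      rw [← C_ofNat, ← C_mul, this]; simp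
    rw [derivative_pow_succ]
    rw [← Nat.cast_succ]
    linear_combination (derivative f * f ^ (k + 1)) * h2m
  have hAd : A.natDegree ≤ q - 1 := by
    have h1 : (N * A).natDegree ≤ 2 * q := by
      rw [← hA]
      refine (natDegree_sub_le_of_le (natDegree_mul_le_of_le (natDegree_X_pow_le 2)
        (natDegree_pow_le_of_le m hfd)) (natDegree_one.le)).trans ?_
      omega
    by_cases hA0 : A = 0
    · simp [hA0]
    rw [hNmonic.natDegree_mul' hA0, hNd] at h1
    omega
  have key1 : X * derivative (X ^ 2 * f ^ m - 1) = X * derivative (N * A) := by rw [hA]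
  simp only [derivative_sub, derivative_mul, derivative_X_pow, derivative_one, map_natCast] at key1
  push_cast at key1
  clear_value N
  set R : F[X] := 2 * f * A + 2 * f * (X * derivative A) - A * (4 * f - X * derivative f) with hR
  have hNR : N * R = (4 * f - X * derivative f) - 2 * f * A := by
    linear_combination (-2 * f) * key1 + X ^ 3 * hpow - (2 * f * A) * hN'
       + (4 * f - X * derivative f) * hA
  have hRd : R.natDegree ≤ 2 := by
    have h1 : (N * R).natDegree ≤ q + 3 := by
      rw [hNR]
      have hθ : (X * derivative f).natDegree ≤ 4 := by
        rw [hf']; compute_degree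
      have h4 : (4 * f).natDegree ≤ 4 := by
        refine (natDegree_mul_le_of_le (natDegree_ofNat 4).le hfd).trans ?_
        omega
      have h2 : (2 * f * A).natDegree ≤ 4 + (q - 1) := by
        refine (natDegree_mul_le_of_le (natDegree_mul_le_of_le (natDegree_ofNat 2).le hfd)
          hAd).trans ?_
        omega
      refine (natDegree_sub_le_of_le (natDegree_sub_le_of_le h4 hθ) h2).trans ?_
      omega
    by_cases hR0 : R = 0
    · simp [hR0]
    rw [hNmonic.natDegree_mul' hR0, hNd] at h1
    omega
  set L : F[X] := 4 * f - X * derivative f with hL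
  have hLe : L = 4 * C c₀ + 3 * C c₁ * X + 2 * C c₂ * X ^ 2 + C c₃ * X ^ 3 := by
    rw [hL, hf', hf]; ring
  clear_value R L
  have hNK : N * (X * (2 * f * derivative R - R * derivative f)) =
      2 * f * (X * derivative L) - 4 * f * R - L * (2 * f + X * derivative f) := by
    have key2 : X * derivative (N * R) = X * derivative (L - 2 * f * A) := by rw [hNR]
    have h2 : derivative (2 : F[X]) = 0 := derivative_ofNat 2
    simp only [derivative_sub, derivative_mul, h2] at key2
    linear_combination (2 * f) * key2 - (2 * f * R) * hN' + (2 * f) * hR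
      - (2 * f + X * derivative f) * hNR - (2 * f * A) * hL
  have hw : 2 * f * derivative R = R * derivative f := by
    obtain ⟨r₀, r₁, r₂, hRe⟩ : ∃ r₀ r₁ r₂, R = C r₀ + C r₁ * X + C r₂ * X ^ 2 := by
      refine ⟨R.coeff 0, R.coeff 1, R.coeff 2, ?_⟩
      conv_lhs => rw [R.as_sum_range_C_mul_X_pow' (Nat.lt_succ_of_le hRd)]
      simp [Finset.sum_range_succ]
    have hL' : derivative L = 3 * C c₁ + 4 * C c₂ * X + 3 * C c₃ * X ^ 2 := by
      rw [hLe]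
      simp only [derivative_add, derivative_mul, derivative_C, derivative_X_pow, derivative_X,
        derivative_ofNat, map_natCast]
      push_cast
      ring
    set K := 2 * f * derivative R - R * derivative f with hK
    by_contra hne
    have hK0 : K ≠ 0 := sub_ne_zero.2 hne
    have hd : (N * (X * K)).natDegree ≤ 6 := by
      have hS : N * (X * K) = (2 * f * (X * derivative L) - L * (2 * f + X * derivative f)
          + 2 * C c₄ * C c₃ * X ^ 7 - 2 * C c₄ * C c₃ * X ^ 7) - 4 * f * R := by
        rw [hNK]; ring
      rw [hS, hL', hLe, hf', hf, hRe]
      ring_nf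
      compute_degree
    rw [hNmonic.natDegree_mul' (mul_ne_zero X_ne_zero hK0), hNd, natDegree_X_mul hK0] at hd
    omega
  by_cases hR0 : R = 0
  · rw [hR0, mul_zero, eq_comm, sub_eq_zero] at hNR
    have h2 : (2 : F) ≠ 0 := by exact_mod_cast hcast 2 (by omega) (by omega)
    have h2' : (2 : F[X]) ≠ 0 := by rw [← C_ofNat]; exact C_ne_zero.2 h2
    obtain ⟨a, rfl⟩ : ∃ a, A = C a := by
      by_cases hA0 : A = 0
      · exact ⟨0, by simp [hA0]⟩
      have hLd : L.natDegree ≤ f.natDegree := by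
        rw [hL]
        have h4 : (4 * f).natDegree ≤ f.natDegree := by
          simpa using natDegree_mul_le_of_le (natDegree_ofNat 4).le (le_refl f.natDegree)
        refine (natDegree_sub_le_of_le h4 (n := f.natDegree) ?_).trans (by omega)
        by_cases hfd0 : f.natDegree = 0
        · rw [derivative_of_natDegree_zero hfd0]; simp
        · refine (natDegree_mul_le_of_le natDegree_X_le (natDegree_derivative_le f)).trans ?_
          omega
      rw [hNR, natDegree_mul (mul_ne_zero h2' hf0) hA0, natDegree_mul h2' hf0] at hLd
      exact ⟨_, eq_C_of_natDegree_eq_zero (by omega)⟩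
    rw [hLe, hf] at hNR
    have e : C (4 * c₀ - 2 * a * c₀) + C (3 * c₁ - 2 * a * c₁) * X
        + C (2 * c₂ - 2 * a * c₂) * X ^ 2 + C (c₃ - 2 * a * c₃) * X ^ 3
        + C (- 2 * a * c₄) * X ^ 4 = 0 := by
      simp only [C_sub, C_mul, C_neg, C_ofNat]
      linear_combination hNR
    generalize hb₀ : 4 * c₀ - 2 * a * c₀ = b₀ at e
    generalize hb₁ : 3 * c₁ - 2 * a * c₁ = b₁ at e
    generalize hb₂ : 2 * c₂ - 2 * a * c₂ = b₂ at e
    generalize hb₃ : c₃ - 2 * a * c₃ = b₃ at e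
    generalize hb₄ : - 2 * a * c₄ = b₄ at e
    have e0 := congrArg (coeff · 0) e
    have e1 := congrArg (coeff · 1) e
    have e2 := congrArg (coeff · 2) e
    have e3 := congrArg (coeff · 3) e
    have e4 := congrArg (coeff · 4) e
    simp [coeff_X, coeff_X_pow, coeff_C] at e0 e1 e2 e3 e4
    subst e0 e1 e2 e3 e4
    have hc1 : c₁ = 0 := by
      by_contra h1
      have h3 : c₃ ≠ 0 := fun h => h1 (h13 h)
      have i1 : 3 - 2 * a = 0 := by
        refine (mul_eq_zero.1 (?_ : (3 - 2 * a) * c₁ = 0)).resolve_right h1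
        linear_combination hb₁
      have i3 : 1 - 2 * a = 0 := by
        refine (mul_eq_zero.1 (?_ : (1 - 2 * a) * c₃ = 0)).resolve_right h3
        linear_combination hb₃
      exact h2 (by linear_combination i1 - i3)
    have hc3 := h31 hc1
    by_cases h0 : c₀ = 0
    · by_cases hc2 : c₂ = 0
      · exact ⟨c₄, X ^ 2, by rw [hf, h0, hc1, hc2, hc3]; simp only [C_0]; ring⟩
      · have i1 : 2 - 2 * a = 0 := by
          refine (mul_eq_zero.1 (?_ : (2 - 2 * a) * c₂ = 0)).resolve_right hc2
          linear_combination hb₂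
        have hc4 : c₄ = 0 := by
          refine (mul_eq_zero.1 (?_ : 2 * c₄ = 0)).resolve_left h2
          linear_combination c₄ * i1 - hb₄
        exact ⟨c₂, X, by rw [hf, h0, hc1, hc4, hc3]; simp⟩
    · have i1 : 4 - 2 * a = 0 := by
        refine (mul_eq_zero.1 (?_ : (4 - 2 * a) * c₀ = 0)).resolve_right h0
        linear_combination hb₀
      have hc2 : c₂ = 0 := by
        refine (mul_eq_zero.1 (?_ : 2 * c₂ = 0)).resolve_left h2
        linear_combination c₂ * i1 - hb₂
      have hc4 : c₄ = 0 := by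
        refine (mul_eq_zero.1 (?_ : 2 * 2 * c₄ = 0)).resolve_left (mul_ne_zero h2 h2)
        linear_combination c₄ * i1 - hb₄
      exact ⟨c₀, 1, by rw [hf, hc1, hc2, hc4, hc3]; simp⟩
  · have hw' : wronskian f (R ^ 2) = 0 := by
      rw [wronskian, sq, derivative_mul]
      linear_combination R * hw
    obtain ⟨c, hc⟩ := eq_C_mul_of_wronskian_eq_zero (p := p) (pow_ne_zero 2 hR0) (by omega)
      (natDegree_pow_le.trans_lt (by omega)) hw'
    exact ⟨c, R, hc⟩

theorem X_pow_sub_one_dvd_of_eval_eq_zero {F : Type*} [Field F] {n : ℕ} {ζ : F} (hn : 0 < n)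
    (hζ : IsPrimitiveRoot ζ n) {f : F[X]} (hf : ∀ z : F, z ^ n = 1 → f.eval z = 0) :
    (X ^ n - 1 : F[X]) ∣ f := by
  rw [X_pow_sub_one_eq_prod hn hζ]
  refine Finset.prod_dvd_of_coprime
    (fun a _ b _ hab => pairwise_coprime_X_sub_C Function.injective_id hab) fun a ha => ?_
  rw [dvd_iff_isRoot]
  exact hf a ((mem_nthRootsFinset hn 1).1 ha)

theorem X_sub_C_sq_dvd {F : Type*} [Field F] {f : F[X]} {a : F} (h : f.eval a = 0)
    (h' : (derivative f).eval a = 0) : (X - C a) ^ 2 ∣ f := by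
  obtain ⟨g, rfl⟩ := dvd_iff_isRoot.2 h
  rw [sq]
  refine mul_dvd_mul_left _ (dvd_iff_isRoot.2 ?_)
  simpa [derivative_mul] using h'

theorem quartic_eq_C_mul_sq {F : Type*} [Field F] {p q m : ℕ} [CharP F p] (hp : 4 < p)
    (hm : q = 2 * m + 1) (hm0 : 2 ≤ m) (σ : F →+* F) (hσ : ∀ x, σ x = x ^ q)
    (hσX : ∀ a : F, (X - C a) ^ q = X ^ q - C (a ^ q)) (hq0 : (q : F) = 0)
    {ζ : F} (hζ : IsPrimitiveRoot ζ (q + 1)) {f : F[X]} {c₀ c₁ c₂ c₃ c₄ : F}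
    (hf : f = C c₀ + C c₁ * X + C c₂ * X ^ 2 + C c₃ * X ^ 3 + C c₄ * X ^ 4)
    (h13 : c₃ = 0 → c₁ = 0) (h31 : c₁ = 0 → c₃ = 0)
    (h1 : ∀ z, z ^ (q + 1) = 1 → f.eval z ≠ 0 → z ^ 2 * f.eval z ^ m = 1)
    (h2 : ∀ z, z ^ (q + 1) = 1 → f.eval z = 0 → (derivative f).eval z = 0) :
    ∃ c s, f = C c * s ^ 2 := by
  by_cases hz : ∀ z, z ^ (q + 1) = 1 → f.eval z ≠ 0
  · refine quartic_eq_C_mul_sq_of_dvd hp hm hm0 hq0 hf h13 h31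
      (X_pow_sub_one_dvd_of_eval_eq_zero q.succ_pos hζ fun z hz1 => ?_)
    simp [h1 z hz1 (hz z hz1)]
  push Not at hz
  obtain ⟨a, ha, hfa⟩ := hz
  by_cases hf0 : f = 0
  · exact ⟨0, 0, by simp [hf0]⟩
  have hfd : f.natDegree ≤ 4 := by rw [hf]; compute_degree
  obtain ⟨E, hE⟩ := X_sub_C_sq_dvd hfa (h2 a ha hfa)
  have hE0 : E ≠ 0 := by rintro rfl; exact hf0 (by rw [hE, mul_zero])
  have ha2 : (X - C a) ^ 2 ≠ 0 := pow_ne_zero 2 (X_sub_C_ne_zero a)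
  have hEd : E.natDegree ≤ 2 := by
    rw [hE, natDegree_mul ha2 hE0, natDegree_pow, natDegree_X_sub_C] at hfd
    omega
  have ha0 : a ≠ 0 := by rintro rfl; simp at ha
  suffices h : ∃ b, (X - C b) ^ 2 ∣ E by
    obtain ⟨b, D, hD⟩ := h
    have hD0 : D ≠ 0 := by rintro rfl; exact hE0 (by rw [hD, mul_zero])
    have hDd : D.natDegree = 0 := by
      rw [hD, natDegree_mul (pow_ne_zero 2 (X_sub_C_ne_zero b)) hD0, natDegree_pow,
        natDegree_X_sub_C] at hEd
      omega
    refine ⟨D.coeff 0, (X - C a) * (X - C b), ?_⟩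
    rw [← eq_C_of_natDegree_eq_zero hDd, hE, hD]
    ring
  by_cases hb : ∃ b, b ≠ a ∧ b ^ (q + 1) = 1 ∧ f.eval b = 0
  · obtain ⟨b, hba, hb1, hfb⟩ := hb
    refine ⟨b, ?_⟩
    have h := X_sub_C_sq_dvd hfb (h2 b hb1 hfb)
    rw [hE] at h
    exact (IsCoprime.pow (pairwise_coprime_X_sub_C Function.injective_id hba)).dvd_of_dvd_mul_left h
  push Not at hb
  refine ⟨a, ?_⟩
  have hdvd : (X ^ (q + 1) - 1 : F[X]) ∣ (X - C a) * (X * E ^ m + C a) := by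
    refine X_pow_sub_one_dvd_of_eval_eq_zero q.succ_pos hζ fun z hz1 => ?_
    by_cases hza : z = a
    · simp [hza]
    have h := h1 z hz1 (hb z hza hz1)
    have hz0 : z ≠ 0 := by rintro rfl; simp at hz1
    have hsub : (z - a) * (z * E.eval z ^ m + a) = 0 := by
      rw [hE, eval_mul, mul_pow] at h
      simp only [eval_pow, eval_sub, eval_X, eval_C] at h
      rw [← pow_mul] at h
      have hpq : (z - a) ^ (2 * m) * (z - a) * (z * a) = a - z := by
        rw [← pow_succ, ← hm, ← hσ, map_sub, hσ, hσ]
        rw [pow_succ] at hz1 ha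
        linear_combination a * hz1 - z * ha
      refine (mul_eq_zero.1 (?_ : z * ((z - a) * (z * E.eval z ^ m + a)) = 0)).resolve_left hz0
      linear_combination (E.eval z ^ m * z ^ 2) * hpq - (z - a) * z * a * h
    simpa using hsub
  obtain ⟨B, hB⟩ := hdvd
  have hNmonic : (X ^ (q + 1) - 1 : F[X]).Monic := monic_X_pow_sub_C 1 (Nat.succ_ne_zero q)
  have hNd : (X ^ (q + 1) - 1 : F[X]).natDegree = q + 1 := natDegree_X_pow_sub_C
  obtain ⟨b, rfl⟩ : ∃ b, B = C b := by
    by_cases hB0 : B = 0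
    · exact ⟨0, by simp [hB0]⟩
    have h : ((X - C a) * (X * E ^ m + C a)).natDegree ≤ 1 + (1 + m * 2) :=
      natDegree_mul_le_of_le (natDegree_X_sub_C_le a) (natDegree_add_le_of_degree_le
        (natDegree_mul_le_of_le natDegree_X_le (natDegree_pow_le_of_le m hEd)) (by simp))
    rw [hB, hNmonic.natDegree_mul' hB0, hNd] at h
    exact ⟨_, eq_C_of_natDegree_eq_zero (by omega)⟩
  have hb : b = a ^ 2 := by
    have := congrArg (eval 0) hB
    simp at this
    linear_combination -this
  subst hb
  have hpow : E ^ m = C (a ^ 2) * ((X - C a) ^ 2) ^ m := by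
    refine mul_left_cancel₀ (mul_ne_zero X_ne_zero (X_sub_C_ne_zero a)) ?_
    have h3 : (X - C a) * ((X - C a) ^ 2) ^ m = X ^ q - C (a ^ q) := by
      rw [← hσX, hm, ← pow_mul, ← pow_succ']
    have h4 : C a * C (a ^ q) = 1 := by rw [← C_mul, ← pow_succ', ha, C_1]
    rw [C_pow] at hB ⊢
    linear_combination hB - X * C a ^ 2 * h3 + X * C a * h4
  refine (UniqueFactorizationMonoid.pow_dvd_pow_iff_dvd (n := m) (by omega)).1 ?_
  rw [hpow]
  exact dvd_mul_left _ _

theorem sq_mul_discrim_pow_eq_one {F : Type*} [Field F] {q m : ℕ} (hm : q = 2 * m + 1)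
    (h2 : (2 : F) ≠ 0) (σ : F →+* F) (hσ : ∀ x, σ x = x ^ q)
    (hsq : ∀ k : F, k ^ (2 * m) = 1 → IsSquare k) {z a b c : F} (hz : z * σ z = 1)
    (ha : σ a * z ^ 2 = c) (hb : σ b * z ^ 2 = b) (hc : σ c * z ^ 2 = a)
    (hno : ∀ w, w * σ w = 1 → a * w ^ 2 + b * w + c = 0 → w = z)
    (hD : b ^ 2 - 4 * a * c ≠ 0) : z ^ 2 * (b ^ 2 - 4 * a * c) ^ m = 1 := by
  have hz0 : z ≠ 0 := left_ne_zero_of_mul_eq_one hz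
  have h4 : (4 : F) ≠ 0 := by
    have : (4 : F) = 2 * 2 := by norm_num
    rw [this]; exact mul_ne_zero h2 h2
  obtain ⟨k, hk⟩ : ∃ k, b ^ 2 - 4 * a * c = k * z ^ 2 :=
    ⟨(b ^ 2 - 4 * a * c) / z ^ 2, by field_simp⟩
  have hk0 : k ≠ 0 := by rintro rfl; exact hD (by rw [hk, zero_mul])
  have hkσ : σ k = k := by
    have h := congrArg σ hk
    simp only [map_sub, map_mul, map_pow, map_ofNat] at h
    refine mul_right_cancel₀ (pow_ne_zero 2 hz0) ?_
    rw [← hk]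
    linear_combination (-z ^ 4) * h - (σ k * z ^ 2 * (z * σ z + 1)) * hz
      + (σ b * z ^ 2 + b) * hb - 4 * (σ a * z ^ 2) * hc - 4 * a * ha
  have hk1 : k ^ (2 * m) = 1 := by
    refine mul_right_cancel₀ hk0 ?_
    rw [← pow_succ, ← hm, ← hσ, hkσ, one_mul]
  have hzk : z ^ 2 * (b ^ 2 - 4 * a * c) ^ m = k ^ m := by
    rw [hσ, ← pow_succ', hm] at hz
    rw [hk, mul_pow, ← pow_mul]
    linear_combination k ^ m * hz
  rw [hzk]
  have hkm : (k ^ m) ^ 2 = 1 := by rw [← pow_mul, mul_comm, hk1]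
  rcases mul_self_eq_one_iff.1 ((sq _).symm.trans hkm) with h | h
  · exact h
  exfalso
  obtain ⟨t, ht⟩ := hsq k hk1
  have ht0 : t ≠ 0 := by rintro rfl; simp at ht; exact hk0 ht
  have htσ : σ t = - t := by
    rw [hσ, hm, pow_succ, pow_mul, sq, ← ht, h, neg_one_mul]
  have hone : (1 : F) ≠ -1 := fun h' => h2 (by linear_combination h')
  by_cases ha0 : a = 0
  · have hc0 : c = 0 := by rw [← ha, ha0, map_zero, zero_mul]
    have hb2 : t * t * z ^ 2 = b ^ 2 := by rw [← ht, ← hk, ha0]; ring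
    have hbt : t = b / z ∨ t = - (b / z) := by
      rw [← sq_eq_sq_iff_eq_or_eq_neg, div_pow, ← hb2]
      field_simp
    have hσb : σ (b / z) = b / z := by
      rw [map_div₀, div_eq_div_iff ((map_ne_zero σ).2 hz0) hz0]
      refine mul_right_cancel₀ hz0 ?_
      linear_combination hb - b * hz
    have : σ t = t := by
      rcases hbt with h | h
      · rw [h, hσb]
      · rw [h, map_neg, hσb]
    rw [htσ] at this
    exact (mul_ne_zero h2 ht0) (by linear_combination -this)
  · have hc0 : c ≠ 0 := by
      rw [← ha]; exact mul_ne_zero ((map_ne_zero σ).2 ha0) (pow_ne_zero 2 hz0)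
    have hσa : σ a ≠ 0 := (map_ne_zero σ).2 ha0
    have key : ∀ s : F, s * s = k → σ s = - s → (- b + z * s) / (2 * a) = z := by
      intro s hs hsσ
      refine hno _ ?_ ?_
      · rw [map_div₀]
        simp only [map_add, map_neg, map_mul, map_ofNat, hsσ]
        rw [div_mul_div_comm, div_eq_one_iff_eq (by simp [h2, ha0])]
        refine mul_right_cancel₀ (pow_ne_zero 2 hz0) ?_
        linear_combination (b - z * s) * hb + (b - z * s) * z * s * hz - 4 * a * ha + hk - z ^ 2 * hs
      · field_simp
        linear_combination (z ^ 2) * hs - hk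
    have e1 := key t ht.symm htσ
    have e2 := key (-t) (by rw [neg_mul_neg, ht]) (by rw [map_neg, htσ])
    rw [← e1, div_left_inj' (mul_ne_zero h2 ha0)] at e2
    rw [e1] at e2
    exact mul_ne_zero (mul_ne_zero h2 hz0) ht0 (by linear_combination -e2)

theorem eq_of_discrim_eq_zero {F : Type*} [Field F] (h2 : (2 : F) ≠ 0) (σ : F →+* F)
    {z a b c : F} (hz : z * σ z = 1)
    (ha : σ a * z ^ 2 = c) (hb : σ b * z ^ 2 = b)
    (hno : ∀ w, w * σ w = 1 → a * w ^ 2 + b * w + c = 0 → w = z)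
    (hD : b ^ 2 - 4 * a * c = 0) : b = - 2 * a * z ∧ c = a * z ^ 2 := by
  have hz0 : z ≠ 0 := left_ne_zero_of_mul_eq_one hz
  by_cases ha0 : a = 0
  · subst ha0
    have hc0 : c = 0 := by rw [← ha, map_zero, zero_mul]
    subst hc0
    have hb0 : b = 0 := by simpa using hD
    subst hb0
    have := hno (-z) (by rw [map_neg, neg_mul_neg, hz]) (by ring)
    exact absurd (by linear_combination -this) (mul_ne_zero h2 hz0)
  have hσa : σ a ≠ 0 := (map_ne_zero σ).2 ha0
  have hw : - b / (2 * a) = z := by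
    refine hno _ ?_ ?_
    · rw [map_div₀]
      simp only [map_neg, map_mul, map_ofNat]
      rw [div_mul_div_comm, div_eq_one_iff_eq (by simp [h2, ha0])]
      refine mul_right_cancel₀ (pow_ne_zero 2 hz0) ?_
      linear_combination b * hb - 4 * a * ha + hD
    · field_simp
      linear_combination -hD
  rw [div_eq_iff (mul_ne_zero h2 ha0)] at hw
  have hb' : b = - 2 * a * z := by linear_combination -hw
  refine ⟨hb', ?_⟩
  refine mul_left_cancel₀ (mul_ne_zero (mul_ne_zero h2 h2) ha0) ?_
  rw [hb'] at hD
  linear_combination -hD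

/-- The symmetric polynomial of bidegree `(2, 2)` with the given coefficients. -/
def symmBiquadratic {F : Type*} [CommRing F] (a b c e b' a' : F) : MvPolynomial (Fin 2) F :=
  MvPolynomial.C a + MvPolynomial.C b * (MvPolynomial.X 0 + MvPolynomial.X 1)
    + MvPolynomial.C c * (MvPolynomial.X 0 ^ 2 + MvPolynomial.X 1 ^ 2)
    + MvPolynomial.C e * (MvPolynomial.X 0 * MvPolynomial.X 1)
    + MvPolynomial.C b' * (MvPolynomial.X 0 * MvPolynomial.X 1
        * (MvPolynomial.X 0 + MvPolynomial.X 1))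
    + MvPolynomial.C a' * (MvPolynomial.X 0 ^ 2 * MvPolynomial.X 1 ^ 2)

/-- The discriminant of `symmBiquadratic` with respect to its second variable. -/
def symmBiquadraticDiscrim {F : Type*} [CommRing F] (a b c e b' a' : F) : F[X] :=
  (C b + C e * X + C b' * X ^ 2) ^ 2
    - 4 * (C c + C b' * X + C a' * X ^ 2) * (C a + C b * X + C c * X ^ 2)

theorem not_irreducible_symmBiquadratic {K : Type*} [Field K] (h2 : (2 : K) ≠ 0)
    {a b c e b' a' : K} (h0 : c = 0 → b' = 0 → a' = 0 → a = 0 ∧ b = 0)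
    {s : K[X]} (hs : symmBiquadraticDiscrim a b c e b' a' = s ^ 2) :
    ¬ Irreducible (symmBiquadratic a b c e b' a') := by
  intro hirr
  obtain ⟨A, hA⟩ : ∃ A : K[X], A = C c + C b' * X + C a' * X ^ 2 := ⟨_, rfl⟩
  obtain ⟨B, hB⟩ : ∃ B : K[X], B = C b + C e * X + C b' * X ^ 2 := ⟨_, rfl⟩
  by_cases hA0 : A = 0
  · have hc : c = 0 := by simpa [hA] using congrArg (coeff · 0) hA0
    have hb' : b' = 0 := by simpa [hA, coeff_X, coeff_C] using congrArg (coeff · 1) hA0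
    have ha' : a' = 0 := by simpa [hA, coeff_X, coeff_C] using congrArg (coeff · 2) hA0
    obtain ⟨ha, hb⟩ := h0 hc hb' ha'
    have hX : ∀ i : Fin 2, ∀ r : MvPolynomial (Fin 2) K, ¬ IsUnit (r * MvPolynomial.X i) := by
      intro i r hu
      have := hu.map (MvPolynomial.aeval (fun _ : Fin 2 => (0 : K)))
      simp at this
    have hfac : symmBiquadratic a b c e b' a' =
        (MvPolynomial.C e * MvPolynomial.X 0) * (1 * MvPolynomial.X 1) := by
      simp only [symmBiquadratic, ha, hb, hc, hb', ha', map_zero]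
      ring
    rcases hirr.isUnit_or_isUnit hfac with h | h
    · exact hX _ _ h
    · exact hX _ _ h
  · have hprime := hirr.prime
    let ι : K[X] →ₐ[K] MvPolynomial (Fin 2) K := aeval (MvPolynomial.X 0)
    have hdvd : symmBiquadratic a b c e b' a' ∣
        (ι (2 * A) * MvPolynomial.X 1 + ι (B - s)) * (ι (2 * A) * MvPolynomial.X 1 + ι (B + s)) := by
      refine ⟨4 * ι A, ?_⟩
      have h := congrArg ι hs
      simp only [symmBiquadraticDiscrim, hA, hB, symmBiquadratic, ι, map_sub, map_add, map_mul,
        map_pow, aeval_C, aeval_X, MvPolynomial.algebraMap_eq, map_ofNat] at h ⊢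
      linear_combination h
    let φ : MvPolynomial (Fin 2) K →ₐ[K] K[X][X] := MvPolynomial.aeval ![C X, X]
    have hφι : ∀ r : K[X], φ (ι r) = C r := by
      intro r
      have : (φ.comp ι) = CAlgHom := by
        ext
        simp [φ, ι]
      exact DFunLike.congr_fun this r
    have hφ : φ (symmBiquadratic a b c e b' a') =
        C A * X ^ 2 + C B * X + C (C a + C b * X + C c * X ^ 2) := by
      have hC : ∀ x : K, algebraMap K K[X][X] x = C (C x) := fun _ => rfl
      simp only [symmBiquadratic, φ, map_add, map_mul, map_pow, MvPolynomial.aeval_C,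
        MvPolynomial.aeval_X, hC, hA, hB]
      simp
      ring
    have hndvd : ∀ r : K[X], ¬ symmBiquadratic a b c e b' a' ∣
        (ι (2 * A) * MvPolynomial.X 1 + ι r) := by
      intro r hr
      have h2A : 2 * A ≠ 0 :=
        mul_ne_zero (by rw [← C_ofNat]; exact C_ne_zero.2 h2) hA0
      have h := map_dvd φ hr
      have hφr : φ (ι (2 * A) * MvPolynomial.X 1 + ι r) = C (2 * A) * X + C r := by
        have hX1 : φ (MvPolynomial.X 1) = X := by simp [φ]
        rw [map_add φ, map_mul φ, hφι, hφι, hX1]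
      rw [hφ, hφr] at h
      have hd := natDegree_le_of_dvd h (fun h0 => by
        have := congrArg natDegree h0
        rw [natDegree_linear h2A] at this
        simp at this)
      rw [natDegree_quadratic hA0, natDegree_linear h2A] at hd
      omega
    exact (hprime.dvd_or_dvd hdvd).elim (hndvd _) (hndvd _)

theorem exists_isPrimitiveRoot_succ_of_card_eq_sq {F : Type*} [Field F] [Fintype F] {q : ℕ}
    (hF : Fintype.card F = q ^ 2) :
    ∃ g : F, g ≠ 0 ∧ IsPrimitiveRoot (g ^ (q - 1)) (q + 1) := by
  obtain ⟨g, hg⟩ := IsCyclic.exists_generator (α := Fˣ)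
  have hord : orderOf g = (q - 1) * (q + 1) := by
    rw [orderOf_eq_card_of_forall_mem_zpowers hg, Nat.card_units, Nat.card_eq_fintype_card, hF,
      mul_comm, ← Nat.sq_sub_sq, one_pow]
  have h := IsPrimitiveRoot.orderOf g
  refine ⟨g, g.ne_zero, ?_⟩
  have h' := h.pow (orderOf_pos g) hord
  rw [← IsPrimitiveRoot.coe_units_iff] at h'
  simpa using h'

theorem Ptilde_cubic {F : Type*} [Field F] {q : ℕ} (hq : Odd q) {δ γ θ : F} {P : F[X]}
    (hP : P = X ^ 3 - C δ * X ^ 2 - C γ * X - C θ) :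
    Ptilde q P = 1 - C (δ ^ q) * X - C (γ ^ q) * X ^ 2 - C (θ ^ q) * X ^ 3 := by
  have hd : P.natDegree = 3 := by rw [hP]; compute_degree!
  have e0 : P.coeff 0 = -θ := by rw [hP]; simp
  have e1 : P.coeff 1 = -γ := by rw [hP]; simp [coeff_X_pow, coeff_C]
  have e2 : P.coeff 2 = -δ := by rw [hP]; simp
  have e3 : P.coeff 3 = 1 := by rw [hP]; simp
  rw [Ptilde, hd]
  simp [Finset.sum_range_succ, e0, e1, e2, e3, hq.neg_pow]
  ring

theorem mul_symmBiquadratic_eq_Gpol {F : Type*} [Field F] {q : ℕ} (hq : Odd q) {δ γ θ : F}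
    {P : F[X]} (hP : P = X ^ 3 - C δ * X ^ 2 - C γ * X - C θ) :
    (MvPolynomial.X 0 - MvPolynomial.X 1) *
      symmBiquadratic (-γ - θ * δ ^ q) (-δ - θ * γ ^ q) (1 - θ * θ ^ q)
        (1 - θ * θ ^ q + (δ * δ ^ q - γ * γ ^ q)) (-δ ^ q - γ * θ ^ q) (-γ ^ q - δ * θ ^ q) =
      Gpol q P := by
  rw [Gpol, Ptilde_cubic hq hP, hP]
  simp only [symmBiquadratic, eval₂_sub, eval₂_mul, eval₂_pow, eval₂_X, eval₂_C, eval₂_one,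
    map_sub, map_mul, map_neg, map_one, map_add]
  ring

theorem eq_of_eval_mul_eval_Ptilde_eq {F : Type*} [Field F] {q : ℕ} (hq : Odd q) (σ : F →+* F)
    (hσ : ∀ x, σ x = x ^ q) (hσσ : ∀ x, σ (σ x) = x) {P : F[X]} {δ γ θ : F}
    (hP : P = X ^ 3 - C δ * X ^ 2 - C γ * X - C θ) (hcond : Condition1 q 3 P) {x y : F}
    (hx : x ≠ 0) (hy : y ≠ 0)
    (h : P.eval (x ^ (q - 1)) * (Ptilde q P).eval (y ^ (q - 1)) =
      (Ptilde q P).eval (x ^ (q - 1)) * P.eval (y ^ (q - 1))) :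
    x ^ (q - 1) = y ^ (q - 1) := by
  have hpow : ∀ u : F, u ≠ 0 → u ^ (q - 1) * u = σ u := fun u _ => by
    rw [hσ, ← pow_succ, Nat.sub_add_cancel hq.pos]
  have hval : ∀ u : F, u ≠ 0 → (u ^ 3 * P.eval (u ^ (q - 1))) ^ q =
      u ^ 3 * (Ptilde q P).eval (u ^ (q - 1)) := by
    intro u hu
    have h1 := hpow u hu
    generalize u ^ (q - 1) = z at *
    have h2 : σ z * σ u = u := by rw [← map_mul, h1, hσσ]
    rw [← hσ, Ptilde_cubic hq hP, hP]
    simp only [eval_sub, eval_mul, eval_pow, eval_X, eval_C, eval_one, map_sub, map_mul, map_pow,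
      ← hσ]
    have hσu : σ u = z * u := h1.symm
    rw [hσu] at h2 ⊢
    have h3 : σ z * z = 1 := mul_right_cancel₀ hu (by linear_combination h2)
    linear_combination u ^ 3 * ((σ z * z) ^ 2 + σ z * z + 1) * h3
      - u ^ 3 * z * σ δ * (σ z * z + 1) * h3 - u ^ 3 * z ^ 2 * σ γ * h3
  have hfin := hcond x y hx hy (by rw [hval x hx, hval y hy]; linear_combination x ^ 3 * y ^ 3 * h)
  rw [← hσ, ← hσ, ← hpow x hx, ← hpow y hy] at hfin
  refine mul_right_cancel₀ (mul_ne_zero hx hy) ?_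
  linear_combination -hfin

/-- Lemma: for a cubic `P(x) = x³ − δx² − γx − θ`, if `H_P = G_P/(z-w)` is absolutely
irreducible (irreducible over the algebraic closure) then `P` does not satisfy
Condition (1) with `m = 3`. -/
theorem statement4 (p n q : ℕ) (hp : p.Prime) (hp3 : 3 < p) (hn : n ≠ 0) (hq : q = p ^ n)
    (F : Type*) [Field F] [Fintype F] (hF : Fintype.card F = q ^ 2)
    (δ γ θ : F) (P : Polynomial F) (hP : P = X ^ 3 - C δ * X ^ 2 - C γ * X - C θ)
    (H : MvPolynomial (Fin 2) F)
    (hH : (MvPolynomial.X 0 - MvPolynomial.X 1) * H = Gpol q P)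
    (habs : Irreducible (MvPolynomial.map (algebraMap F (AlgebraicClosure F)) H)) :
    ¬ Condition1 q 3 P := by
  intro hcond
  have : Fact p.Prime := ⟨hp⟩
  have hp4 : 4 < p := by
    rcases (show p = 4 ∨ 4 < p by omega) with rfl | h
    · exact absurd hp (by norm_num)
    · exact h
  have : CharP F p := charP_of_card_eq_prime_pow (f := n * 2) (by rw [hF, hq, pow_mul])
  have hpodd : Odd p := hp.odd_of_ne_two (by omega)
  have hqodd : Odd q := hq ▸ hpodd.pow
  have hpq : p ≤ q := hq ▸ Nat.le_self_pow hn p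
  obtain ⟨m, hm⟩ := hqodd
  have hqodd : Odd q := ⟨m, hm⟩
  let σ : F →+* F := iterateFrobenius F p n
  have hσ : ∀ x, σ x = x ^ q := fun x => by rw [hq]; rfl
  have hσσ : ∀ x, σ (σ x) = x := fun x => by
    rw [hσ, hσ, ← pow_mul, ← sq, ← hF, FiniteField.pow_card]
  have hσX : ∀ a : F, (X - C a) ^ q = X ^ q - C (a ^ q) := fun a => by
    rw [hq, sub_pow_char_pow, C_pow]
  clear_value σ
  have hq0 : (q : F) = 0 := by rw [hq]; simp [hn]
  have h2 : (2 : F) ≠ 0 := by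
    intro h
    have := Nat.le_of_dvd two_pos ((CharP.cast_eq_zero_iff F p 2).1 (by exact_mod_cast h))
    omega
  obtain ⟨g, hg0, hζ⟩ := exists_isPrimitiveRoot_succ_of_card_eq_sq hF
  have hsq : ∀ k : F, k ^ (2 * m) = 1 → IsSquare k := by
    intro k hk
    have hk0 : k ≠ 0 := by
      rintro rfl
      rw [zero_pow (by omega)] at hk
      exact zero_ne_one hk
    rw [FiniteField.isSquare_iff (by rw [ringChar.eq F p]; omega) hk0, hF]
    have : q ^ 2 / 2 = 2 * m * (m + 1) := by
      rw [hm, show (2 * m + 1) ^ 2 = 1 + 2 * (2 * m * (m + 1)) by ring]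
      omega
    rw [this, pow_mul, hk, one_pow]
  have hH' := mul_symmBiquadratic_eq_Gpol hqodd hP
  rw [← hH] at hH'
  have hXX : (MvPolynomial.X 0 - MvPolynomial.X 1 : MvPolynomial (Fin 2) F) ≠ 0 :=
    sub_ne_zero.2 (fun h => by simpa using MvPolynomial.X_injective h)
  have hHe := mul_left_cancel₀ hXX hH'
  have hno : ∀ z w : F, z ^ (q + 1) = 1 → w ^ (q + 1) = 1 →
      MvPolynomial.eval ![z, w] H = 0 → w = z := by
    intro z w hz hw hzw
    obtain ⟨i, -, rfl⟩ := hζ.eq_pow_of_pow_eq_one hz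
    obtain ⟨j, -, rfl⟩ := hζ.eq_pow_of_pow_eq_one hw
    rw [pow_right_comm g _ i, pow_right_comm g _ j] at hzw ⊢
    refine (eq_of_eval_mul_eval_Ptilde_eq hqodd σ hσ hσσ hP hcond (pow_ne_zero i hg0)
      (pow_ne_zero j hg0) ?_).symm
    have h := congrArg (MvPolynomial.eval ![(g ^ i) ^ (q - 1), (g ^ j) ^ (q - 1)]) hH
    rw [map_mul, hzw, mul_zero, Gpol, map_sub, map_mul, map_mul, eq_comm, sub_eq_zero] at h
    have hev : ∀ (Q : F[X]) (v : Fin 2 → F) (k : Fin 2),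
        MvPolynomial.eval v (Q.eval₂ MvPolynomial.C (MvPolynomial.X k)) = Q.eval (v k) := by
      intro Q v k
      have hid : (MvPolynomial.eval v).comp MvPolynomial.C = RingHom.id F := by
        ext
        simp
      rw [hom_eval₂, hid, MvPolynomial.eval_X, eval₂_id]
    simpa [hev] using h
  rw [← hHe] at habs hno
  simp only [← hσ] at habs hno
  generalize ha : -γ - θ * σ δ = a at *
  generalize hb : -δ - θ * σ γ = b at *
  generalize hc : 1 - θ * σ θ = c at *
  generalize he : c + (δ * σ δ - γ * σ γ) = e at *
  have hσa : -σ γ - δ * σ θ = σ a := by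
    rw [← ha]; simp only [map_sub, map_neg, map_mul, hσσ]; ring
  have hσb : -σ δ - γ * σ θ = σ b := by
    rw [← hb]; simp only [map_sub, map_neg, map_mul, hσσ]; ring
  have hσc : σ c = c := by
    rw [← hc]; simp only [map_sub, map_mul, map_one, hσσ]; ring
  have hσe : σ e = e := by
    rw [← he]; simp only [map_sub, map_add, map_mul, hσσ, hσc]; ring
  rw [hσa, hσb] at habs hno
  have hnow : ∀ z, z * σ z = 1 → ∀ w, w * σ w = 1 →
      (c + σ b * z + σ a * z ^ 2) * w ^ 2 + (b + e * z + σ b * z ^ 2) * w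
        + (a + b * z + c * z ^ 2) = 0 → w = z := by
    intro z hz w hw h
    refine hno z w (by rw [pow_succ', ← hσ, hz]) (by rw [pow_succ', ← hσ, hw]) ?_
    simp [symmBiquadratic]
    linear_combination h
  have hA : ∀ z, z * σ z = 1 → σ (c + σ b * z + σ a * z ^ 2) * z ^ 2 = a + b * z + c * z ^ 2 := by
    intro z hz
    simp only [map_add, map_mul, map_pow, hσσ, hσc]
    linear_combination (b * z + a * (z * σ z + 1)) * hz
  have hB : ∀ z, z * σ z = 1 → σ (b + e * z + σ b * z ^ 2) * z ^ 2 = b + e * z + σ b * z ^ 2 := by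
    intro z hz
    simp only [map_add, map_mul, map_pow, hσσ, hσe]
    linear_combination (e * z + b * (z * σ z + 1)) * hz
  have hC : ∀ z, z * σ z = 1 → σ (a + b * z + c * z ^ 2) * z ^ 2 = c + σ b * z + σ a * z ^ 2 := by
    intro z hz
    simp only [map_add, map_mul, map_pow, hσc]
    linear_combination (σ b * z + c * (z * σ z + 1)) * hz
  obtain ⟨f, hf⟩ : ∃ f, f = symmBiquadraticDiscrim a b c e (σ b) (σ a) := ⟨_, rfl⟩
  have hfe : ∀ z, f.eval z = (b + e * z + σ b * z ^ 2) ^ 2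
      - 4 * (c + σ b * z + σ a * z ^ 2) * (a + b * z + c * z ^ 2) := by
    intro z
    simp [hf, symmBiquadraticDiscrim]
  obtain ⟨κ, s, hs⟩ : ∃ κ s, f = C κ * s ^ 2 := by
    refine quartic_eq_C_mul_sq hp4 hm (by omega) σ hσ hσX hq0 hζ
      (c₀ := b ^ 2 - 4 * a * c) (c₁ := 2 * b * e - 4 * (c * b + σ b * a))
      (c₂ := e ^ 2 + 2 * b * σ b - 4 * (c * c + σ b * b + σ a * a))
      (c₃ := 2 * e * σ b - 4 * (σ b * c + σ a * b)) (c₄ := σ b ^ 2 - 4 * σ a * c)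
      ?_ ?_ ?_ ?_ ?_
    · rw [hf, symmBiquadraticDiscrim]
      simp only [C_sub, C_add, C_mul, C_pow, C_ofNat]
      ring
    · intro h
      have := congrArg σ h
      simp only [map_sub, map_add, map_mul, map_ofNat, hσσ, hσc, hσe, map_zero] at this
      linear_combination this
    · intro h
      have := congrArg σ h
      simp only [map_sub, map_add, map_mul, map_ofNat, hσσ, hσc, hσe, map_zero] at this
      linear_combination this
    · intro z hz hfz
      rw [pow_succ', ← hσ] at hz
      rw [hfe] at hfz ⊢
      exact sq_mul_discrim_pow_eq_one hm h2 σ hσ hsq hz (hA z hz) (hB z hz) (hC z hz)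
        (hnow z hz) hfz
    · intro z hz hfz
      rw [pow_succ', ← hσ] at hz
      rw [hfe] at hfz
      obtain ⟨h3, h4⟩ := eq_of_discrim_eq_zero h2 σ hz (hA z hz) (hB z hz) (hnow z hz) hfz
      rw [hf, symmBiquadraticDiscrim, sq (C b + _ + _)]
      simp
      linear_combination (2 * (e + 2 * σ b * z) - 4 * (c + σ b * z + σ a * z ^ 2)) * h3
        - 4 * (σ b + 2 * σ a * z) * h4
  let K := AlgebraicClosure F
  obtain ⟨ι, hι⟩ := IsAlgClosed.exists_pow_nat_eq (algebraMap F K κ) two_pos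
  let ψ := algebraMap F K
  refine not_irreducible_symmBiquadratic (a := ψ a) (b := ψ b) (c := ψ c) (e := ψ e)
    (b' := ψ (σ b)) (a' := ψ (σ a)) (s := C ι * s.map ψ) ?_ ?_ ?_ ?_
  · rw [← map_ofNat ψ 2]
    exact (map_ne_zero ψ).2 h2
  · intro _ hb0 ha0
    rw [map_eq_zero, map_eq_zero] at hb0 ha0
    simp [ha0, hb0]
  · rw [mul_pow, ← C_pow, hι]
    have := congrArg (Polynomial.map ψ) (hf.symm.trans hs)
    simpa [symmBiquadraticDiscrim] using this
  · simpa [symmBiquadratic, ψ] using habs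
end
end

section
/- Let P(x) be a monic irreducible cubic in F_{q^2}[x]. If H_P(z,w) is reducible over the algebraic closure of F_q, then H_P(z,w) is reducible over F_{q^2}, and in fact H_P(z,w) = μ(czw + az + bw + d)(czw + bz + aw + d) for some a, b, c, d, μ ∈ F_{q^2} with a ≠ b. -/
noncomputable section

open Polynomial

/-- A nonunit in two variables that does not involve the variable `i` vanishes on a whole line. -/
theorem MvPolynomial.exists_eval_eq_zero_of_degreeOf_eq_zero {K : Type*} [Field K] [IsAlgClosed K]
    {A : MvPolynomial (Fin 2) K} (hA : ¬ IsUnit A) {i j : Fin 2} (hij : i ≠ j)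
    (hi : A.degreeOf i = 0) : ∃ x : K, ∀ v : Fin 2 → K, v j = x → MvPolynomial.eval v A = 0 := by
  obtain ⟨g, rfl⟩ := MvPolynomial.exists_rename_eq_of_vars_subset_range A (fun _ : Unit => j)
    (fun _ _ _ => rfl) (by
      intro k hk
      have : k ≠ i := fun h => MvPolynomial.mem_vars_iff_degreeOf_ne_zero.1 hk (h ▸ hi)
      exact ⟨(), by simp only; omega⟩)
  have hg : (MvPolynomial.uniqueAlgEquiv K Unit g).degree ≠ 0 := by
    intro h
    have h1 := Polynomial.isUnit_iff_degree_eq_zero.2 h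
    have h2 : IsUnit g := by
      have := h1.map (MvPolynomial.uniqueAlgEquiv K Unit).symm
      rwa [AlgEquiv.symm_apply_apply] at this
    exact hA (h2.map _)
  obtain ⟨x, hx⟩ := IsAlgClosed.exists_root _ hg
  refine ⟨x, fun v hv => ?_⟩
  rw [MvPolynomial.eval_rename]
  rw [Polynomial.IsRoot.def, Polynomial.eval, MvPolynomial.eval₂_const_uniqueAlgEquiv] at hx
  rw [← hx, MvPolynomial.eval, MvPolynomial.coe_eval₂Hom]
  congr 1
  funext k
  exact hv

theorem MvPolynomial.exists_eq_of_degreeOf_le_one {K : Type*} [CommRing K]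
    {A : MvPolynomial (Fin 2) K} (h0 : A.degreeOf 0 ≤ 1) (h1 : A.degreeOf 1 ≤ 1) :
    ∃ c a b d : K, A = MvPolynomial.C c * MvPolynomial.X 0 * MvPolynomial.X 1 +
      MvPolynomial.C a * MvPolynomial.X 0 + MvPolynomial.C b * MvPolynomial.X 1 +
      MvPolynomial.C d := by
  classical
  let s : ℕ → ℕ → (Fin 2 →₀ ℕ) := fun i j => Finsupp.single (0 : Fin 2) i + Finsupp.single (1 : Fin 2) j
  refine ⟨A.coeff (s 1 1), A.coeff (s 1 0), A.coeff (s 0 1), A.coeff (s 0 0), ?_⟩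
  have e : MvPolynomial.C (A.coeff (s 1 1)) * MvPolynomial.X 0 * MvPolynomial.X 1 +
      MvPolynomial.C (A.coeff (s 1 0)) * MvPolynomial.X 0 +
      MvPolynomial.C (A.coeff (s 0 1)) * MvPolynomial.X 1 +
      MvPolynomial.C (A.coeff (s 0 0)) =
      MvPolynomial.monomial (s 1 1) (A.coeff (s 1 1)) +
      MvPolynomial.monomial (s 1 0) (A.coeff (s 1 0)) +
      MvPolynomial.monomial (s 0 1) (A.coeff (s 0 1)) +
      MvPolynomial.monomial (s 0 0) (A.coeff (s 0 0)) := by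
    simp only [s, MvPolynomial.X, MvPolynomial.monomial_mul, mul_one,
      Finsupp.single_zero, add_zero, zero_add, MvPolynomial.C_apply]
  rw [e]
  ext m
  simp only [MvPolynomial.coeff_add, MvPolynomial.coeff_monomial]
  have hs : ∀ i j, s i j = m ↔ i = m 0 ∧ j = m 1 := by
    intro i j
    rw [Finsupp.ext_iff, Fin.forall_fin_two]
    simp [s]
  by_cases hm : m ∈ A.support
  · have k0 := (MvPolynomial.monomial_le_degreeOf 0 hm).trans h0
    have k1 := (MvPolynomial.monomial_le_degreeOf 1 hm).trans h1
    have hm' : A.coeff m = A.coeff (s (m 0) (m 1)) := by rw [(hs _ _).2 ⟨rfl, rfl⟩]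
    simp only [hs, hm']
    interval_cases m 0 <;> interval_cases m 1 <;> simp
  · have hz := MvPolynomial.notMem_support_iff.1 hm
    have : ∀ i j, (if s i j = m then A.coeff (s i j) else 0) = 0 := by
      intro i j
      split_ifs with h
      · rw [h, hz]
      · rfl
    simp only [this, hz, add_zero]

theorem FiniteField.mem_range_algebraMap_of_pow_card_eq {F K : Type*} [Field F] [Fintype F]
    [Field K] [Algebra F K] {x : K} (hx : x ^ Fintype.card F = x) :
    x ∈ (algebraMap F K).range := by
  have hs : ((X : F[X]) ^ Fintype.card F - X).Splits := by
    rw [Polynomial.splits_iff_card_roots, FiniteField.roots_X_pow_card_sub_X,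
      FiniteField.X_pow_card_sub_X_natDegree_eq _ Fintype.one_lt_card]
    simp
  have h0 := FiniteField.X_pow_card_sub_X_ne_zero F (Fintype.one_lt_card (α := F))
  exact hs.mem_range_of_isRoot h0 (by simp [hx])

theorem bilinear_proportional_of_cyclic_zeros {K : Type*} [Field K] {α β γ c a b d : K}
    (h₁ : c * α * β + a * α + b * β + d = 0) (h₂ : c * β * γ + a * β + b * γ + d = 0)
    (h₃ : c * γ * α + a * γ + b * α + d = 0) (hαβ : α ≠ β) (hβγ : β ≠ γ) (hγα : γ ≠ α) :
    ∃ k : K, c = k * -(α ^ 2 + β ^ 2 + γ ^ 2 - α * β - β * γ - γ * α) ∧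
      a = k * (α ^ 2 * β + β ^ 2 * γ + γ ^ 2 * α - 3 * (α * β * γ)) ∧
      b = k * (α ^ 2 * γ + β ^ 2 * α + γ ^ 2 * β - 3 * (α * β * γ)) ∧
      d = k * (α * β * γ * (α + β + γ) - α ^ 2 * β ^ 2 - β ^ 2 * γ ^ 2 - γ ^ 2 * α ^ 2) := by
  have hΔ : (α - β) * (β - γ) * (γ - α) ≠ 0 :=
    mul_ne_zero (mul_ne_zero (sub_ne_zero.2 hαβ) (sub_ne_zero.2 hβγ)) (sub_ne_zero.2 hγα)
  refine ⟨-(a - b) / ((α - β) * (β - γ) * (γ - α)), ?_, ?_, ?_, ?_⟩ <;>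
    rw [div_mul_eq_mul_div, eq_div_iff hΔ]
  · linear_combination -(α - β) * (h₁ - h₂) - (α - γ) * (h₂ - h₃)
  · linear_combination -γ * (β - α) * (h₁ - h₂) + β * (α - γ) * (h₂ - h₃)
  · linear_combination -γ * (β - α) * (h₁ - h₂) + β * (α - γ) * (h₂ - h₃)
  · linear_combination (α - β) * (β - γ) * (γ - α) * h₁ -
      α * β * (-(α - β) * (h₁ - h₂) - (α - γ) * (h₂ - h₃)) -
      (α + β) * (-γ * (β - α) * (h₁ - h₂) + β * (α - γ) * (h₂ - h₃))

theorem bilinear_factors_of_cubic_pencil {K : Type*} [Field K] {α β γ : K} (hαβ : α ≠ β)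
    (hβγ : β ≠ γ) (hγα : γ ≠ α) (h0 : α * β * γ ≠ 0) {t : K → K} (hα : t α ≠ 0) (hβ : t β ≠ 0)
    (hγ : t γ ≠ 0) {c a b d c' a' b' d' : K}
    (h : ∀ x y : K, (x - y) * ((c * x * y + a * x + b * y + d) * (c' * x * y + a' * x + b' * y + d'))
      = (x - α) * (x - β) * (x - γ) * t y - t x * ((y - α) * (y - β) * (y - γ))) :
    ((c * α * β + a * α + b * β + d = 0 ∧ c * β * γ + a * β + b * γ + d = 0 ∧
        c * γ * α + a * γ + b * α + d = 0) ∧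
      (c' * α * γ + a' * α + b' * γ + d' = 0 ∧ c' * γ * β + a' * γ + b' * β + d' = 0 ∧
        c' * β * α + a' * β + b' * α + d' = 0)) ∨
    ((c' * α * β + a' * α + b' * β + d' = 0 ∧ c' * β * γ + a' * β + b' * γ + d' = 0 ∧
        c' * γ * α + a' * γ + b' * α + d' = 0) ∧
      (c * α * γ + a * α + b * γ + d = 0 ∧ c * γ * β + a * γ + b * β + d = 0 ∧
        c * β * α + a * β + b * α + d = 0)) := by
  have hzero : ∀ x y : K, x ≠ y → (x - α) * (x - β) * (x - γ) = 0 →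
      (y - α) * (y - β) * (y - γ) = 0 →
      c * x * y + a * x + b * y + d = 0 ∨ c' * x * y + a' * x + b' * y + d' = 0 := by
    intro x y hxy hx hy
    have := h x y
    rw [hx, hy, zero_mul, mul_zero, sub_zero] at this
    exact mul_eq_zero.1 ((mul_eq_zero.1 this).resolve_left (sub_ne_zero.2 hxy))
  have hrow : ∀ x : K, (x - α) * (x - β) * (x - γ) = 0 → t x ≠ 0 →
      a * x + d ≠ 0 ∧ a' * x + d' ≠ 0 := by
    intro x hx ht
    have h1 := h x 0
    rw [hx] at h1
    have h2 : t x * (α * β * γ) ≠ 0 := mul_ne_zero ht h0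
    constructor <;> intro h3 <;> apply h2
    · linear_combination -h1 + x * (a' * x + d') * h3
    · linear_combination -h1 + x * (a * x + d) * h3
  have hcol : ∀ y : K, (y - α) * (y - β) * (y - γ) = 0 → t y ≠ 0 →
      b * y + d ≠ 0 ∧ b' * y + d' ≠ 0 := by
    intro x hx ht
    have h1 := h 0 x
    rw [hx] at h1
    have h2 : t x * (α * β * γ) ≠ 0 := mul_ne_zero ht h0
    constructor <;> intro h3 <;> apply h2
    · linear_combination h1 + x * (b' * x + d') * h3
    · linear_combination h1 + x * (b * x + d) * h3
  have line : ∀ {u v y z : K}, y ≠ z → u * y + v = 0 → u * z + v = 0 → v = 0 := by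
    intro u v y z hyz h1 h2
    have hu : u = 0 := by
      have : u * (y - z) = 0 := by linear_combination h1 - h2
      exact (mul_eq_zero.1 this).resolve_right (sub_ne_zero.2 hyz)
    simpa [hu] using h1
  have hrowA : ∀ x y z : K, (x - α) * (x - β) * (x - γ) = 0 → t x ≠ 0 → y ≠ z →
      c * x * y + a * x + b * y + d = 0 → c * x * z + a * x + b * z + d = 0 → False := by
    intro x y z hx ht hyz h1 h2
    exact (hrow x hx ht).1 (line (u := c * x + b) hyz (by linear_combination h1)
      (by linear_combination h2))
  have hrowB : ∀ x y z : K, (x - α) * (x - β) * (x - γ) = 0 → t x ≠ 0 → y ≠ z →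
      c' * x * y + a' * x + b' * y + d' = 0 → c' * x * z + a' * x + b' * z + d' = 0 → False := by
    intro x y z hx ht hyz h1 h2
    exact (hrow x hx ht).2 (line (u := c' * x + b') hyz (by linear_combination h1)
      (by linear_combination h2))
  have hcolA : ∀ x y z : K, (x - α) * (x - β) * (x - γ) = 0 → t x ≠ 0 → y ≠ z →
      c * y * x + a * y + b * x + d = 0 → c * z * x + a * z + b * x + d = 0 → False := by
    intro x y z hx ht hyz h1 h2
    exact (hcol x hx ht).1 (line (u := c * x + a) hyz (by linear_combination h1)
      (by linear_combination h2))
  have hcolB : ∀ x y z : K, (x - α) * (x - β) * (x - γ) = 0 → t x ≠ 0 → y ≠ z →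
      c' * y * x + a' * y + b' * x + d' = 0 → c' * z * x + a' * z + b' * x + d' = 0 → False := by
    intro x y z hx ht hyz h1 h2
    exact (hcol x hx ht).2 (line (u := c' * x + a') hyz (by linear_combination h1)
      (by linear_combination h2))
  have rα : (α - α) * (α - β) * (α - γ) = 0 := by ring
  have rβ : (β - α) * (β - β) * (β - γ) = 0 := by ring
  have rγ : (γ - α) * (γ - β) * (γ - γ) = 0 := by ring
  have z1 := hzero α β hαβ rα rβ
  have z2 := hzero β γ hβγ rβ rγ
  have z3 := hzero γ α hγα rγ rα
  have z4 := hzero α γ hγα.symm rα rγ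
  have z5 := hzero γ β hβγ.symm rγ rβ
  have z6 := hzero β α hαβ.symm rβ rα
  have a1 := hrowA α β γ rα hα hβγ
  have a2 := hrowA β γ α rβ hβ hγα
  have a3 := hrowA γ α β rγ hγ hαβ
  have a4 := hcolA α β γ rα hα hβγ
  have a5 := hcolA β γ α rβ hβ hγα
  have a6 := hcolA γ α β rγ hγ hαβ
  have b1 := hrowB α β γ rα hα hβγ
  have b2 := hrowB β γ α rβ hβ hγα
  have b3 := hrowB γ α β rγ hγ hαβ
  have b4 := hcolB α β γ rα hα hβγ
  have b5 := hcolB β γ α rβ hβ hγα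
  have b6 := hcolB γ α β rγ hγ hαβ
  rcases z1 with h | h
  · have k1 := z4.resolve_left (a1 h)
    have k2 := z5.resolve_left fun k => a5 k h
    have k3 := z2.resolve_right (b6 k1)
    exact .inl ⟨⟨h, k3, z3.resolve_right fun k => b3 k k2⟩, k1, k2, z6.resolve_left (a2 k3)⟩
  · have k1 := z4.resolve_right (b1 h)
    have k2 := z5.resolve_right fun k => b5 k h
    have k3 := z2.resolve_left (a6 k1)
    exact .inr ⟨⟨h, k3, z3.resolve_left fun k => a3 k k2⟩, k1, k2, z6.resolve_right (b2 k3)⟩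

theorem Irreducible.exists_frobenius_roots_of_natDegree_eq_three {F K : Type*} [Field F]
    [Fintype F] [Field K] [IsAlgClosed K] [Algebra F K] {P : F[X]} (hP : Irreducible P) (hmon : P.Monic)
    (hdeg : P.natDegree = 3) :
    ∃ α β γ : K, α ≠ β ∧ β ≠ γ ∧ γ ≠ α ∧ α * β * γ ≠ 0 ∧ α ^ Fintype.card F = β ∧
      β ^ Fintype.card F = γ ∧ γ ^ Fintype.card F = α ∧
      ∀ x : K, aeval x P = (x - α) * (x - β) * (x - γ) := by
  obtain ⟨α, hα⟩ := IsAlgClosed.exists_aeval_eq_zero K P hP.degree_pos.ne'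
  have hpow : ∀ n : ℕ, α ^ Fintype.card F ^ n = α ↔ 3 ∣ n := by
    intro n
    rw [← hdeg, hP.natDegree_dvd_iff_dvd_X_pow_card_pow_sub_X, ← hP.dvd_iff_aeval_eq_zero hα]
    simp [sub_eq_zero]
  let φ := FiniteField.frobeniusAlgHom F K
  have hφ : ∀ x, φ x = x ^ Fintype.card F := fun x => rfl
  have hroot : ∀ x : K, aeval x P = 0 → aeval (φ x) P = 0 := by
    intro x hx
    rw [aeval_algHom_apply, hx, map_zero]
  have hβ : φ (φ α) = α ^ Fintype.card F ^ 2 := by rw [hφ, hφ, sq, pow_mul]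
  have hγ : φ (φ (φ α)) = α := by
    rw [hβ, hφ, ← pow_mul, ← pow_succ]
    exact (hpow 3).2 dvd_rfl
  have h1 : α ≠ φ α := fun h => by
    have := (hpow 1).1 (by rw [pow_one]; exact h.symm)
    omega
  have h2 : φ α ≠ φ (φ α) := fun h => h1 (φ.toRingHom.injective h)
  have h3 : φ (φ α) ≠ α := fun h => h1 (hγ.symm.trans (congrArg φ h))
  have h0 : α ≠ 0 := fun h => h1 (by rw [h, map_zero])
  have h0' : ∀ {x}, x ≠ 0 → φ x ≠ 0 := fun h => (map_ne_zero φ).2 h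
  refine ⟨α, φ α, φ (φ α), h1, h2, h3, mul_ne_zero (mul_ne_zero h0 (h0' h0)) (h0' (h0' h0)),
    rfl, rfl, hγ, fun x => ?_⟩
  have hdvd : (({α, φ α, φ (φ α)} : Multiset K).map fun a => X - C a).prod ∣
      P.map (algebraMap F K) := by
    rw [Multiset.prod_X_sub_C_dvd_iff_le_roots (hmon.map _).ne_zero, Multiset.le_iff_subset]
    · intro y hy
      simp only [Multiset.insert_eq_cons, Multiset.mem_cons, Multiset.mem_singleton] at hy
      rw [mem_roots_map hmon.ne_zero, ← aeval_def]
      rcases hy with rfl | rfl | rfl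
      exacts [hα, hroot _ hα, hroot _ (hroot _ hα)]
    · simp [h1, h2, h3.symm]
  have := eq_of_monic_of_dvd_of_natDegree_le (monic_multiset_prod_of_monic _ _
    fun a _ => monic_X_sub_C a) (hmon.map (algebraMap F K)) hdvd (by
      rw [natDegree_map, hdeg, natDegree_multiset_prod_X_sub_C_eq_card]; simp)
  rw [← eval_map_algebraMap, this]
  simp [mul_assoc]

theorem natDegree_Ptilde_le {F : Type*} [Field F] (q : ℕ) (P : F[X]) :
    (Ptilde q P).natDegree ≤ P.natDegree := by
  refine natDegree_sum_le_of_forall_le _ _ fun i hi => ?_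
  exact (natDegree_C_mul_X_pow_le _ _).trans (by simpa [Nat.lt_succ_iff] using hi)

theorem Gpol_eq_zero_of_dvd_Ptilde {F : Type*} [Field F] {q : ℕ} {P : F[X]}
    (h : P ∣ Ptilde q P) : Gpol q P = 0 := by
  obtain ⟨k, hk⟩ : ∃ k : F, Ptilde q P = C k * P := by
    obtain ⟨R, hR⟩ := h
    by_cases h0 : Ptilde q P = 0
    · exact ⟨0, by simp [h0]⟩
    have hP0 : P ≠ 0 := fun e => h0 (by rw [hR, e, zero_mul])
    have hR0 : R ≠ 0 := fun e => h0 (by rw [hR, e, mul_zero])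
    have hle := natDegree_Ptilde_le q P
    rw [hR, natDegree_mul hP0 hR0] at hle
    refine ⟨R.coeff 0, ?_⟩
    rw [hR, mul_comm, ← eq_C_of_natDegree_eq_zero (by omega)]
  simp only [Gpol, hk, Polynomial.eval₂_mul, Polynomial.eval₂_C]
  ring

theorem eval_map_eval₂_X {F K : Type*} [Field F] [Field K] [Algebra F K] (P : F[X]) (i : Fin 2)
    (v : Fin 2 → K) :
    MvPolynomial.eval v (MvPolynomial.map (algebraMap F K)
      (P.eval₂ MvPolynomial.C (MvPolynomial.X i))) = aeval (v i) P := by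
  rw [Polynomial.hom_eval₂, Polynomial.hom_eval₂, aeval_def]
  congr 1
  · ext x
    simp
  · simp

theorem eval_map_Gpol {F K : Type*} [Field F] [Field K] [Algebra F K] (q : ℕ) (P : F[X])
    (v : Fin 2 → K) :
    MvPolynomial.eval v (MvPolynomial.map (algebraMap F K) (Gpol q P)) =
      aeval (v 0) P * aeval (v 1) (Ptilde q P) - aeval (v 0) (Ptilde q P) * aeval (v 1) P := by
  simp only [Gpol, map_sub, map_mul, eval_map_eval₂_X]

theorem degreeOf_eval₂_X_le {F : Type*} [Field F] (P : F[X]) (i j : Fin 2) :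
    (P.eval₂ MvPolynomial.C (MvPolynomial.X j)).degreeOf i ≤
      if i = j then P.natDegree else 0 := by
  rw [Polynomial.eval₂_eq_sum_range]
  refine (MvPolynomial.degreeOf_sum_le _ _ _).trans (Finset.sup_le fun k hk => ?_)
  refine (MvPolynomial.degreeOf_C_mul_le _ _ _).trans ?_
  refine (MvPolynomial.degreeOf_pow_le _ _ _).trans ?_
  rw [MvPolynomial.degreeOf_X]
  split_ifs <;> simp_all

theorem degreeOf_Gpol_le {F : Type*} [Field F] (q : ℕ) (P : F[X]) (i : Fin 2) :
    (Gpol q P).degreeOf i ≤ P.natDegree := by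
  have hP := fun j => degreeOf_eval₂_X_le P i j
  have hQ := fun j => (degreeOf_eval₂_X_le (Ptilde q P) i j)
  have hle := natDegree_Ptilde_le q P
  refine (MvPolynomial.degreeOf_sub_le _ _ _).trans (max_le ?_ ?_) <;>
    refine (MvPolynomial.degreeOf_mul_le _ _ _).trans ?_
  · refine (add_le_add (hP 0) (hQ 1)).trans ?_
    fin_cases i <;> simp [hle]
  · refine (add_le_add (hQ 0) (hP 1)).trans ?_
    fin_cases i <;> simp [hle]

/-- In a factorization of `H_P` into two nonunits over an algebraically closed field, every factor
has degree one in each variable. -/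
theorem degreeOf_le_one_of_mul_eq {K : Type*} [Field K] [IsAlgClosed K] {α β γ : K}
    (h0 : α * β * γ ≠ 0) {t : K → K} (hα : t α ≠ 0) (hβ : t β ≠ 0) (hγ : t γ ≠ 0)
    {A B G : MvPolynomial (Fin 2) K} (hA : ¬ IsUnit A) (hB : ¬ IsUnit B)
    (hAB : (MvPolynomial.X 0 - MvPolynomial.X 1) * (A * B) = G)
    (hG : ∀ v, MvPolynomial.eval v G = (v 0 - α) * (v 0 - β) * (v 0 - γ) * t (v 1) -
      t (v 0) * ((v 1 - α) * (v 1 - β) * (v 1 - γ)))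
    (hdeg : ∀ i, G.degreeOf i ≤ 3) (i : Fin 2) : A.degreeOf i ≤ 1 ∧ B.degreeOf i ≤ 1 := by
  have hroot : ∀ x : K, (x - α) * (x - β) * (x - γ) = 0 → t x ≠ 0 := by
    intro x hx
    rcases mul_eq_zero.1 hx with hx | hx
    · rcases mul_eq_zero.1 hx with hx | hx <;> rwa [sub_eq_zero.1 hx]
    · rwa [sub_eq_zero.1 hx]
  have hkey : ∀ x : K, (x - α) * (x - β) * (x - γ) * t α = 0 →
      (x - α) * (x - β) * (x - γ) * t 0 + t x * (α * β * γ) = 0 → False := by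
    intro x h1 h2
    have h3 := (mul_eq_zero.1 h1).resolve_right hα
    rw [h3, zero_mul, zero_add] at h2
    exact mul_ne_zero (hroot x h3) h0 h2
  have hpos : ∀ D : MvPolynomial (Fin 2) K, ¬ IsUnit D → D ∣ G → ∀ i, D.degreeOf i ≠ 0 := by
    intro D hD hDG i hi
    have hzero : ∀ v, MvPolynomial.eval v D = 0 → MvPolynomial.eval v G = 0 := by
      intro v hv
      obtain ⟨E, rfl⟩ := hDG
      rw [map_mul, hv, zero_mul]
    simp only [hG] at hzero
    fin_cases i
    · obtain ⟨x, hx⟩ := MvPolynomial.exists_eval_eq_zero_of_degreeOf_eq_zero hD zero_ne_one hi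
      have h1 := hzero ![α, x] (hx _ rfl)
      have h2 := hzero ![0, x] (hx _ rfl)
      simp only [Matrix.cons_val_zero, Matrix.cons_val_one] at h1 h2
      exact hkey x (by linear_combination -h1) (by linear_combination -h2)
    · obtain ⟨x, hx⟩ := MvPolynomial.exists_eval_eq_zero_of_degreeOf_eq_zero hD one_ne_zero hi
      have h1 := hzero ![x, α] (hx _ rfl)
      have h2 := hzero ![x, 0] (hx _ rfl)
      simp only [Matrix.cons_val_zero, Matrix.cons_val_one] at h1 h2
      exact hkey x (by linear_combination h1) (by linear_combination h2)
  have hG0 : G ≠ 0 := by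
    rintro rfl
    have h1 := hG ![0, α]
    simp only [Matrix.cons_val_zero, Matrix.cons_val_one, map_zero] at h1
    exact mul_ne_zero h0 hα (by linear_combination h1)
  have hAB0 : A * B ≠ 0 := fun h => hG0 (by rw [← hAB, h, mul_zero])
  have hX0 : (MvPolynomial.X 0 - MvPolynomial.X 1 : MvPolynomial (Fin 2) K) ≠ 0 :=
    fun h => hG0 (by rw [← hAB, h, zero_mul])
  have hXpos : (MvPolynomial.X 0 - MvPolynomial.X 1 : MvPolynomial (Fin 2) K).degreeOf i ≠ 0 := by
    refine hpos _ (fun h => ?_) ⟨_, hAB.symm⟩ i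
    simpa using h.map (MvPolynomial.eval (fun _ => (0 : K)))
  have hApos := hpos A hA ⟨(MvPolynomial.X 0 - MvPolynomial.X 1) * B, by rw [← hAB]; ring⟩ i
  have hBpos := hpos B hB ⟨(MvPolynomial.X 0 - MvPolynomial.X 1) * A, by rw [← hAB]; ring⟩ i
  have h3 := hdeg i
  rw [← hAB, MvPolynomial.degreeOf_mul_eq hX0 hAB0, MvPolynomial.degreeOf_mul_eq
    (left_ne_zero_of_mul hAB0) (right_ne_zero_of_mul hAB0)] at h3
  omega

theorem MvPolynomial.exists_eq_C_mul_of_map_eq {F K σ : Type*} [Field F] [Field K] [Algebra F K]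
    {H L : MvPolynomial σ F} (μ : K)
    (h : MvPolynomial.map (algebraMap F K) H =
      MvPolynomial.C μ * MvPolynomial.map (algebraMap F K) L) :
    ∃ ν : F, H = MvPolynomial.C ν * L := by
  have hinj := MvPolynomial.map_injective (σ := σ) (algebraMap F K) (algebraMap F K).injective
  by_cases hL : L = 0
  · refine ⟨0, hinj ?_⟩
    rw [h, hL]
    simp
  obtain ⟨m, hm⟩ := MvPolynomial.ne_zero_iff.1 hL
  have hc := congrArg (MvPolynomial.coeff m) h
  rw [MvPolynomial.coeff_C_mul, MvPolynomial.coeff_map, MvPolynomial.coeff_map] at hc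
  have hμ : μ = algebraMap F K (H.coeff m / L.coeff m) := by
    rw [map_div₀, eq_div_iff ((_root_.map_ne_zero _).2 hm), hc]
  refine ⟨H.coeff m / L.coeff m, hinj ?_⟩
  rw [h, hμ, map_mul, MvPolynomial.map_C]

/-- The coefficients `c, a, b, d` of the Möbius relation `czw + az + bw + d = 0` cyclically permuting
the roots of an irreducible cubic are rational over the finite base field. -/
theorem exists_algebraMap_eq_cyclic_coeffs {F K : Type*} [Field F] [Fintype F] [Field K]
    [Algebra F K] {α β γ : K} (hα : α ^ Fintype.card F = β) (hβ : β ^ Fintype.card F = γ)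
    (hγ : γ ^ Fintype.card F = α) :
    ∃ c a b d : F,
      algebraMap F K c = -(α ^ 2 + β ^ 2 + γ ^ 2 - α * β - β * γ - γ * α) ∧
      algebraMap F K a = α ^ 2 * β + β ^ 2 * γ + γ ^ 2 * α - 3 * (α * β * γ) ∧
      algebraMap F K b = α ^ 2 * γ + β ^ 2 * α + γ ^ 2 * β - 3 * (α * β * γ) ∧
      algebraMap F K d =
        α * β * γ * (α + β + γ) - α ^ 2 * β ^ 2 - β ^ 2 * γ ^ 2 - γ ^ 2 * α ^ 2 := by
  have key : ∀ x : K, FiniteField.frobeniusAlgHom F K x = x → ∃ y : F, algebraMap F K y = x :=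
    fun x hx => FiniteField.mem_range_algebraMap_of_pow_card_eq hx
  replace hα : FiniteField.frobeniusAlgHom F K α = β := hα
  replace hβ : FiniteField.frobeniusAlgHom F K β = γ := hβ
  replace hγ : FiniteField.frobeniusAlgHom F K γ = α := hγ
  obtain ⟨c, hc⟩ := key (-(α ^ 2 + β ^ 2 + γ ^ 2 - α * β - β * γ - γ * α)) (by
    simp only [map_neg, map_add, map_sub, map_mul, map_pow, hα, hβ, hγ]; ring)
  obtain ⟨a, ha⟩ := key (α ^ 2 * β + β ^ 2 * γ + γ ^ 2 * α - 3 * (α * β * γ)) (by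
    simp only [map_add, map_sub, map_mul, map_pow, map_ofNat, hα, hβ, hγ]; ring)
  obtain ⟨b, hb⟩ := key (α ^ 2 * γ + β ^ 2 * α + γ ^ 2 * β - 3 * (α * β * γ)) (by
    simp only [map_add, map_sub, map_mul, map_pow, map_ofNat, hα, hβ, hγ]; ring)
  obtain ⟨d, hd⟩ := key
    (α * β * γ * (α + β + γ) - α ^ 2 * β ^ 2 - β ^ 2 * γ ^ 2 - γ ^ 2 * α ^ 2) (by
    simp only [map_add, map_sub, map_mul, map_pow, hα, hβ, hγ]; ring)
  exact ⟨c, a, b, d, hc, ha, hb, hd⟩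

/-- Lemma: for a monic irreducible cubic `P`, if `H_P = G_P/(z-w)` is reducible over the
algebraic closure then it is reducible over `𝔽_{q²}`, and in fact
`H_P = μ(czw + az + bw + d)(czw + bz + aw + d)` with `a,b,c,d,μ ∈ 𝔽_{q²}`, `a ≠ b`. -/
theorem statement5 (p n q : ℕ) (hp : p.Prime) (hp3 : 3 < p) (hn : n ≠ 0) (hq : q = p ^ n)
    (F : Type*) [Field F] [Fintype F] (hF : Fintype.card F = q ^ 2)
    (P : Polynomial F) (hmon : P.Monic) (hPirr : Irreducible P) (hPdeg : P.natDegree = 3)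
    (H : MvPolynomial (Fin 2) F)
    (hH : (MvPolynomial.X 0 - MvPolynomial.X 1) * H = Gpol q P)
    (hred : ¬ Irreducible (MvPolynomial.map (algebraMap F (AlgebraicClosure F)) H)) :
    ¬ Irreducible H ∧
      ∃ a b c d μ : F, a ≠ b ∧
        H = MvPolynomial.C μ *
          (MvPolynomial.C c * MvPolynomial.X 0 * MvPolynomial.X 1 +
            MvPolynomial.C a * MvPolynomial.X 0 + MvPolynomial.C b * MvPolynomial.X 1 +
            MvPolynomial.C d) *
          (MvPolynomial.C c * MvPolynomial.X 0 * MvPolynomial.X 1 +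
            MvPolynomial.C b * MvPolynomial.X 0 + MvPolynomial.C a * MvPolynomial.X 1 +
            MvPolynomial.C d) := by
  have hX0 : (MvPolynomial.X 0 - MvPolynomial.X 1 : MvPolynomial (Fin 2) F) ≠ 0 :=
    sub_ne_zero.2 fun h => zero_ne_one (MvPolynomial.X_injective h)
  by_cases hdvd : P ∣ Ptilde q P
  · rw [Gpol_eq_zero_of_dvd_Ptilde hdvd] at hH
    obtain rfl := (mul_eq_zero.1 hH).resolve_left hX0
    exact ⟨not_irreducible_zero, 1, 0, 0, 0, 0, one_ne_zero, by simp⟩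
  obtain ⟨α, β, γ, hαβ, hβγ, hγα, h0, hα, hβ, hγ, hP⟩ :=
    hPirr.exists_frobenius_roots_of_natDegree_eq_three (K := AlgebraicClosure F) hmon hPdeg
  obtain ⟨c, a, b, d, hc, ha, hb, hd⟩ := exists_algebraMap_eq_cyclic_coeffs hα hβ hγ
  have ht : ∀ x : AlgebraicClosure F, (x - α) * (x - β) * (x - γ) = 0 →
      aeval x (Ptilde q P) ≠ 0 := fun x hx h =>
    hdvd ((hPirr.dvd_iff_aeval_eq_zero ((hP x).trans hx)).1 h)
  have htα := ht α (by ring)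
  have htβ := ht β (by ring)
  have htγ := ht γ (by ring)
  have hab : a ≠ b := by
    rintro rfl
    have : (α - β) * (β - γ) * (γ - α) = 0 := by linear_combination ha - hb
    exact mul_ne_zero (mul_ne_zero (sub_ne_zero.2 hαβ) (sub_ne_zero.2 hβγ))
      (sub_ne_zero.2 hγα) this
  have hG := fun v : Fin 2 → AlgebraicClosure F => eval_map_Gpol q P v
  simp only [hP] at hG
  have hH' := congrArg (MvPolynomial.map (algebraMap F (AlgebraicClosure F))) hH
  simp only [map_mul, map_sub, MvPolynomial.map_X] at hH'
  have hHunit : ¬ IsUnit (MvPolynomial.map (algebraMap F (AlgebraicClosure F)) H) := by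
    intro h
    have h1 := (h.map (MvPolynomial.eval ![α, β])).ne_zero
    have h2 := hG ![α, β]
    rw [← hH'] at h2
    simp only [map_mul, map_sub, MvPolynomial.eval_X, Matrix.cons_val_zero,
      Matrix.cons_val_one] at h2
    exact mul_ne_zero (sub_ne_zero.2 hαβ) h1 (by rw [h2]; ring)
  obtain ⟨A, B, hA, hB, hAB⟩ : ∃ A B, ¬ IsUnit A ∧ ¬ IsUnit B ∧
      MvPolynomial.map (algebraMap F (AlgebraicClosure F)) H = A * B := by
    simp only [irreducible_iff, hHunit, not_false_iff, true_and] at hred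
    push Not at hred
    obtain ⟨A, B, h, hA, hB⟩ := hred
    exact ⟨A, B, hA, hB, h⟩
  rw [hAB] at hH'
  have hdeg : ∀ i, (MvPolynomial.map (algebraMap F (AlgebraicClosure F)) (Gpol q P)).degreeOf i
      ≤ 3 := by
    intro i
    rw [← hPdeg]
    refine le_trans ?_ (degreeOf_Gpol_le q P i)
    rw [MvPolynomial.degreeOf_le_iff]
    exact fun m hm => MvPolynomial.monomial_le_degreeOf i (MvPolynomial.support_map_subset _ _ hm)
  have hd1 := degreeOf_le_one_of_mul_eq h0 (t := fun x => aeval x (Ptilde q P)) htα htβ htγ hA hB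
    hH' hG hdeg
  obtain ⟨c₁, a₁, b₁, d₁, rfl⟩ := MvPolynomial.exists_eq_of_degreeOf_le_one (hd1 0).1 (hd1 1).1
  obtain ⟨c₂, a₂, b₂, d₂, rfl⟩ := MvPolynomial.exists_eq_of_degreeOf_le_one (hd1 0).2 (hd1 1).2
  have hfac := bilinear_factors_of_cubic_pencil hαβ hβγ hγα h0
    (t := fun x => aeval x (Ptilde q P)) htα htβ htγ (c := c₁) (a := a₁) (b := b₁) (d := d₁)
    (c' := c₂) (a' := a₂) (b' := b₂) (d' := d₂) (by
      intro x y
      have h1 := hG ![x, y]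
      rw [← hH'] at h1
      simpa using h1)
  obtain ⟨μ, hμ⟩ : ∃ μ : AlgebraicClosure F,
      MvPolynomial.map (algebraMap F (AlgebraicClosure F)) H = MvPolynomial.C μ *
        MvPolynomial.map (algebraMap F (AlgebraicClosure F))
        ((MvPolynomial.C c * MvPolynomial.X 0 * MvPolynomial.X 1 +
            MvPolynomial.C a * MvPolynomial.X 0 + MvPolynomial.C b * MvPolynomial.X 1 +
            MvPolynomial.C d) *
          (MvPolynomial.C c * MvPolynomial.X 0 * MvPolynomial.X 1 +
            MvPolynomial.C b * MvPolynomial.X 0 + MvPolynomial.C a * MvPolynomial.X 1 +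
            MvPolynomial.C d)) := by
    rw [hAB]
    simp only [map_mul, map_add, MvPolynomial.map_X, MvPolynomial.map_C]
    rcases hfac with ⟨⟨h1, h2, h3⟩, h4, h5, h6⟩ | ⟨⟨h1, h2, h3⟩, h4, h5, h6⟩ <;>
    · obtain ⟨k, e1, e2, e3, e4⟩ := bilinear_proportional_of_cyclic_zeros h1 h2 h3 hαβ hβγ hγα
      obtain ⟨l, f1, f2, f3, f4⟩ :=
        bilinear_proportional_of_cyclic_zeros h4 h5 h6 hγα.symm hβγ.symm hαβ.symm
      rw [← hc] at e1
      rw [← ha] at e2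
      rw [← hb] at e3
      rw [← hd] at e4
      replace f1 : _ = l * algebraMap F _ c := f1.trans (by rw [hc]; ring)
      replace f2 : _ = l * algebraMap F _ b := f2.trans (by rw [hb]; ring)
      replace f3 : _ = l * algebraMap F _ a := f3.trans (by rw [ha]; ring)
      replace f4 : _ = l * algebraMap F _ d := f4.trans (by rw [hd]; ring)
      refine ⟨k * l, ?_⟩
      rw [e1, e2, e3, e4, f1, f2, f3, f4]
      simp only [map_mul]
      ring
  obtain ⟨ν, hν⟩ := MvPolynomial.exists_eq_C_mul_of_map_eq μ hμ
  rw [← mul_assoc] at hν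
  refine ⟨fun hirr => ?_, a, b, c, d, ν, hab, hν⟩
  have hnot : ∀ (L : MvPolynomial (Fin 2) F) (x y : AlgebraicClosure F),
      MvPolynomial.aeval ![x, y] L = 0 → ¬ IsUnit L := by
    intro L x y hL hu
    exact (hu.map (MvPolynomial.aeval ![x, y])).ne_zero hL
  rcases hirr.isUnit_or_isUnit hν with hu | hu
  · refine hnot _ α β ?_ (isUnit_of_mul_isUnit_right hu)
    simp [hc, ha, hb, hd]
    ring
  · refine hnot _ β α ?_ hu
    simp [hc, ha, hb, hd]
    ring
end
end

section
/- Let e ∈ F_{q^2} be nonzero and λ ∈ F_q, and set f(x) = ex^2 + λx + e^q. Then f has a root w ∈ F_{q^2} with w^{q+1} = 1 if and only if the discriminant λ^2 − 4e^{q+1} (an element of F_q) is either zero or a nonsquare in F_q. -/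
/-- An element of `𝔽_{q²}` fixed by `x ↦ x^q` is a square in `𝔽_{q²}`, for `q` odd. -/
theorem isSquare_of_pow_eq_self {F : Type*} [Field F] [Fintype F] {q : ℕ} (hq : Odd q)
    (hF : Fintype.card F = q ^ 2) (h2 : ringChar F ≠ 2) {a : F} (ha : a ^ q = a) :
    IsSquare a := by
  rcases eq_or_ne a 0 with rfl | h0
  · exact IsSquare.zero
  obtain ⟨k, rfl⟩ := hq
  have hk : a ^ (2 * k) = 1 := mul_right_cancel₀ h0 (by rw [← pow_succ, ha, one_mul])
  have hc : Fintype.card F / 2 = 2 * k * (k + 1) := by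
    rw [hF, show (2 * k + 1) ^ 2 = 2 * (2 * k * (k + 1)) + 1 by ring]
    omega
  rw [FiniteField.isSquare_iff h2 h0, hc, pow_mul, hk, one_pow]

/-- Lemma: for `0 ≠ e ∈ 𝔽_{q²}` and `λ ∈ 𝔽_q`, the quadratic `f(x) = ex² + λx + e^q` has a
root `w ∈ 𝔽_{q²}` with `w^{q+1} = 1` if and only if its discriminant `λ² − 4e^{q+1}` is
either zero or a nonsquare in `𝔽_q` (the subfield of elements fixed by `x ↦ x^q`). -/
theorem statement6 (p n q : ℕ) (hp : p.Prime) (hp3 : 3 < p) (hn : n ≠ 0) (hq : q = p ^ n)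
    (F : Type*) [Field F] [Fintype F] (hF : Fintype.card F = q ^ 2)
    (e lam : F) (he : e ≠ 0) (hlam : lam ^ q = lam) :
    (∃ w : F, e * w ^ 2 + lam * w + e ^ q = 0 ∧ w ^ (q + 1) = 1) ↔
      (lam ^ 2 - 4 * e ^ (q + 1) = 0 ∨
        ¬ ∃ s : F, s ^ q = s ∧ s ^ 2 = lam ^ 2 - 4 * e ^ (q + 1)) := by
  have : Fact p.Prime := ⟨hp⟩
  have hchar : CharP F p :=
    charP_of_card_eq_prime_pow (f := n * 2) (by simp [hF, hq, pow_mul])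
  have hringChar : ringChar F ≠ 2 := by
    rw [ringChar.eq F p]
    omega
  have h2 : (2 : F) ≠ 0 := Ring.two_ne_zero hringChar
  have hqodd : Odd q := hq ▸ (hp.odd_of_ne_two (by omega)).pow
  have hadd (x y : F) : (x + y) ^ q = x ^ q + y ^ q := by
    rw [hq]
    exact add_pow_char_pow x y p n
  have hsub (x y : F) : (x - y) ^ q = x ^ q - y ^ q := by
    rw [hq]
    exact sub_pow_char_pow x y n
  have htwo : (2 : F) ^ q = 2 := by
    rw [← one_add_one_eq_two, hadd, one_pow]
  have hee : (e ^ q) ^ q = e := by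
    rw [← pow_mul, ← sq, ← hF, FiniteField.pow_card]
  constructor
  · rintro ⟨w, hw, hw1⟩
    rw [or_iff_not_imp_right, not_not]
    rintro ⟨t, ht, hts⟩
    have hw0 : w ≠ 0 := by
      rintro rfl
      simp at hw1
    have hroot : t ^ 2 = (2 * e * w + lam) ^ 2 := by
      rw [hts, pow_succ]
      linear_combination (-4 * e) * hw
    have hconj : (2 * e * w + lam) ^ q = -(2 * e * w + lam) := by
      rw [hadd, mul_pow, mul_pow, htwo, hlam]
      apply mul_right_cancel₀ hw0
      rw [pow_succ] at hw1
      linear_combination 2 * e ^ q * hw1 + 2 * hw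
    have hneg : t ^ q = -t := by
      rcases sq_eq_sq_iff_eq_or_eq_neg.mp hroot with h | h
      · rw [h, hconj]
      · rw [h, hqodd.neg_pow, hconj]
    have ht0 : t = 0 := by
      have : 2 * t = 0 := by linear_combination hneg - ht
      simpa [h2] using this
    rw [← hts, ht0, zero_pow two_ne_zero]
  · intro h
    have hfix : (lam ^ 2 - 4 * e ^ (q + 1)) ^ q = lam ^ 2 - 4 * e ^ (q + 1) := by
      rw [hsub, mul_pow, pow_right_comm, hlam, show (4 : F) = 2 ^ 2 by norm_num,
        pow_right_comm, htwo, pow_succ e q, mul_pow, hee, mul_comm e]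
    obtain ⟨s, hs⟩ := isSquare_of_pow_eq_self hqodd hF hringChar hfix
    rw [← sq] at hs
    have hconj : s ^ q = -s := by
      rcases h with h | h
      · have hs0 : s = 0 := by simpa [h] using hs.symm
        rw [hs0, neg_zero, zero_pow hqodd.pos.ne']
      · have hsq : (s ^ q) ^ 2 = s ^ 2 := by
          rw [pow_right_comm, ← hs, hfix]
        exact (sq_eq_sq_iff_eq_or_eq_neg.mp hsq).resolve_left fun h' => h ⟨s, h', hs.symm⟩
    have heq : e ^ q ≠ 0 := pow_ne_zero q he
    rw [pow_succ] at hs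
    refine ⟨(s - lam) / (2 * e), ?_, ?_⟩
    · field_simp
      linear_combination -hs
    · rw [pow_succ, div_pow, hsub, mul_pow, htwo, hconj, hlam]
      field_simp
      linear_combination hs
end

section
/- Let P(x) be a cubic polynomial in F_{q^2}[x] and suppose H_P(z,w) = (czw + az + bw + d)(czw + bz + aw + d) for some a, b, c, d ∈ F_{q^2} with a ≠ b. If ab = cd, then P(x) is reducible over F_{q^2}. -/
noncomputable section

open Polynomial

/-- If `ab = cd` and `a ≠ b`, one of the two bilinear factors vanishes identically on a line
`z = z₀`. -/
lemma exists_vanishing_line {F : Type*} [Field F] {a b c d : F} (hab : a ≠ b)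
    (habcd : a * b = c * d) :
    ∃ z : F, (c * z + b = 0 ∧ a * z + d = 0) ∨ (c * z + a = 0 ∧ b * z + d = 0) := by
  by_cases hc : c = 0
  · subst hc
    rcases mul_eq_zero.mp (habcd.trans (zero_mul d)) with rfl | rfl
    · refine ⟨-d / b, Or.inr ⟨by ring, ?_⟩⟩
      have hb : b ≠ 0 := hab.symm
      field_simp
      ring
    · refine ⟨-d / a, Or.inl ⟨by ring, ?_⟩⟩
      field_simp
      ring
  · refine ⟨-b / c, Or.inl ⟨?_, ?_⟩⟩
    · field_simp
      ring
    · field_simp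
      linear_combination -habcd

/-- The bilinear form `czw + az + bw + d` is nonzero when `a ≠ b`. -/
lemma bilinear_ne_zero {F : Type*} [Field F] {a b c d : F} (hab : a ≠ b) :
    (MvPolynomial.C c * MvPolynomial.X 0 * MvPolynomial.X 1 +
        MvPolynomial.C a * MvPolynomial.X 0 + MvPolynomial.C b * MvPolynomial.X 1 +
        MvPolynomial.C d : MvPolynomial (Fin 2) F) ≠ 0 := by
  intro h
  have h10 := congrArg (MvPolynomial.eval ![(1 : F), 0]) h
  have h01 := congrArg (MvPolynomial.eval ![(0 : F), 1]) h
  simp at h10 h01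
  exact hab (by linear_combination h10 - h01)

/-- If `G_P` vanishes on the line `z = z₀` and `P(z₀) ≠ 0`, then `G_P = 0`. -/
lemma Gpol_eq_zero_of_vanishing_line {F : Type*} [Field F] {q : ℕ} {P : Polynomial F} {z : F}
    (hz : P.eval z ≠ 0) (hG : MvPolynomial.aeval ![(C z : F[X]), X] (Gpol q P) = 0) :
    Gpol q P = 0 := by
  have hline (Q : F[X]) (i : Fin 2) : MvPolynomial.aeval ![(C z : F[X]), X]
      (Polynomial.eval₂ MvPolynomial.C (MvPolynomial.X i) Q) =
        Q.eval₂ C (![(C z : F[X]), X] i) := by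
    rw [← AlgHom.coe_toRingHom, Polynomial.hom_eval₂]
    congr 1
    · ext x
      simp [Polynomial.algebraMap_eq]
    · simp
  have hcoll : Ptilde q P = C ((Ptilde q P).eval z / P.eval z) * P := by
    simp only [Gpol, map_sub, map_mul, hline, Matrix.cons_val_zero, Matrix.cons_val_one,
      Polynomial.eval₂_C_X, Polynomial.eval₂_at_apply] at hG
    have hC : (C (P.eval z) : F[X]) ≠ 0 := C_ne_zero.mpr hz
    apply mul_left_cancel₀ hC
    rw [← mul_assoc, ← C_mul, mul_div_cancel₀ _ hz]
    exact sub_eq_zero.mp hG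
  rw [Gpol, hcoll]
  simp only [Polynomial.eval₂_mul, Polynomial.eval₂_C]
  ring

/-- Lemma: let `P` be a cubic with `H_P = (czw + az + bw + d)(czw + bz + aw + d)`, `a ≠ b`.
If `ab = cd` then `P` is reducible over `𝔽_{q²}`. -/
theorem statement7 (p n q : ℕ) (hp : p.Prime) (hp3 : 3 < p) (hn : n ≠ 0) (hq : q = p ^ n)
    (F : Type*) [Field F] [Fintype F] (hF : Fintype.card F = q ^ 2)
    (P : Polynomial F) (hPdeg : P.natDegree = 3)
    (a b c d : F) (hab : a ≠ b)
    (H : MvPolynomial (Fin 2) F)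
    (hH : (MvPolynomial.X 0 - MvPolynomial.X 1) * H = Gpol q P)
    (hfac : H =
      (MvPolynomial.C c * MvPolynomial.X 0 * MvPolynomial.X 1 +
        MvPolynomial.C a * MvPolynomial.X 0 + MvPolynomial.C b * MvPolynomial.X 1 +
        MvPolynomial.C d) *
      (MvPolynomial.C c * MvPolynomial.X 0 * MvPolynomial.X 1 +
        MvPolynomial.C b * MvPolynomial.X 0 + MvPolynomial.C a * MvPolynomial.X 1 +
        MvPolynomial.C d))
    (habcd : a * b = c * d) :
    ¬ Irreducible P := by
  intro hirr
  obtain ⟨z, hz⟩ := exists_vanishing_line hab habcd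
  have hPz : P.eval z ≠ 0 := fun h => by
    have : P.natDegree = 1 := Polynomial.natDegree_eq_of_degree_eq_some
      (Polynomial.degree_eq_one_of_irreducible_of_root hirr h)
    omega
  have hG : Gpol q P = 0 := by
    apply Gpol_eq_zero_of_vanishing_line hPz
    rw [← hH, hfac]
    simp only [map_mul, map_add, MvPolynomial.aeval_X, MvPolynomial.algHom_C,
      Polynomial.algebraMap_eq, Matrix.cons_val_zero, Matrix.cons_val_one]
    have hfactor {s t : F} (h₁ : c * z + t = 0) (h₂ : s * z + d = 0) :
        (C c * C z * X + C s * C z + C t * X + C d : F[X]) = 0 := by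
      have h₁' := congrArg (C : F → F[X]) h₁
      have h₂' := congrArg (C : F → F[X]) h₂
      simp only [map_add, map_mul, map_zero] at h₁' h₂'
      linear_combination X * h₁' + h₂'
    rcases hz with ⟨h₁, h₂⟩ | ⟨h₁, h₂⟩ <;> simp [hfactor h₁ h₂]
  have hX : (MvPolynomial.X 0 - MvPolynomial.X 1 : MvPolynomial (Fin 2) F) ≠ 0 :=
    sub_ne_zero.mpr (MvPolynomial.X_injective.ne (by decide))
  rw [hG, hfac] at hH
  exact mul_ne_zero hX (mul_ne_zero (bilinear_ne_zero hab) (bilinear_ne_zero hab.symm)) hH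
end
end

section
/- Let a, b, c, d ∈ F_{q^2} with ab ≠ cd, set H_Ψ(z,w) = czw + az + bw + d, and let Δ = (a^{q+1} − b^{q+1} + c^{q+1} − d^{q+1})^2 − 4(bd^q − a^q c)^{q+1}, an element of F_q. Then there exist z, w ∈ F_{q^2} with H_Ψ(z,w) = 0, z ≠ w and z^{q+1} = w^{q+1} = 1 if and only if Δ is zero or a nonsquare in F_q, and the quadratic (bd^q − a^q c)x^2 + (d^{q+1} + b^{q+1} − c^{q+1} − a^{q+1})x + (b^q d − ac^q) possesses a root in F_{q^2} which is not a root of cx^2 + (a+b)x + d. -/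
/-- The `q`-power map on a field with `q ^ 2` elements, as an involutive ring endomorphism. -/
theorem exists_involutive_frobenius {p n q : ℕ} (hp : p.Prime) (hn : n ≠ 0) (hq : q = p ^ n)
    (F : Type*) [Field F] [Fintype F] (hF : Fintype.card F = q ^ 2) :
    CharP F p ∧ ∃ σ : F →+* F, (∀ x, σ x = x ^ q) ∧ ∀ x, σ (σ x) = x := by
  have : Fact p.Prime := ⟨hp⟩
  have hchar : CharP F p := by
    obtain ⟨r, hr⟩ := CharP.exists F
    obtain ⟨k, hrp, hk⟩ := FiniteField.card F r
    have hdvd : p ∣ r ^ (k : ℕ) := by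
      rw [← hk, hF, hq, ← pow_mul]
      exact dvd_pow_self p (by positivity)
    have hpr : p = r := (Nat.prime_dvd_prime_iff_eq hp hrp).1 (hp.dvd_of_dvd_pow hdvd)
    exact hpr ▸ hr
  have hσ : ∀ x : F, iterateFrobenius F p n x = x ^ q := fun x => by
    rw [iterateFrobenius_def, hq]
  refine ⟨hchar, iterateFrobenius F p n, hσ, fun x => ?_⟩
  rw [hσ, hσ, ← pow_mul, ← sq, ← hF, FiniteField.pow_card]

/-- A field with `q ^ 2` elements, `q > 1`, has an element `v ≠ ±1` with `v ^ (q + 1) = 1`. -/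
theorem exists_pow_succ_eq_one_sq_ne_one {q : ℕ} (hq : 1 < q) (F : Type*) [Field F] [Fintype F]
    (hF : Fintype.card F = q ^ 2) : ∃ v : F, v ^ (q + 1) = 1 ∧ v ^ 2 ≠ 1 := by
  obtain ⟨m, rfl⟩ : ∃ m, q = m + 1 := ⟨q - 1, by omega⟩
  have hm : 0 < m := by omega
  have hcard : Fintype.card F - 1 = m * (m + 2) := by
    rw [hF]; exact Nat.sub_eq_of_eq_add (by ring)
  have hnot : ¬ ∀ x : Fˣ, x ^ (m * 2) = 1 := by
    rw [FiniteField.forall_pow_eq_one_iff, hcard]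
    intro h
    have := Nat.le_of_dvd two_pos (Nat.dvd_of_mul_dvd_mul_left hm h)
    omega
  push Not at hnot
  obtain ⟨u, hu⟩ := hnot
  refine ⟨(u : F) ^ m, ?_, fun h => hu ?_⟩
  · rw [← pow_mul, ← hcard, FiniteField.pow_card_sub_one_eq_one _ u.ne_zero]
  · ext; push_cast; rw [pow_mul, h]

section Involution

variable {F : Type*} [Field F] {σ : F →+* F}

/-- If `w` has norm one and is a root of `A x² + B x + σ A` with `B` fixed by `σ`, then the
discriminant is zero or not the square of a fixed element. -/
theorem discrim_eq_zero_of_norm_one_root (h2 : (2 : F) ≠ 0) {A B w t : F}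
    (hB : σ B = B) (hw : w * σ w = 1) (hroot : A * w ^ 2 + B * w + σ A = 0)
    (ht : σ t = t) (htd : t ^ 2 = B ^ 2 - 4 * (A * σ A)) :
    B ^ 2 - 4 * (A * σ A) = 0 := by
  have hlin : A * w + B + σ A * σ w = 0 := by
    linear_combination σ w * hroot - (A * w + B) * hw
  have hs : σ (2 * A * w + B) = -(2 * A * w + B) := by
    simp only [map_add, map_mul, map_ofNat, hB]
    linear_combination 2 * hlin
  have hsd : (2 * A * w + B) ^ 2 = t ^ 2 := by
    rw [htd]; linear_combination 4 * A * hroot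
  have htt : σ t = -t := by
    rcases sq_eq_sq_iff_eq_or_eq_neg.1 hsd with h | h
    · rw [← h, hs]
    · rw [h, map_neg] at hs
      linear_combination -hs
  have h0 : 2 * t = 0 := by linear_combination htt - ht
  have h0' : t = 0 := (mul_eq_zero.1 h0).resolve_left h2
  rw [← htd, h0']; ring

/-- If the discriminant of `A x² + B x + σ A`, with `A ≠ 0` and `B` fixed by `σ`, is zero or
not the square of a fixed element, then every root has norm one. -/
theorem norm_one_of_root (h2 : (2 : F) ≠ 0) {A B x : F} (hA : A ≠ 0) (hσ : σ (σ A) = A)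
    (hB : σ B = B) (hroot : A * x ^ 2 + B * x + σ A = 0)
    (hd : B ^ 2 - 4 * (A * σ A) = 0 ∨ ¬ ∃ s : F, σ s = s ∧ s ^ 2 = B ^ 2 - 4 * (A * σ A)) :
    x * σ x = 1 := by
  have hsd : (2 * A * x + B) ^ 2 = B ^ 2 - 4 * (A * σ A) := by
    linear_combination 4 * A * hroot
  have hs : σ (2 * A * x + B) = -(2 * A * x + B) := by
    have hsq : (σ (2 * A * x + B)) ^ 2 = (2 * A * x + B) ^ 2 := by
      rw [← map_pow, hsd]
      simp only [map_sub, map_mul, map_pow, map_ofNat, hB, hσ]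
      ring
    rcases sq_eq_sq_iff_eq_or_eq_neg.1 hsq with h | h
    · rcases hd with hd | hd
      · rw [hd] at hsd
        simp [pow_eq_zero_iff two_ne_zero |>.1 hsd]
      · exact absurd ⟨_, h, hsd⟩ hd
    · exact h
  simp only [map_add, map_mul, map_ofNat, hB] at hs
  have hlin : A * x + B + σ A * σ x = 0 :=
    (mul_eq_zero.1 (by linear_combination hs :
      2 * (A * x + B + σ A * σ x) = 0)).resolve_left h2
  have hA' : σ A ≠ 0 := (map_ne_zero σ).2 hA
  apply mul_left_cancel₀ hA'
  linear_combination x * hlin - hroot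

/-- A norm-one root `w` of the quadratic expressing that `-(b w + d) / (c w + a)` has norm one
yields a point `(z, w)` of the curve, off the diagonal. -/
theorem exists_norm_one_partner {a b c d w : F} (habcd : a * b ≠ c * d) (hw : w * σ w = 1)
    (hroot : (b * σ d - σ a * c) * w ^ 2 + (d * σ d + b * σ b - c * σ c - a * σ a) * w +
      (σ b * d - a * σ c) = 0)
    (hne : c * w ^ 2 + (a + b) * w + d ≠ 0) :
    ∃ z : F, c * z * w + a * z + b * w + d = 0 ∧ z ≠ w ∧ z * σ z = 1 := by
  have hnorm : (b * w + d) * σ (b * w + d) = (c * w + a) * σ (c * w + a) := by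
    simp only [map_add, map_mul]
    linear_combination σ w * hroot +
      (a * σ a - d * σ d - (b * σ d - σ a * c) * w) * hw
  have hcw : c * w + a ≠ 0 := by
    intro h
    rw [h, zero_mul, mul_eq_zero, map_eq_zero, or_self] at hnorm
    apply habcd
    linear_combination b * h - c * hnorm
  have hcw' : σ (c * w + a) ≠ 0 := (map_ne_zero σ).2 hcw
  refine ⟨-(b * w + d) / (c * w + a), ?_, fun h => hne ?_, ?_⟩
  · field_simp; ring
  · rw [div_eq_iff hcw] at h
    linear_combination -h
  · rw [map_div₀, map_neg, div_mul_div_comm, neg_mul_neg, hnorm, div_self (mul_ne_zero hcw hcw')]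

/-- A polynomial of degree at most two vanishing at `1`, `-1` and `v ≠ ±1` is zero. -/
theorem quadratic_coeffs_eq_zero (h2 : (2 : F) ≠ 0) {c e d v : F} (hv : v ^ 2 ≠ 1)
    (h : c * 1 ^ 2 + e * 1 + d = 0) (h' : c * (-1) ^ 2 + e * (-1) + d = 0)
    (hvr : c * v ^ 2 + e * v + d = 0) : c = 0 ∧ e = 0 ∧ d = 0 := by
  have he : e = 0 := (mul_eq_zero.1 (by linear_combination h - h' : 2 * e = 0)).resolve_left h2
  subst he
  have hc : c = 0 := (mul_eq_zero.1 (by linear_combination hvr - h :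
    c * (v ^ 2 - 1) = 0)).resolve_right (sub_ne_zero.2 hv)
  subst hc
  exact ⟨rfl, rfl, by linear_combination h⟩

end Involution

/-- Theorem: for `a,b,c,d ∈ 𝔽_{q²}` with `ab ≠ cd` and `H_Ψ(z,w) = czw + az + bw + d`,
there exist `z ≠ w` with `H_Ψ(z,w) = 0` and `z^{q+1} = w^{q+1} = 1` if and only if
`Δ = (a^{q+1} − b^{q+1} + c^{q+1} − d^{q+1})² − 4(bd^q − a^q c)^{q+1}` is zero or a
nonsquare in `𝔽_q`, and the quadratic
`(bd^q − a^q c)x² + (d^{q+1} + b^{q+1} − c^{q+1} − a^{q+1})x + (b^q d − ac^q)` has a root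
which is not a root of `cx² + (a+b)x + d`. -/
theorem statement8 (p n q : ℕ) (hp : p.Prime) (hp3 : 3 < p) (hn : n ≠ 0) (hq : q = p ^ n)
    (F : Type*) [Field F] [Fintype F] (hF : Fintype.card F = q ^ 2)
    (a b c d : F) (habcd : a * b ≠ c * d) :
    (∃ z w : F, c * z * w + a * z + b * w + d = 0 ∧ z ≠ w ∧
        z ^ (q + 1) = 1 ∧ w ^ (q + 1) = 1) ↔
      (((a ^ (q + 1) - b ^ (q + 1) + c ^ (q + 1) - d ^ (q + 1)) ^ 2 -
            4 * (b * d ^ q - a ^ q * c) ^ (q + 1) = 0 ∨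
          ¬ ∃ s : F, s ^ q = s ∧ s ^ 2 =
            (a ^ (q + 1) - b ^ (q + 1) + c ^ (q + 1) - d ^ (q + 1)) ^ 2 -
              4 * (b * d ^ q - a ^ q * c) ^ (q + 1)) ∧
        ∃ x : F,
          (b * d ^ q - a ^ q * c) * x ^ 2 +
              (d ^ (q + 1) + b ^ (q + 1) - c ^ (q + 1) - a ^ (q + 1)) * x +
              (b ^ q * d - a * c ^ q) = 0 ∧
            c * x ^ 2 + (a + b) * x + d ≠ 0) := by
  have hq1 : 1 < q := hq ▸ Nat.one_lt_pow hn hp.one_lt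
  obtain ⟨hchar, σ, hσ, hσσ⟩ := exists_involutive_frobenius hp hn hq F hF
  have h2 : (2 : F) ≠ 0 := by
    intro h
    have hdvd : p ∣ 2 := (CharP.cast_eq_zero_iff F p 2).1 (by exact_mod_cast h)
    have := Nat.le_of_dvd two_pos hdvd
    omega
  have hnorm : ∀ x : F, x ^ (q + 1) = x * σ x := fun x => by rw [hσ, pow_succ']
  obtain ⟨v, hv, hv2⟩ := exists_pow_succ_eq_one_sq_ne_one hq1 F hF
  simp only [hnorm, ← hσ] at hv ⊢
  set A := b * σ d - σ a * c with hA
  set B := d * σ d + b * σ b - c * σ c - a * σ a with hB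
  have hσA : σ A = σ b * d - a * σ c := by simp [hA, hσσ]
  have hσB : σ B = B := by simp only [hB, map_sub, map_add, map_mul, hσσ]; ring
  have hΔ : (a * σ a - b * σ b + c * σ c - d * σ d) ^ 2 = B ^ 2 := by rw [hB]; ring
  rw [hΔ, ← hσA]
  constructor
  · rintro ⟨z, w, hH, hne, hz, hw⟩
    have hroot : A * w ^ 2 + B * w + σ A = 0 := by
      have h1 : z * (c * w + a) = -(b * w + d) := by linear_combination hH
      have h3 := congrArg σ h1
      simp only [map_add, map_mul, map_neg] at h3
      rw [hσA, hA, hB]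
      linear_combination -w * (z * (c * w + a)) * h3 + w * (σ b * σ w + σ d) * h1 +
        w * (c * w + a) * (σ c * σ w + σ a) * hz +
        (c * w * σ c + a * σ c - b * w * σ b - d * σ b) * hw
    refine ⟨or_iff_not_imp_right.2 fun h => ?_, w, hroot, fun h => ?_⟩
    · obtain ⟨t, ht, htd⟩ := not_not.1 h
      exact discrim_eq_zero_of_norm_one_root h2 hσB hw hroot ht htd
    · have h1 : (z - w) * (c * w + a) = 0 := by linear_combination hH - h
      have h3 : c * w + a = 0 := (mul_eq_zero.1 h1).resolve_left (sub_ne_zero.2 hne)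
      apply habcd
      linear_combination (b + c * z) * h3 - c * hH
  · rintro ⟨hd, x, hroot, hx⟩
    suffices ∃ w : F, w * σ w = 1 ∧ A * w ^ 2 + B * w + σ A = 0 ∧
        c * w ^ 2 + (a + b) * w + d ≠ 0 by
      obtain ⟨w, hw, hwr, hwx⟩ := this
      rw [hσA] at hwr
      obtain ⟨z, hH, hne, hz⟩ := exists_norm_one_partner habcd hw hwr hwx
      exact ⟨z, w, hH, hne, hz, hw⟩
    by_cases hA0 : A = 0
    · have hB0 : B = 0 := by
        simp only [hA0, zero_mul, mul_zero, sub_zero] at hd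
        rcases hd with hd | hd
        · exact (pow_eq_zero_iff two_ne_zero).1 hd
        · exact absurd ⟨B, hσB, rfl⟩ hd
      simp only [hA0, hB0, map_zero, zero_mul, add_zero, true_and]
      by_contra! hall
      obtain ⟨hc, he, hd0⟩ := quadratic_coeffs_eq_zero h2 hv2 (hall 1 (by simp))
        (hall (-1) (by simp)) (hall v hv)
      exact hx (by rw [hc, he, hd0]; ring)
    · exact ⟨x, norm_one_of_root h2 hA0 (hσσ A) hσB hroot hd, hroot, hx⟩
end

section
/- Let m > 2 be an integer, θ ∈ F_{q^2}, and P(x) = x^m − θ ∈ F_{q^2}[x]. Then H_P(z,w) is not identically zero and reducible over the algebraic closure of F_q if and only if θ^{q+1} ≠ 1. Furthermore, if θ^{q+1} ≠ 1, then P satisfies Condition (1) if and only if gcd(m, q+1) = 1. -/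
noncomputable section

open Polynomial

theorem Ptilde_X_pow_sub_C {F : Type*} [Field F] {q m : ℕ} (hq : Odd q) (hm : 0 < m) (θ : F) :
    Ptilde q (X ^ m - C θ) = 1 - C (θ ^ q) * X ^ m := by
  obtain ⟨k, rfl⟩ : ∃ k, m = k + 1 := ⟨m - 1, by omega⟩
  have hmid : ∑ i ∈ Finset.range k,
      C (((X ^ (k + 1) - C θ).coeff (k + 1 - (i + 1))) ^ q) * (X : Polynomial F) ^ (i + 1) = 0 := by
    refine Finset.sum_eq_zero fun i hi => ?_
    have hik := Finset.mem_range.mp hi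
    have hcoeff : (X ^ (k + 1) - C θ : Polynomial F).coeff (k + 1 - (i + 1)) = 0 := by
      rw [coeff_sub, coeff_X_pow, coeff_C, if_neg (by omega), if_neg (by omega), sub_zero]
    rw [hcoeff, zero_pow hq.pos.ne', C_0, zero_mul]
  rw [Ptilde, natDegree_X_pow_sub_C, Finset.sum_range_succ, Finset.sum_range_succ', hmid]
  simp [coeff_X_pow, coeff_C, hq.neg_pow]
  ring

theorem Gpol_X_pow_sub_C {F : Type*} [Field F] {q m : ℕ} (hq : Odd q) (hm : 0 < m) (θ : F) :
    Gpol q (X ^ m - C θ) =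
      MvPolynomial.C (1 - θ ^ (q + 1)) * (MvPolynomial.X 0 ^ m - MvPolynomial.X 1 ^ m) := by
  rw [Gpol, Ptilde_X_pow_sub_C hq hm]
  simp only [eval₂_sub, eval₂_mul, eval₂_pow, eval₂_X, eval₂_C, eval₂_one, map_sub, map_one,
    map_pow]
  ring

theorem MvPolynomial.X_zero_sub_X_one_ne_zero (F : Type*) [Field F] :
    (MvPolynomial.X 0 - MvPolynomial.X 1 : MvPolynomial (Fin 2) F) ≠ 0 :=
  sub_ne_zero.mpr fun h => by simpa using MvPolynomial.X_injective h

/-- A nonzero multiple of `(z ^ m - w ^ m) / (z - w)` splits off a linear factor over an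
algebraically closed field. -/
theorem not_irreducible_C_mul_geom_sum {K : Type*} [Field K] [IsAlgClosed K] {m : ℕ} (hm : 2 < m)
    {c : K} (hc : c ≠ 0) :
    ¬ Irreducible (MvPolynomial.C c * ∑ i ∈ Finset.range m,
      (MvPolynomial.X 0 : MvPolynomial (Fin 2) K) ^ i * MvPolynomial.X 1 ^ (m - 1 - i)) := by
  intro hirr
  obtain ⟨a, ha⟩ : ∃ a : K, ∑ i ∈ Finset.range m, a ^ i = 0 := by
    have hdeg : (∑ i ∈ Finset.range m, (X : Polynomial K) ^ i).degree ≠ 0 := by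
      intro h
      have hcoeff := coeff_eq_zero_of_degree_lt
        (show (∑ i ∈ Finset.range m, (X : Polynomial K) ^ i).degree < ((1 : ℕ) : WithBot ℕ) by
          rw [h]; norm_num)
      simp only [finsetSum_coeff, coeff_X_pow, Finset.sum_ite_eq, Finset.mem_range] at hcoeff
      rw [if_pos (by omega)] at hcoeff
      exact one_ne_zero hcoeff
    obtain ⟨a, ha⟩ := IsAlgClosed.exists_root _ hdeg
    exact ⟨a, by simpa [eval_finsetSum] using ha⟩
  have hdvd : (MvPolynomial.X 0 - MvPolynomial.C a * MvPolynomial.X 1 : MvPolynomial (Fin 2) K) ∣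
      ∑ i ∈ Finset.range m, MvPolynomial.X 0 ^ i * MvPolynomial.X 1 ^ (m - 1 - i) := by
    have hzero : ∑ i ∈ Finset.range m, (MvPolynomial.C a * MvPolynomial.X 1) ^ i *
        (MvPolynomial.X 1 : MvPolynomial (Fin 2) K) ^ (m - 1 - i) = 0 := by
      calc _ = ∑ i ∈ Finset.range m, MvPolynomial.C (a ^ i) *
            (MvPolynomial.X 1 : MvPolynomial (Fin 2) K) ^ (m - 1) := by
            refine Finset.sum_congr rfl fun i hi => ?_
            have := Finset.mem_range.mp hi
            rw [mul_pow, mul_assoc, ← pow_add, map_pow]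
            congr 2
            omega
        _ = 0 := by rw [← Finset.sum_mul, ← map_sum, ha, map_zero, zero_mul]
    rw [← sub_zero (∑ i ∈ Finset.range m, _), ← hzero, ← Finset.sum_sub_distrib]
    refine Finset.dvd_sum fun i _ => ?_
    rw [← sub_mul]
    exact (sub_dvd_pow_sub_pow _ _ i).mul_right _
  obtain ⟨Q, hQ⟩ := hdvd.mul_left (MvPolynomial.C c)
  rcases hirr.isUnit_or_isUnit hQ with hu | hu
  · simpa using hu.map (MvPolynomial.eval (0 : Fin 2 → K))
  · obtain ⟨b, -, hb⟩ := MvPolynomial.isUnit_iff_eq_C_of_isReduced.mp hu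
    have hspec := congrArg (MvPolynomial.aeval ![(X : Polynomial K), 0]) hQ
    have hsum : ∑ i ∈ Finset.range m, (X : Polynomial K) ^ i * 0 ^ (m - 1 - i) = X ^ (m - 1) := by
      rw [Finset.sum_eq_single (m - 1)]
      · simp
      · intro i hi hne
        have := Finset.mem_range.mp hi
        rw [zero_pow (by omega), mul_zero]
      · intro h
        exact absurd (Finset.mem_range.mpr (by omega)) h
    simp only [hb, map_mul, map_sum, map_sub, map_pow, MvPolynomial.aeval_X,
      MvPolynomial.algHom_C, Matrix.cons_val_zero, Matrix.cons_val_one, mul_zero, sub_zero,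
      hsum, Polynomial.algebraMap_eq] at hspec
    have hcoeff := congrArg (fun p => coeff p (m - 1)) hspec
    simp only [coeff_C_mul, mul_comm X, coeff_X, coeff_X_pow, if_true] at hcoeff
    rw [if_neg (by omega), mul_one, mul_zero] at hcoeff
    exact hc hcoeff

theorem condition1_X_pow_sub_C_iff {F : Type*} [Field F] [Fintype F] {p n q m : ℕ} [CharP F p]
    (hp : p.Prime) (hq : q = p ^ n) (hF : Fintype.card F = q ^ 2)
    {θ : F} (hθ : θ ^ (q + 1) ≠ 1) :
    Condition1 q m (X ^ m - C θ) ↔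
      ∀ x y : F, x ≠ 0 → y ≠ 0 → (x * y ^ q) ^ m = (x ^ q * y) ^ m → x * y ^ q = x ^ q * y := by
  have hq0 : 0 < q := hq ▸ pow_pos hp.pos n
  have : ExpChar F p := ExpChar.prime hp
  have hfrob : ∀ x : F, (x ^ q) ^ q = x := fun x => by
    rw [← pow_mul, ← sq, ← hF, FiniteField.pow_card]
  have hsub : ∀ x y : F, (x - y) ^ q = x ^ q - y ^ q := fun x y => by
    rw [hq, sub_pow_expChar_pow]
  have hval : ∀ x : F, x ^ m * (X ^ m - C θ).eval (x ^ (q - 1)) = (x ^ q) ^ m - θ * x ^ m := by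
    intro x
    have hx : x ^ q = x * x ^ (q - 1) := by rw [← pow_succ', Nat.sub_add_cancel hq0]
    rw [hx]
    simp only [eval_sub, eval_pow, eval_X, eval_C]
    ring
  have hvalq : ∀ x : F, ((x ^ q) ^ m - θ * x ^ m) ^ q = x ^ m - θ ^ q * (x ^ q) ^ m := by
    intro x
    rw [hsub, mul_pow, pow_right_comm (x ^ q) m q, hfrob, pow_right_comm x m q]
  refine forall₄_congr fun x y _ _ => ?_
  rw [hval, hval, hvalq, hvalq]
  refine imp_congr_left ⟨fun h => ?_, fun h => ?_⟩
  · have hne : 1 - θ ^ (q + 1) ≠ 0 := sub_ne_zero.mpr hθ.symm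
    refine mul_left_cancel₀ hne ?_
    rw [mul_pow, mul_pow]
    linear_combination -h
  · rw [mul_pow, mul_pow] at h
    linear_combination -(1 - θ ^ (q + 1)) * h

/-- In a field with `q ^ 2` elements, the `m`-th power map is injective on the quotients
`x ^ (q - 1)` exactly when `m` is prime to `q + 1`. -/
theorem pow_injective_on_quotients_iff {F : Type*} [Field F] [Fintype F] {q m : ℕ} (hq : 1 < q)
    (hF : Fintype.card F = q ^ 2) :
    (∀ x y : F, x ≠ 0 → y ≠ 0 → (x * y ^ q) ^ m = (x ^ q * y) ^ m → x * y ^ q = x ^ q * y) ↔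
      Nat.gcd m (q + 1) = 1 := by
  have hfact : (q - 1) * (q + 1) = q ^ 2 - 1 := by
    rw [mul_comm, ← Nat.sq_sub_sq, one_pow]
  constructor
  · intro h
    obtain ⟨g, hg⟩ := IsCyclic.exists_generator (α := Fˣ)
    have hord : orderOf g = (q - 1) * (q + 1) := by
      rw [orderOf_eq_card_of_forall_mem_zpowers hg, Nat.card_units,
        Nat.card_eq_fintype_card, hF, hfact]
    obtain ⟨k, hk⟩ := Nat.gcd_dvd_left m (q + 1)
    obtain ⟨e, he⟩ := Nat.gcd_dvd_right m (q + 1)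
    set d := Nat.gcd m (q + 1)
    have hxq : (g ^ e) ^ q = g ^ e * (g ^ e) ^ (q - 1) := by
      rw [← pow_succ', Nat.sub_add_cancel hq.le]
    have hpow : ((g ^ e) ^ (q - 1)) ^ m = 1 := by
      rw [← pow_mul, ← pow_mul, ← orderOf_dvd_iff_pow_eq_one, hord]
      exact ⟨k, by rw [he]; conv_lhs => rw [hk]
                   ring⟩
    have heq := h (g ^ e : Fˣ) 1 (Units.ne_zero _) one_ne_zero (by
      rw [one_pow, mul_one, mul_one, ← Units.val_pow_eq_pow_val _ q, hxq,
        ← Units.val_pow_eq_pow_val, ← Units.val_pow_eq_pow_val, mul_pow, hpow, mul_one])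
    rw [one_pow, mul_one, mul_one, ← Units.val_pow_eq_pow_val, Units.val_inj, hxq, left_eq_mul,
      ← pow_mul, ← orderOf_dvd_iff_pow_eq_one, hord, mul_comm e] at heq
    have hdvd : q + 1 ∣ e := Nat.dvd_of_mul_dvd_mul_left (by omega) heq
    have he0 : 0 < e := Nat.pos_of_ne_zero fun h0 => by simp [h0] at he
    have hle : d * e ≤ 1 * e := by rw [one_mul, ← he]; exact Nat.le_of_dvd he0 hdvd
    have hd0 : 0 < d := Nat.pos_of_ne_zero fun h0 => by simp [h0] at he
    have := Nat.le_of_mul_le_mul_right hle he0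
    omega
  · intro hgcd x y hx hy hxy
    have hfrob : ∀ x : F, (x ^ q) ^ q = x := fun x => by
      rw [← pow_mul, ← sq, ← hF, FiniteField.pow_card]
    have hne : x ^ q * y ≠ 0 := mul_ne_zero (pow_ne_zero _ hx) hy
    have h1 : (x * y ^ q / (x ^ q * y)) ^ m = 1 := by
      rw [div_pow, hxy, div_self (pow_ne_zero _ hne)]
    have h2 : (x * y ^ q / (x ^ q * y)) ^ (q + 1) = 1 := by
      rw [pow_succ, div_pow, mul_pow, mul_pow, hfrob, hfrob]
      field_simp
    have h3 : orderOf (x * y ^ q / (x ^ q * y)) ∣ 1 :=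
      hgcd ▸ Nat.dvd_gcd (orderOf_dvd_of_pow_eq_one h1) (orderOf_dvd_of_pow_eq_one h2)
    rw [← div_eq_one_iff_eq hne, ← orderOf_eq_one_iff]
    exact Nat.dvd_one.mp h3

/-- Lemma: for `P(x) = x^m − θ` with `m > 2`, `H_P` is nonzero and reducible over the
algebraic closure iff `θ^{q+1} ≠ 1`; and if `θ^{q+1} ≠ 1`, then `P` satisfies Condition (1)
iff `gcd(m, q+1) = 1`. -/
theorem statement9 (p n q m : ℕ) (hp : p.Prime) (hp3 : 3 < p) (hn : n ≠ 0) (hq : q = p ^ n)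
    (F : Type*) [Field F] [Fintype F] (hF : Fintype.card F = q ^ 2)
    (θ : F) (hm : 2 < m) (P : Polynomial F) (hP : P = X ^ m - C θ)
    (H : MvPolynomial (Fin 2) F)
    (hH : (MvPolynomial.X 0 - MvPolynomial.X 1) * H = Gpol q P) :
    ((H ≠ 0 ∧ ¬ Irreducible (MvPolynomial.map (algebraMap F (AlgebraicClosure F)) H)) ↔
        θ ^ (q + 1) ≠ 1) ∧
      (θ ^ (q + 1) ≠ 1 → (Condition1 q m P ↔ Nat.gcd m (q + 1) = 1)) := by
  have hq1 : 1 < q := hq ▸ Nat.one_lt_pow hn hp.one_lt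
  have hodd : Odd q := hq ▸ (hp.odd_of_ne_two (by omega)).pow
  have hm0 : 0 < m := by omega
  subst hP
  have hHsum : H = MvPolynomial.C (1 - θ ^ (q + 1)) * ∑ i ∈ Finset.range m,
      MvPolynomial.X 0 ^ i * MvPolynomial.X 1 ^ (m - 1 - i) := by
    refine mul_left_cancel₀ (MvPolynomial.X_zero_sub_X_one_ne_zero F) ?_
    rw [hH, Gpol_X_pow_sub_C hodd hm0, ← (Commute.all _ _).mul_geom_sum₂]
    ring
  refine ⟨⟨fun h hθ => h.1 ?_, fun hθ => ⟨fun h0 => ?_, ?_⟩⟩, fun hθ => ?_⟩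
  · rw [hHsum, hθ, sub_self, map_zero, zero_mul]
  · have heval := congrArg (MvPolynomial.eval ![(1 : F), 0]) hH
    rw [h0, mul_zero, map_zero, Gpol_X_pow_sub_C hodd hm0] at heval
    simp only [map_mul, map_sub, map_pow, MvPolynomial.eval_C, MvPolynomial.eval_X,
      Matrix.cons_val_zero, Matrix.cons_val_one, one_pow, zero_pow hm0.ne', sub_zero,
      mul_one] at heval
    exact hθ (sub_eq_zero.mp heval.symm).symm
  · have hc : algebraMap F (AlgebraicClosure F) (1 - θ ^ (q + 1)) ≠ 0 :=
      (_root_.map_ne_zero _).mpr (sub_ne_zero.mpr (Ne.symm hθ))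
    have hmap := not_irreducible_C_mul_geom_sum hm hc
    rw [hHsum]
    simpa only [map_mul, map_sum, map_pow, MvPolynomial.map_C, MvPolynomial.map_X] using hmap
  · have : Fact p.Prime := ⟨hp⟩
    have : CharP F p := charP_of_card_eq_prime_pow (f := n * 2) (by
      rw [hF, hq, pow_mul])
    rw [condition1_X_pow_sub_C_iff hp hq hF hθ, pow_injective_on_quotients_iff hq1 hF]
end
end

section
/- Let θ ∈ F_{q^2} be nonzero with multiplicative order o(θ). The cubic binomial x^3 − θ ∈ F_{q^2}[x] is irreducible over F_{q^2} and satisfies Condition (1) if and only if q ≡ 1 (mod 3) and 3 does not divide (q^2 − 1)/o(θ). -/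
noncomputable section

open Polynomial

/-- In a finite cyclic group `G`, an element is a `d`-th power, for `d` dividing `|G|`, iff `d`
divides its index `|G| / orderOf a`. -/
theorem IsCyclic.exists_pow_eq_iff_dvd_card_div_orderOf {G : Type*} [Group G] [Finite G]
    [IsCyclic G] {d : ℕ} (hd : d ∣ Nat.card G) (a : G) :
    (∃ b : G, b ^ d = a) ↔ d ∣ Nat.card G / orderOf a := by
  obtain ⟨g, hg⟩ := IsCyclic.exists_monoid_generator (α := G)
  have hgo : orderOf g = Nat.card G := by
    refine orderOf_eq_card_of_forall_mem_zpowers fun x => ?_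
    obtain ⟨k, rfl⟩ := Submonoid.mem_powers_iff _ _ |>.1 (hg x)
    exact Subgroup.npow_mem_zpowers g k
  have index_pow (k : ℕ) : Nat.card G / orderOf (g ^ k) = (Nat.card G).gcd k := by
    rw [orderOf_pow, hgo, Nat.div_div_self (Nat.gcd_dvd_left _ _) Nat.card_pos.ne']
  constructor
  · rintro ⟨b, rfl⟩
    obtain ⟨k, rfl⟩ := Submonoid.mem_powers_iff _ _ |>.1 (hg b)
    rw [← pow_mul, index_pow]
    exact Nat.dvd_gcd hd (Dvd.intro_left k rfl)
  · obtain ⟨k, rfl⟩ := Submonoid.mem_powers_iff _ _ |>.1 (hg a)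
    rw [index_pow]
    intro h
    obtain ⟨m, rfl⟩ := h.trans (Nat.gcd_dvd_right _ _)
    exact ⟨g ^ m, by rw [← pow_mul, mul_comm]⟩

/-- In a finite field, a nonzero element is a `d`-th power, for `d` dividing `|F| - 1`, iff `d`
divides its index `(|F| - 1) / orderOf a`. -/
theorem FiniteField.exists_pow_eq_iff_dvd_card_sub_one_div_orderOf {F : Type*} [Field F]
    [Fintype F] {d : ℕ} (hd : d ∣ Fintype.card F - 1) (hd0 : d ≠ 0) {a : F} (ha : a ≠ 0) :
    (∃ b : F, b ^ d = a) ↔ d ∣ (Fintype.card F - 1) / orderOf a := by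
  have hcard : Nat.card Fˣ = Fintype.card F - 1 := by
    rw [Nat.card_units, Nat.card_eq_fintype_card]
  have key := IsCyclic.exists_pow_eq_iff_dvd_card_div_orderOf (hcard ▸ hd) (Units.mk0 a ha)
  rw [hcard, ← orderOf_units, Units.val_mk0] at key
  rw [← key]
  constructor
  · rintro ⟨b, rfl⟩
    exact ⟨Units.mk0 b (ne_zero_pow hd0 ha), Units.ext (by simp)⟩
  · rintro ⟨b, hb⟩
    exact ⟨b, by simpa using congrArg Units.val hb⟩

/-- If the `q`-power map swaps `a` and `b`, which have the same cube, and `q ≡ 1 (mod 3)`,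
then `a = b`. -/
theorem eq_of_pow_three_eq_of_pow_swap {F : Type*} [Field F] {q : ℕ} (hq : q % 3 = 1) {a b : F}
    (hab : a ^ q = b) (hba : b ^ q = a) (h : a ^ 3 = b ^ 3) : a = b := by
  obtain ⟨k, rfl⟩ : ∃ k, q = 3 * k + 1 := ⟨q / 3, by omega⟩
  rw [pow_succ, pow_mul] at hab hba
  rw [← h] at hba
  rcases eq_or_ne a 0 with rfl | ha
  · simpa using hab
  have hsq : a ^ 2 = b ^ 2 := mul_left_cancel₀ (pow_ne_zero k (pow_ne_zero 3 ha)) <| by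
    linear_combination a * hab - b * hba
  have : a ^ 2 * (a - b) = 0 := by linear_combination h - b * hsq
  exact sub_eq_zero.1 ((mul_eq_zero.1 this).resolve_left (pow_ne_zero 2 ha))

theorem pow_three_mul_eval_X_pow_three_sub_C {F : Type*} [Field F] {q : ℕ} (hq : 1 ≤ q)
    (θ x : F) : x ^ 3 * ((X : F[X]) ^ 3 - C θ).eval (x ^ (q - 1)) = (x ^ 3) ^ q - θ * x ^ 3 := by
  obtain ⟨k, rfl⟩ : ∃ k, q = k + 1 := ⟨q - 1, by omega⟩
  simp only [eval_sub, eval_pow, eval_X, eval_C, Nat.add_sub_cancel]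
  ring

/-- Condition (1) for `x³ - θ` when `q ≡ 1 (mod 3)` and `θ` does not have norm `1`. -/
theorem condition1_X_pow_three_sub_C {F : Type*} [Field F] {q : ℕ} (hq : q % 3 = 1)
    (hsub : ∀ x y : F, (x - y) ^ q = x ^ q - y ^ q) (hinv : ∀ x : F, (x ^ q) ^ q = x)
    {θ : F} (hθ : θ ^ (q + 1) ≠ 1) : Condition1 q 3 ((X : F[X]) ^ 3 - C θ) := by
  intro x y _ _ h
  simp only [pow_three_mul_eval_X_pow_three_sub_C (show 1 ≤ q by omega), hsub, mul_pow _ _ q,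
    hinv] at h
  have hprod : (1 - θ ^ (q + 1)) * ((x ^ 3) ^ q * y ^ 3 - x ^ 3 * (y ^ 3) ^ q) = 0 := by
    rw [pow_succ]
    linear_combination h
  have hcube := (mul_eq_zero.1 hprod).resolve_left (sub_ne_zero.2 hθ.symm)
  refine eq_of_pow_three_eq_of_pow_swap hq ?_ ?_ ?_
  · rw [mul_pow, hinv]
  · rw [mul_pow, hinv]
  · rw [pow_right_comm x, pow_right_comm y] at hcube
    linear_combination -hcube

/-- If `q ≡ 2 (mod 3)`, a primitive cube root of unity violates Condition (1) for `x³ - θ`. -/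
theorem not_condition1_X_pow_three_sub_C {F : Type*} [Field F] {q : ℕ} (hq : q % 3 = 2)
    {ω : F} (hω : ω ^ 3 = 1) (hω1 : ω ≠ 1) (θ : F) :
    ¬ Condition1 q 3 ((X : F[X]) ^ 3 - C θ) := by
  intro h
  have hω0 : ω ≠ 0 := by
    rintro rfl
    simp at hω
  have key := h ω 1 hω0 one_ne_zero <| by
    simp only [pow_three_mul_eval_X_pow_three_sub_C (show 1 ≤ q by omega)]
    simp only [hω, one_pow]
    ring
  obtain ⟨k, rfl⟩ : ∃ k, q = 3 * k + 2 := ⟨q / 3, by omega⟩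
  rw [one_pow, pow_add, pow_mul, hω, one_pow] at key
  exact hω1 (mul_left_cancel₀ hω0 (by linear_combination -key))

/-- Theorem: for `0 ≠ θ ∈ 𝔽_{q²}`, the binomial `x³ − θ` is irreducible over `𝔽_{q²}` and
satisfies Condition (1) iff `q ≡ 1 (mod 3)` and `3 ∤ (q² − 1)/o(θ)`. -/
theorem statement10 (p n q : ℕ) (hp : p.Prime) (hp3 : 3 < p) (hn : n ≠ 0) (hq : q = p ^ n)
    (F : Type*) [Field F] [Fintype F] (hF : Fintype.card F = q ^ 2)
    (θ : F) (hθ : θ ≠ 0) :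
    (Irreducible ((X : Polynomial F) ^ 3 - C θ) ∧ Condition1 q 3 ((X : Polynomial F) ^ 3 - C θ)) ↔
      (q % 3 = 1 ∧ ¬ (3 ∣ (q ^ 2 - 1) / orderOf θ)) := by
  have : Fact p.Prime := ⟨hp⟩
  have hcard : Fintype.card F = p ^ (n * 2) := by rw [hF, hq, pow_mul]
  have : CharP F p := charP_of_card_eq_prime_pow hcard
  have hq3 : q % 3 ≠ 0 := fun h => by
    have h3p := Nat.prime_three.dvd_of_dvd_pow (hq ▸ Nat.dvd_of_mod_eq_zero h)
    have := (Nat.prime_dvd_prime_iff_eq Nat.prime_three hp).1 h3p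
    omega
  have hsq : (q + 1) * (q - 1) = q ^ 2 - 1 := by simpa using (Nat.sq_sub_sq q 1).symm
  have h3 : 3 ∣ q ^ 2 - 1 := by
    rw [← hsq, Nat.prime_three.dvd_mul]
    omega
  have hcubes : (∃ b : F, b ^ 3 = θ) ↔ 3 ∣ (q ^ 2 - 1) / orderOf θ := by
    rw [← hF] at h3 ⊢
    exact FiniteField.exists_pow_eq_iff_dvd_card_sub_one_div_orderOf h3 three_ne_zero hθ
  rw [X_pow_sub_C_irreducible_iff_of_prime Nat.prime_three, ← hcubes, not_exists,
    and_comm (a := q % 3 = 1), and_congr_right_iff]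
  intro hθ3
  constructor
  · intro hcond
    by_contra hq1
    obtain ⟨ω, hω⟩ := exists_prime_orderOf_dvd_card' (G := Fˣ) 3 (by
      rwa [Nat.card_units, Nat.card_eq_fintype_card, hF])
    refine not_condition1_X_pow_three_sub_C (q := q) (ω := (ω : F)) (by omega) ?_ ?_ θ hcond
    · rw [← Units.val_pow_eq_pow_val, ← hω, pow_orderOf_eq_one, Units.val_one]
    · rintro h
      rw [Units.val_eq_one.1 h, orderOf_one] at hω
      omega
  · intro hq1
    refine condition1_X_pow_three_sub_C hq1 (fun x y => hq ▸ sub_pow_char_pow x y n)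
      (fun x => by rw [← pow_mul, ← sq, ← hF, FiniteField.pow_card]) fun hnorm => ?_
    have h3o : 3 ∣ (q ^ 2 - 1) / orderOf θ := by
      rw [← hsq, Nat.mul_div_right_comm (orderOf_dvd_of_pow_eq_one hnorm)]
      exact Dvd.dvd.mul_left (by omega) _
    obtain ⟨b, hb⟩ := hcubes.2 h3o
    exact hθ3 b hb
end
end

section
/- Let δ, γ ∈ F_{q^2} with γ^{q+1} = 9 and suppose Q_{δ,γ}(x) is irreducible in F_{q^2}[x]. Then Q_{δ,γ} satisfies Condition (1) if and only if γ^{(q+1)/2} = 3. -/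
noncomputable section

open Polynomial

/-- The cubic `Q_{δ,γ}(x) = x³ − δx² − γx + δγ/9`. -/
def Qdg {F : Type*} [Field F] (δ γ : F) : Polynomial F :=
  X ^ 3 - C δ * X ^ 2 - C γ * X + C (δ * γ / 9)

/-- The factorisation of the cross difference of two values of `σ x ^ 3 - δ x σ x ^ 2 - …`;
here `X, Y, d, g` stand for the conjugates of `x, y, δ, γ`. -/
lemma cubic_form_cross_sub {F : Type*} [Field F] (h9 : (9 : F) ≠ 0) {δ γ d g x X y Y : F}
    (h : γ * g = 9) :
    (X ^ 3 - δ * x * X ^ 2 - γ * x ^ 2 * X + δ * γ / 9 * x ^ 3) *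
        (y ^ 3 - d * Y * y ^ 2 - g * Y ^ 2 * y + d * g / 9 * Y ^ 3) -
      (x ^ 3 - d * X * x ^ 2 - g * X ^ 2 * x + d * g / 9 * X ^ 3) *
        (Y ^ 3 - δ * y * Y ^ 2 - γ * y ^ 2 * Y + δ * γ / 9 * y ^ 3) =
    (9 - δ * d) / (9 * γ) * (x * Y - X * y) *
      ((3 * X * Y + γ * x * y) ^ 2 - γ * (X * y - x * Y) ^ 2) := by
  have hγ : γ ≠ 0 := by rintro rfl; simp at h; exact h9 h.symm
  obtain rfl : g = 9 / γ := by field_simp; linear_combination h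
  field_simp
  ring

lemma eq_of_sq_eq_of_norm_eq_three {F : Type*} [Field F] (h2 : (2 : F) ≠ 0) (h3 : (3 : F) ≠ 0)
    (σ : F →+* F) {r z w : F} (hr : r * σ r = 3) (hz : z * σ z = 1) (hw : w * σ w = 1)
    (h : (3 * z * w + r ^ 2) ^ 2 = r ^ 2 * (z - w) ^ 2) : z = w := by
  have hr0 : r ≠ 0 := by rintro rfl; simp at hr; exact h3 hr.symm
  have hz0 : z ≠ 0 := left_ne_zero_of_mul_eq_one hz
  have hw0 : w ≠ 0 := left_ne_zero_of_mul_eq_one hw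
  have hσr : σ r = 3 / r := by field_simp; linear_combination hr
  have hσz : σ z = 1 / z := by field_simp; linear_combination hz
  have hσw : σ w = 1 / w := by field_simp; linear_combination hw
  have key : (3 * z * w + r ^ 2 + r * (z - w)) = 0 ∧ (3 * z * w + r ^ 2 - r * (z - w)) = 0 := by
    have hprod : (3 * z * w + r ^ 2 + r * (z - w)) * (3 * z * w + r ^ 2 - r * (z - w)) = 0 := by
      linear_combination h
    rcases mul_eq_zero.mp hprod with h' | h' <;> refine ⟨?_, ?_⟩ <;> try exact h'
    all_goals
      have := congrArg σ h'
      simp only [map_add, map_sub, map_mul, map_pow, map_ofNat, map_zero, hσr, hσz, hσw] at this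
      field_simp at this
      first
        | linear_combination this
        | (refine (mul_eq_zero.mp (?_ : (3 : F) * _ = 0)).resolve_left h3
           linear_combination this)
  have : 2 * r * (z - w) = 0 := by linear_combination key.1 - key.2
  simpa [h2, hr0, sub_eq_zero] using this

lemma exists_root_cubic {F : Type*} [Field F] [Finite F] (h2 : (2 : F) ≠ 0) (h3 : (3 : F) ≠ 0)
    (σ : F →+* F) {r δ : F} (hr : r * σ r = 3) (hδ : δ * σ δ = 9) :
    ∃ z : F, z ^ 3 - δ * z ^ 2 - r ^ 2 * z + δ * r ^ 2 / 9 = 0 := by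
  have h9 : (9 : F) ≠ 0 := by
    have : (9 : F) = 3 * 3 := by norm_num
    rw [this]; exact mul_ne_zero h3 h3
  have hr0 : r ≠ 0 := by rintro rfl; simp at hr; exact h3 hr.symm
  have hσr : σ r = 3 / r := by field_simp; linear_combination hr
  let S := {z : F // z * σ z = 1}
  have hden (z : S) : 9 * (z : F) ^ 2 - r ^ 2 ≠ 0 := by
    obtain ⟨z, hz⟩ := z
    intro h
    have h' : 9 * z ^ 2 = r ^ 2 := sub_eq_zero.mp h
    have hc := congrArg σ h'
    simp only [map_mul, map_pow, map_ofNat] at hc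
    have : (81 : F) = 9 := by
      calc (81 : F) = (9 * z ^ 2) * (9 * σ z ^ 2) := by linear_combination (-81) * (z * σ z + 1) * hz
        _ = 9 := by rw [h', hc]; linear_combination (r * σ r + 3) * hr
    have : (2 : F) ^ 3 * 3 ^ 2 = 0 := by linear_combination this
    simp [h2, h3] at this
  have hnorm (z : S) : 9 * ((z : F) ^ 3 - r ^ 2 * z) / (9 * (z : F) ^ 2 - r ^ 2) *
      σ (9 * ((z : F) ^ 3 - r ^ 2 * z) / (9 * (z : F) ^ 2 - r ^ 2)) = 9 := by
    have hd := hden z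
    have hd' : σ (9 * (z : F) ^ 2 - r ^ 2) ≠ 0 := (map_ne_zero σ).mpr hd
    obtain ⟨z, hz⟩ := z
    have hz0 : z ≠ 0 := left_ne_zero_of_mul_eq_one hz
    have hσz : σ z = 1 / z := by field_simp; linear_combination hz
    rw [map_div₀, div_mul_div_comm, div_eq_iff (mul_ne_zero hd hd')]
    simp only [map_sub, map_mul, map_pow, map_ofNat, hσr, hσz]
    field_simp
    ring
  let f : S → S := fun z ↦ ⟨9 * ((z : F) ^ 3 - r ^ 2 * z) / (9 * (z : F) ^ 2 - r ^ 2) / 3, by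
    have := hnorm z
    rw [map_div₀, div_mul_div_comm, this, map_ofNat]
    rw [div_eq_one_iff_eq] <;> norm_num
    exact h9⟩
  have hf : Function.Injective f := by
    intro z w h
    have h := congrArg Subtype.val h
    have hdz := hden z
    have hdw := hden w
    simp only [f] at h
    have h' : ((z : F) ^ 3 - r ^ 2 * z) * (9 * (w : F) ^ 2 - r ^ 2) =
        ((w : F) ^ 3 - r ^ 2 * w) * (9 * (z : F) ^ 2 - r ^ 2) := by
      field_simp at h
      linear_combination h
    have h'' : ((z : F) - w) * ((3 * z * w + r ^ 2) ^ 2 - r ^ 2 * (z - w) ^ 2) = 0 := by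
      linear_combination h'
    apply Subtype.ext
    rcases mul_eq_zero.mp h'' with h | h
    · exact sub_eq_zero.mp h
    · exact eq_of_sq_eq_of_norm_eq_three h2 h3 σ hr z.2 w.2 (sub_eq_zero.mp h)
  obtain ⟨z, hz⟩ := Finite.injective_iff_surjective.mp hf ⟨δ / 3, by
    rw [map_div₀, div_mul_div_comm, hδ, map_ofNat]
    rw [div_eq_one_iff_eq] <;> norm_num
    exact h9⟩
  refine ⟨z, ?_⟩
  have hz := congrArg Subtype.val hz
  have hd := hden z
  simp only [f] at hz
  field_simp at hz
  field_simp
  linear_combination hz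

lemma exists_not_fixed {F : Type*} [Field F] (h2 : (2 : F) ≠ 0) (σ : F →+* F)
    (hσ : ∃ t, σ t ≠ t) {r : F} (hr : r ≠ 0) : ∃ x : F, x ≠ 0 ∧ σ (r * x ^ 2) ≠ r * x ^ 2 := by
  by_contra! H
  obtain ⟨t, ht⟩ := hσ
  have fixed (x : F) : σ r * σ x ^ 2 = r * x ^ 2 := by
    rcases eq_or_ne x 0 with rfl | hx
    · simp
    · simpa using H x hx
  have h1 := fixed 1
  have ht' := fixed t
  have ht1 := fixed (1 + t)
  simp only [map_one, map_add] at h1 ht1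
  have : 2 * r * (σ t - t) = 0 := by
    linear_combination ht1 - ht' - h1 - 2 * σ t * h1
  simp [h2, hr, sub_eq_zero, ht] at this

lemma eval_Qdg_homogeneous {F : Type*} [Field F] {q : ℕ} (hq : q ≠ 0) (δ γ x : F) :
    x ^ 3 * (Qdg δ γ).eval (x ^ (q - 1)) =
      (x ^ q) ^ 3 - δ * x * (x ^ q) ^ 2 - γ * x ^ 2 * x ^ q + δ * γ / 9 * x ^ 3 := by
  have h : x ^ q = x * x ^ (q - 1) := (mul_pow_sub_one hq x).symm
  rw [h]
  simp only [Qdg, eval_add, eval_sub, eval_mul, eval_pow, eval_X, eval_C]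
  ring

/-- Theorem: for `γ^{q+1} = 9` and `Q_{δ,γ}` irreducible, `Q_{δ,γ}` satisfies Condition (1)
iff `γ^{(q+1)/2} = 3`. -/
theorem statement13 (p n q : ℕ) (hp : p.Prime) (hp3 : 3 < p) (hn : n ≠ 0) (hq : q = p ^ n)
    (F : Type*) [Field F] [Fintype F] (hF : Fintype.card F = q ^ 2)
    (δ γ : F) (hγ : γ ^ (q + 1) = 9) (hQirr : Irreducible (Qdg δ γ)) :
    Condition1 q 3 (Qdg δ γ) ↔ γ ^ ((q + 1) / 2) = 3 := by
  have : Fact p.Prime := ⟨hp⟩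
  have hchar : CharP F p := by
    refine (CharP.charP_iff_prime_eq_zero hp).mpr ?_
    have h := FiniteField.cast_card_eq_zero F
    rw [hF, hq] at h
    simpa [hn] using h
  have hq1 : 1 < q := hq ▸ Nat.one_lt_pow hn hp.one_lt
  have hqodd : Odd q := hq ▸ (hp.odd_of_ne_two (by omega)).pow
  have natCast_ne_zero {k : ℕ} (hk : 0 < k) (hkp : k < p) : (k : F) ≠ 0 := fun h ↦
    absurd (Nat.le_of_dvd hk ((CharP.cast_eq_zero_iff F p k).mp h)) (by omega)
  have h2 : (2 : F) ≠ 0 := by exact_mod_cast natCast_ne_zero (k := 2) (by omega) (by omega)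
  have h3 : (3 : F) ≠ 0 := by exact_mod_cast natCast_ne_zero (k := 3) (by omega) (by omega)
  have h9 : (9 : F) ≠ 0 := by
    have : (9 : F) = 3 * 3 := by norm_num
    rw [this]; exact mul_ne_zero h3 h3
  obtain ⟨σ, hσ⟩ : ∃ σ : F →+* F, ∀ a, σ a = a ^ q :=
    ⟨iterateFrobenius F p n, fun a ↦ by rw [iterateFrobenius_def, hq]⟩
  have hσσ (a : F) : σ (σ a) = a := by
    rw [hσ, hσ, ← pow_mul, ← sq, ← hF, FiniteField.pow_card]
  have hγσ : γ * σ γ = 9 := by rw [hσ, ← hγ]; ring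
  have hγ0 : γ ≠ 0 := by rintro rfl; simp at hγσ; exact h9 hγσ.symm
  obtain ⟨r, hr⟩ : ∃ r, γ = r ^ 2 := by
    have hch2 : ringChar F ≠ 2 := by
      rw [ringChar.eq F p]; omega
    obtain ⟨r, hr⟩ := (FiniteField.isSquare_iff hch2 hγ0).mpr (by
      obtain ⟨k, hk⟩ := hqodd
      have : Fintype.card F / 2 = (q + 1) * k := by
        rw [hF, hk]
        have : (2 * k + 1) ^ 2 = 2 * ((2 * k + 1 + 1) * k) + 1 := by ring
        omega
      rw [this, pow_mul, hγ]
      have h3q : (3 : F) ^ q = 3 := by rw [← hσ, map_ofNat]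
      have : (3 : F) * 9 ^ k = 3 := by
        calc (3 : F) * 9 ^ k = 3 ^ q := by
              rw [hk, pow_succ, pow_mul]; norm_num [mul_comm]
          _ = 3 := h3q
      exact mul_left_cancel₀ h3 (by rw [this, mul_one]))
    exact ⟨r, by rw [hr, sq]⟩
  have hr0 : r ≠ 0 := by rintro rfl; simp at hr; exact hγ0 hr
  have hc : γ ^ ((q + 1) / 2) = r * σ r := by
    rw [hr, ← pow_mul, hσ, Nat.mul_div_cancel' (by rcases hqodd with ⟨k, hk⟩; omega)]
    ring
  have hform (x y : F) :
      (x ^ 3 * (Qdg δ γ).eval (x ^ (q - 1))) * (y ^ 3 * (Qdg δ γ).eval (y ^ (q - 1))) ^ q -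
        (x ^ 3 * (Qdg δ γ).eval (x ^ (q - 1))) ^ q * (y ^ 3 * (Qdg δ γ).eval (y ^ (q - 1))) =
      (9 - δ * σ δ) / (9 * γ) * (x * σ y - σ x * y) *
        ((3 * σ x * σ y + γ * x * y) ^ 2 - γ * (σ x * y - x * σ y) ^ 2) := by
    rw [← cubic_form_cross_sub h9 hγσ, eval_Qdg_homogeneous (by omega),
      eval_Qdg_homogeneous (by omega), ← hσ, ← hσ, ← hσ, ← hσ]
    simp only [map_add, map_sub, map_mul, map_pow, map_div₀, map_ofNat, hσσ]
  rw [hc]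
  constructor
  · intro hC
    by_contra hne
    have hr3 : r * σ r = -3 := by
      have : (r * σ r - 3) * (r * σ r + 3) = 0 := by
        rw [hr, map_pow] at hγσ
        linear_combination hγσ
      rcases mul_eq_zero.mp this with h | h
      · exact absurd (sub_eq_zero.mp h) hne
      · exact eq_neg_of_add_eq_zero_left h
    have hmove : ∃ t, σ t ≠ t := by
      by_contra! H
      have hsub : (Finset.univ : Finset F).val ⊆ (X ^ q - X : F[X]).roots := by
        intro a _
        rw [mem_roots (FiniteField.X_pow_card_sub_X_ne_zero F hq1)]
        simp [← hσ, H]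
      have h1 := card_le_degree_of_subset_roots hsub
      rw [FiniteField.X_pow_card_sub_X_natDegree_eq F hq1, Finset.card_univ, hF] at h1
      nlinarith
    obtain ⟨x, hx, hrx⟩ := exists_not_fixed h2 σ hmove hr0
    set y := x + σ r * σ x with hy
    have hσy : σ y = σ x + r * x := by rw [hy, map_add, map_mul, hσσ, hσσ]
    have hcross : x * σ y ≠ σ x * y := by
      intro h
      apply hrx
      rw [hσy, hy] at h
      rw [map_mul, map_pow]
      linear_combination -h
    have hy0 : y ≠ 0 := by
      intro h
      rw [h, map_zero, mul_zero, mul_zero] at hcross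
      exact hcross rfl
    apply hcross
    rw [hσ, hσ]
    refine hC x y hx hy0 (sub_eq_zero.mp ?_)
    rw [hform]
    have hE : 3 * σ x * σ y + γ * x * y + r * (σ x * y - x * σ y) = 0 := by
      rw [hσy, hy, hr]
      linear_combination (r * x * σ x + σ x ^ 2) * hr3
    rw [hr] at hE ⊢
    linear_combination (9 - δ * σ δ) / (9 * r ^ 2) * (x * σ y - σ x * y) *
      (3 * σ x * σ y + r ^ 2 * x * y - r * (σ x * y - x * σ y)) * hE
  · intro hr3 x y hx hy h
    have hδ : 9 - δ * σ δ ≠ 0 := by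
      intro h
      obtain ⟨z, hz⟩ := exists_root_cubic h2 h3 σ hr3 (sub_eq_zero.mp h).symm
      have hdeg : (Qdg δ γ).natDegree = 3 := by
        unfold Qdg; compute_degree!
      have h1 : (Qdg δ γ).natDegree = 1 := natDegree_eq_of_degree_eq_some
        (degree_eq_one_of_irreducible_of_root hQirr (x := z) (by
          simp only [IsRoot.def, Qdg, eval_add, eval_sub, eval_mul, eval_pow, eval_X, eval_C, hr]
          exact hz))
      omega
    rw [← sub_eq_zero, hform] at h
    rw [← hσ, ← hσ]
    rcases mul_eq_zero.mp h with h | h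
    · have h' := (mul_eq_zero.mp h).resolve_left (div_ne_zero hδ (mul_ne_zero h9 hγ0))
      exact sub_eq_zero.mp h'
    · have hx' : σ x ≠ 0 := by simpa using hx
      have hy' : σ y ≠ 0 := by simpa using hy
      have hzw := eq_of_sq_eq_of_norm_eq_three (z := σ x / x) (w := σ y / y) h2 h3 σ hr3
        (by rw [map_div₀, hσσ]; field_simp) (by rw [map_div₀, hσσ]; field_simp) (by
          rw [hr] at h
          field_simp
          linear_combination h)
      field_simp at hzw
      linear_combination -hzw
end
end

section
/- Let δ, α ∈ F_{q^2} with α ≠ 0. Then P_{δ,α}(x) is either irreducible over F_{q^2} or has all three of its roots (with multiplicity) in F_{q^2}. Moreover, P_{δ,α}(x) is reducible over F_{q^2} if and only if at least one of the following holds: α^{q+1} = 4; or there exists r ∈ F_{q^2} with r^2 = 1 − 4α^{−(q+1)} such that either δ = −(3α/2)(1 + r), or δ = −(3α/2)(1 + ((κ^3 + 1)/(κ^3 − 1))·r) for some κ ∈ F_{q^2} with κ^3 ≠ 1. -/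
noncomputable section

open Polynomial

/-- The cubic `P_{δ,α}(x) = x³ − δx² − (δα + 3α^{1−q})x − (δα²(1 − α^{−(q+1)})/3 + α^{2−q})`. -/
def Pda {F : Type*} [Field F] (q : ℕ) (δ α : F) : Polynomial F :=
  X ^ 3 - C δ * X ^ 2 - C (δ * α + 3 * α ^ ((1 : ℤ) - q)) * X -
    C (δ * α ^ 2 * (1 - α ^ (-((q : ℤ) + 1))) / 3 + α ^ ((2 : ℤ) - q))

/-- Vieta's formulas for a cubic given by its three roots. -/
theorem prod_X_sub_C_three {R : Type*} [CommRing R] (a b c : R) :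
    (X - C a) * (X - C b) * (X - C c) =
      X ^ 3 - C (a + b + c) * X ^ 2 + C (a * b + a * c + b * c) * X - C (a * b * c) := by
  simp only [C_add, C_mul]
  ring

section Cubic

variable {F : Type*} [Field F]

theorem four_ne_zero_of_two_ne_zero (h2 : (2 : F) ≠ 0) : (4 : F) ≠ 0 := by
  convert mul_ne_zero h2 h2 using 1
  norm_num

/-- `P_{δ,α}` written in terms of `u = α^{-(q+1)}`. -/
theorem Pda_eq {q : ℕ} {δ α u : F} (hα : α ≠ 0) (hu : α ^ (-((q : ℤ) + 1)) = u) :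
    Pda q δ α = X ^ 3 - C δ * X ^ 2 - C (δ * α + 3 * (u * α ^ 2)) * X -
      C (δ * α ^ 2 * (1 - u) / 3 + u * α ^ 3) := by
  have h1 : α ^ ((1 : ℤ) - q) = u * α ^ 2 := by
    rw [← hu, ← zpow_natCast α 2, ← zpow_add₀ hα]
    congr 1
    push_cast
    ring
  have h2 : α ^ ((2 : ℤ) - q) = u * α ^ 3 := by
    rw [← hu, ← zpow_natCast α 3, ← zpow_add₀ hα]
    congr 1
    push_cast
    ring
  rw [Pda, h1, h2, hu]

/-- If the elementary symmetric functions of `a, b, c` match, `P_{δ,α}` splits. -/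
theorem Pda_eq_prod {q : ℕ} {δ α u a b c : F} (hα : α ≠ 0)
    (hu : α ^ (-((q : ℤ) + 1)) = u) (h1 : a + b + c = δ)
    (h2 : a * b + a * c + b * c = -(δ * α + 3 * (u * α ^ 2)))
    (h3 : a * b * c = δ * α ^ 2 * (1 - u) / 3 + u * α ^ 3) :
    Pda q δ α = (X - C a) * (X - C b) * (X - C c) := by
  rw [Pda_eq hα hu, prod_X_sub_C_three, h1, h2, h3, C_neg]
  ring

theorem Pda_splits_of_param {q : ℕ} {δ α u r ω κ : F} (h2 : (2 : F) ≠ 0) (h3 : (3 : F) ≠ 0)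
    (hα : α ≠ 0) (hu : α ^ (-((q : ℤ) + 1)) = u) (hr : r ^ 2 = 1 - 4 * u)
    (hω : ω ^ 2 + ω + 1 = 0) (hκ : κ ^ 3 ≠ 1)
    (hδ : δ = -(3 * α / 2) * (1 + ((κ ^ 3 + 1) / (κ ^ 3 - 1)) * r)) :
    ∃ τ σ ν : F, Pda q δ α = (X - C τ) * (X - C σ) * (X - C ν) := by
  have hD : κ ^ 3 - 1 ≠ 0 := sub_ne_zero.mpr hκ
  have h4 := four_ne_zero_of_two_ne_zero h2
  have hu' : u = (1 - r ^ 2) / 4 := by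
    field_simp
    linear_combination hr
  set m : F := -(1 + (κ ^ 3 + 1) / (κ ^ 3 - 1) * r) / 2 with hm
  set w : F := -r / (κ ^ 3 - 1) with hw
  set a : F := κ + κ ^ 2 with ha
  set b : F := κ * ω + κ ^ 2 * (-1 - ω) with hb
  set c : F := κ * (-1 - ω) + κ ^ 2 * ω with hc
  have e1 : a + b + c = 0 := by
    rw [ha, hb, hc]
    ring
  have e2 : a * b + a * c + b * c = -3 * κ ^ 3 := by
    rw [ha, hb, hc]
    linear_combination (2 * κ ^ 3 - κ ^ 2 - κ ^ 4) * hω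
  have e3 : a * b * c = κ ^ 3 + κ ^ 6 := by
    rw [ha, hb, hc]
    linear_combination (κ + κ ^ 2) * (2 * κ ^ 3 - κ ^ 2 - κ ^ 4) * hω
  refine ⟨α * (m + w * a), α * (m + w * b), α * (m + w * c), Pda_eq_prod hα hu ?_ ?_ ?_⟩
  · rw [hδ]
    linear_combination α * w * e1 + 3 * α * hm
  · have key : 3 * m ^ 2 - 3 * w ^ 2 * κ ^ 3 = -(3 * m + 3 * u) := by
      rw [hu', hm, hw]
      field_simp
      ring
    have hδ' : δ = 3 * α * m := by
      rw [hδ, hm]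
      ring
    rw [hδ']
    linear_combination α ^ 2 * (2 * m * w * e1 + w ^ 2 * e2 + key)
  · have key : m ^ 3 - 3 * m * w ^ 2 * κ ^ 3 + w ^ 3 * (κ ^ 3 + κ ^ 6) = m * (1 - u) + u := by
      rw [hu', hm, hw]
      field_simp
      ring
    have hδ' : δ = 3 * α * m := by
      rw [hδ, hm]
      ring
    have hd : δ * α ^ 2 * (1 - u) / 3 = α ^ 3 * (m * (1 - u)) := by
      rw [hδ']
      field_simp
    rw [hd]
    linear_combination α ^ 3 * (m ^ 2 * w * e1 + m * w ^ 2 * e2 + w ^ 3 * e3 + key)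

theorem Pda_splits_of_double_root {q : ℕ} {δ α : F} (h2 : (2 : F) ≠ 0) (h3 : (3 : F) ≠ 0)
    (hα : α ≠ 0) (hu : 4 * α ^ (-((q : ℤ) + 1)) = 1) :
    ∃ τ σ ν : F, Pda q δ α = (X - C τ) * (X - C σ) * (X - C ν) := by
  have h4 := four_ne_zero_of_two_ne_zero h2
  have hu' : α ^ (-((q : ℤ) + 1)) = 1 / 4 := by
    field_simp
    linear_combination hu
  refine ⟨-α / 2, -α / 2, δ + α, Pda_eq_prod hα hu' ?_ ?_ ?_⟩ <;> field_simp <;> ring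

theorem Pda_splits_of_triple_root {q : ℕ} {δ α u r : F} (h2 : (2 : F) ≠ 0) (h3 : (3 : F) ≠ 0)
    (hα : α ≠ 0) (hu : α ^ (-((q : ℤ) + 1)) = u) (hr : r ^ 2 = 1 - 4 * u)
    (hδ : δ = -(3 * α / 2) * (1 + r)) :
    ∃ τ σ ν : F, Pda q δ α = (X - C τ) * (X - C σ) * (X - C ν) := by
  have h4 := four_ne_zero_of_two_ne_zero h2
  have hu' : u = (1 - r ^ 2) / 4 := by
    field_simp
    linear_combination hr
  refine ⟨-α * (1 + r) / 2, -α * (1 + r) / 2, -α * (1 + r) / 2, Pda_eq_prod hα hu ?_ ?_ ?_⟩ <;>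
    rw [hδ] <;> try rw [hu']
  all_goals field_simp
  all_goals ring

theorem exists_param_of_root {q : ℕ} {δ α u r x : F} (h2 : (2 : F) ≠ 0) (h3 : (3 : F) ≠ 0)
    (hα : α ≠ 0) (hu : α ^ (-((q : ℤ) + 1)) = u) (hr : r ^ 2 = 1 - 4 * u) (hr0 : r ≠ 0)
    (hx : (Pda q δ α).IsRoot x) :
    δ = -(3 * α / 2) * (1 + r) ∨
      ∃ κ : F, κ ^ 3 ≠ 1 ∧ δ = -(3 * α / 2) * (1 + ((κ ^ 3 + 1) / (κ ^ 3 - 1)) * r) := by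
  have h4 := four_ne_zero_of_two_ne_zero h2
  have hu' : u = (1 - r ^ 2) / 4 := by
    field_simp
    linear_combination hr
  rw [IsRoot.def, Pda_eq hα hu] at hx
  simp only [eval_sub, eval_mul, eval_pow, eval_X, eval_C] at hx
  set s : F := α * (-1 + r) / 2 with hs
  set t : F := α * (-1 - r) / 2 with ht
  set ρ : F := -(2 * δ + 3 * α) / (3 * α * r) with hρ
  have hδ : δ = -(3 * α / 2) * (1 + ρ * r) := by
    rw [hρ]
    field_simp
    ring
  have key : (1 - ρ) * (x - s) ^ 3 + (1 + ρ) * (x - t) ^ 3 = 0 := by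
    rw [hδ, hu'] at hx
    field_simp at hx
    rw [hs, ht]
    field_simp
    linear_combination 2 * hx
  have hst : t - s ≠ 0 := by
    have : t - s = -(α * r) := by
      rw [hs, ht]
      field_simp
      ring
    rw [this]
    exact neg_ne_zero.mpr (mul_ne_zero hα hr0)
  by_cases hxt : x - t = 0
  · left
    rw [hxt, show x - s = t - s by linear_combination hxt] at key
    have : (1 - ρ) * (t - s) ^ 3 = 0 := by linear_combination key
    have h1 : 1 - ρ = 0 := (mul_eq_zero.mp this).resolve_right (pow_ne_zero 3 hst)
    rw [hδ]
    linear_combination (3 * α / 2) * r * h1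
  · right
    have hk : (1 - ρ) * ((x - s) / (x - t)) ^ 3 + (1 + ρ) = 0 := by
      field_simp
      linear_combination key
    set κ : F := (x - s) / (x - t)
    have hκ : κ ^ 3 ≠ 1 := by
      intro h
      rw [h] at hk
      exact h2 (by linear_combination hk)
    refine ⟨κ, hκ, ?_⟩
    have hD : κ ^ 3 - 1 ≠ 0 := sub_ne_zero.mpr hκ
    have : (κ ^ 3 + 1) / (κ ^ 3 - 1) = ρ := by
      field_simp
      linear_combination hk
    rw [this, hδ]

theorem natDegree_Pda (q : ℕ) (δ α : F) : (Pda q δ α).natDegree = 3 := by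
  unfold Pda
  compute_degree!

end Cubic

section FiniteField

variable {F : Type*} [Field F] [Fintype F]

/-- A field whose order is `1` modulo `3` contains a primitive cube root of unity. -/
theorem exists_sq_add_self_add_one_eq_zero (h : 3 ∣ Fintype.card F - 1) :
    ∃ ω : F, ω ^ 2 + ω + 1 = 0 := by
  classical
  have : Fact (Nat.Prime 3) := ⟨Nat.prime_three⟩
  obtain ⟨x, hx⟩ := exists_prime_orderOf_dvd_card (G := Fˣ) 3 (by rwa [Fintype.card_units])
  refine ⟨x, ?_⟩
  have h1 : (x : F) ^ 3 = 1 := by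
    rw [← Units.val_pow_eq_pow_val, ← hx, pow_orderOf_eq_one, Units.val_one]
  have h2 : (x : F) - 1 ≠ 0 := by
    intro h0
    have : x = 1 := Units.ext (sub_eq_zero.mp h0)
    rw [this, orderOf_one] at hx
    norm_num at hx
  exact (mul_eq_zero.mp (show ((x : F) - 1) * (x ^ 2 + x + 1) = 0 by
    linear_combination h1)).resolve_left h2

/-- Elements of the subfield of order `q` are squares in the field of order `q ^ 2`. -/
theorem isSquare_of_pow_card_eq_self {q : ℕ} (hF : Fintype.card F = q ^ 2) (hodd : Odd q)
    {c : F} (hc : c ^ q = c) : IsSquare c := by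
  by_cases h0 : c = 0
  · exact h0 ▸ IsSquare.zero
  have hchar : ringChar F ≠ 2 := by
    intro h
    have := FiniteField.even_card_of_char_two h
    rw [hF, ← Nat.even_iff] at this
    exact (Nat.not_even_iff_odd.mpr hodd.pow) this
  rw [FiniteField.isSquare_iff hchar h0, hF]
  obtain ⟨k, rfl⟩ := hodd
  have h1 : c ^ (2 * k) = 1 := by
    apply mul_right_cancel₀ h0
    rw [← pow_succ, hc, one_mul]
  have h2 : (2 * k + 1) ^ 2 / 2 = 2 * k * (k + 1) := by
    rw [show (2 * k + 1) ^ 2 = 2 * (2 * k * (k + 1)) + 1 by ring]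
    omega
  rw [h2, pow_mul, h1, one_pow]

end FiniteField

/-- Lemma: `P_{δ,α}` is either irreducible over `𝔽_{q²}` or splits completely over `𝔽_{q²}`;
moreover it is reducible iff `α^{q+1} = 4`, or `δ = −(3α/2)(1 + r)` or
`δ = −(3α/2)(1 + ((κ³+1)/(κ³−1))r)` for some `κ` with `κ³ ≠ 1`,
where `r² = 1 − 4α^{−(q+1)}`. -/
theorem statement14 (p n q : ℕ) (hp : p.Prime) (hp3 : 3 < p) (hn : n ≠ 0) (hq : q = p ^ n)
    (F : Type*) [Field F] [Fintype F] (hF : Fintype.card F = q ^ 2)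
    (δ α : F) (hα : α ≠ 0) :
    (Irreducible (Pda q δ α) ∨
        ∃ τ σ ν : F, Pda q δ α = (X - C τ) * (X - C σ) * (X - C ν)) ∧
      (¬ Irreducible (Pda q δ α) ↔
        (α ^ (q + 1) = 4 ∨
          ∃ r : F, r ^ 2 = 1 - 4 * α ^ (-((q : ℤ) + 1)) ∧
            (δ = -(3 * α / 2) * (1 + r) ∨
              ∃ κ : F, κ ^ 3 ≠ 1 ∧
                δ = -(3 * α / 2) * (1 + ((κ ^ 3 + 1) / (κ ^ 3 - 1)) * r)))) := by
  have := Fact.mk hp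
  have hchar : CharP F p := by
    obtain ⟨p', hp'⟩ := CharP.exists F
    obtain ⟨m, hp'p, hm⟩ := FiniteField.card F p'
    have : p' ∣ p := by
      apply hp'p.dvd_of_dvd_pow (n := n * 2)
      rw [pow_mul, ← hq, ← hF, hm]
      exact dvd_pow_self _ m.pos.ne'
    rwa [← (Nat.prime_dvd_prime_iff_eq hp'p hp).mp this]
  have h2 : (2 : F) ≠ 0 := by
    intro h
    have := (CharP.cast_eq_zero_iff F p 2).mp (by exact_mod_cast h)
    have := Nat.le_of_dvd (by norm_num) this
    omega
  have h3 : (3 : F) ≠ 0 := by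
    intro h
    have := (CharP.cast_eq_zero_iff F p 3).mp (by exact_mod_cast h)
    have := Nat.le_of_dvd (by norm_num) this
    omega
  have hodd : Odd q := hq ▸ (hp.odd_of_ne_two (by omega)).pow
  obtain ⟨ω, hω⟩ : ∃ ω : F, ω ^ 2 + ω + 1 = 0 := by
    apply exists_sq_add_self_add_one_eq_zero
    have hq3 : ¬ 3 ∣ q := by
      rw [hq]
      intro h
      have := (Nat.prime_dvd_prime_iff_eq Nat.prime_three hp).mp
        (Nat.prime_three.dvd_of_dvd_pow h)
      omega
    rw [hF]
    refine (Nat.modEq_iff_dvd' (Nat.pos_of_ne_zero ?_)).mp ?_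
    · rintro h
      simp_all
    · rcases (by omega : q % 3 = 1 ∨ q % 3 = 2) with h | h <;>
        simp [Nat.ModEq, Nat.pow_mod, h]
  set u : F := α ^ (-((q : ℤ) + 1)) with hu
  have huN : α ^ (q + 1) * u = 1 := by
    rw [hu, ← zpow_natCast, ← zpow_add₀ hα]
    simp
  obtain ⟨r, hr⟩ : ∃ r : F, r ^ 2 = 1 - 4 * u := by
    have hNq : (α ^ (q + 1)) ^ q = α ^ (q + 1) := by
      rw [← pow_mul, add_mul, ← sq, one_mul, pow_add, ← hF, FiniteField.pow_card, pow_succ']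
    have huq : u ^ q = u := by
      apply mul_left_cancel₀ (pow_ne_zero (q + 1) hα)
      rw [huN, ← hNq, ← mul_pow, huN, one_pow]
    have hsub : (1 - 4 * u) ^ q = 1 - 4 * u := by
      have h4 : (4 : F) ^ q = 4 := by
        rw [hq]
        have := map_natCast (iterateFrobenius F p n) 4
        rw [iterateFrobenius_def] at this
        exact_mod_cast this
      calc (1 - 4 * u) ^ q = 1 ^ q - (4 * u) ^ q := by
            rw [hq]
            exact sub_pow_char_pow 1 (4 * u) n
        _ = 1 - 4 * u := by rw [one_pow, mul_pow, h4, huq]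
    obtain ⟨r, hr⟩ := isSquare_of_pow_card_eq_self hF hodd hsub
    exact ⟨r, by rw [hr, sq]⟩
  have hdeg := natDegree_Pda q δ α
  have hsplit : (α ^ (q + 1) = 4 ∨ ∃ r : F, r ^ 2 = 1 - 4 * u ∧
      (δ = -(3 * α / 2) * (1 + r) ∨ ∃ κ : F, κ ^ 3 ≠ 1 ∧
        δ = -(3 * α / 2) * (1 + ((κ ^ 3 + 1) / (κ ^ 3 - 1)) * r))) →
      ∃ τ σ ν : F, Pda q δ α = (X - C τ) * (X - C σ) * (X - C ν) := by
    rintro (h | ⟨r, hr, h | ⟨κ, hκ, h⟩⟩)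
    · exact Pda_splits_of_double_root h2 h3 hα (h ▸ huN)
    · exact Pda_splits_of_triple_root h2 h3 hα hu.symm hr h
    · exact Pda_splits_of_param h2 h3 hα hu.symm hr hω hκ h
  have hroot : ¬ Irreducible (Pda q δ α) → ∃ x, (Pda q δ α).IsRoot x := by
    rw [irreducible_iff_roots_eq_zero_of_degree_le_three (by omega) (by omega)]
    intro h
    obtain ⟨x, hx⟩ := Multiset.exists_mem_of_ne_zero h
    exact ⟨x, isRoot_of_mem_roots hx⟩
  have hparam : ¬ Irreducible (Pda q δ α) → (α ^ (q + 1) = 4 ∨ ∃ r : F, r ^ 2 = 1 - 4 * u ∧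
      (δ = -(3 * α / 2) * (1 + r) ∨ ∃ κ : F, κ ^ 3 ≠ 1 ∧
        δ = -(3 * α / 2) * (1 + ((κ ^ 3 + 1) / (κ ^ 3 - 1)) * r))) := by
    intro h
    obtain ⟨x, hx⟩ := hroot h
    by_cases hr0 : r = 0
    · left
      rw [hr0] at hr
      linear_combination 4 * huN - α ^ (q + 1) * hr
    · exact Or.inr ⟨r, hr, exists_param_of_root h2 h3 hα hu.symm hr hr0 hx⟩
  refine ⟨or_iff_not_imp_left.mpr fun h => hsplit (hparam h), hparam, fun h hirr => ?_⟩
  obtain ⟨τ, σ, ν, hP⟩ := hsplit h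
  refine hirr.not_isRoot_of_natDegree_ne_one (x := τ) (by omega) ?_
  simp [hP]
end
end
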